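/- arXiv:2204.03677 — 2 statements merged into one kernel-verified Lean document; each statement's English description precedes it below -/
import Mathlib

section
/- Assume the AG₂ setup below, and let κ_τ = 3 for τ ∈ {±2β₁, ±2β₂, ±2β₃} and κ_τ = 1 for τ ∈ {±2α₁, ±2α₂, ±2α₃}. Then for every x ∈ ℂ² such that ∑_{τ : τ/2 ∈ G₂} κ_τ·⟨τ,γ⟩·exp⟨x,τ⟩ ≠ 0 for each γ ∈ G₂₊, there exists a Baker–Akhiezer function for AG₂ at x. -/
noncomputable section

open Complex

/-- The bilinear extension of the Euclidean inner product on `ℂ²`. -/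
def bil (z w : Fin 2 → ℂ) : ℂ := z 0 * w 0 + z 1 * w 1

/-- `√3` as a complex number. -/
def rt3 : ℂ := (Real.sqrt 3 : ℝ)

def vα₁ : Fin 2 → ℂ := ![0, rt3]
def vα₂ : Fin 2 → ℂ := ![-(3/2), rt3 / 2]
def vα₃ : Fin 2 → ℂ := ![3/2, rt3 / 2]
def vβ₁ : Fin 2 → ℂ := ![1, 0]
def vβ₂ : Fin 2 → ℂ := ![1/2, rt3 / 2]
def vβ₃ : Fin 2 → ℂ := ![-(1/2), rt3 / 2]

/-- Positive roots of `G₂`: `α₁, α₂, α₃, β₁, β₂, β₃`. -/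
def G2plus : List (Fin 2 → ℂ) := [vα₁, vα₂, vα₃, vβ₁, vβ₂, vβ₃]
/-- The six short roots `±βᵢ` of `G₂`. -/
def shortRoots : List (Fin 2 → ℂ) := [vβ₁, vβ₂, vβ₃, -vβ₁, -vβ₂, -vβ₃]
/-- The six long roots `±αᵢ` of `G₂`. -/
def longRoots : List (Fin 2 → ℂ) := [vα₁, vα₂, vα₃, -vα₁, -vα₂, -vα₃]
/-- All twelve roots of `G₂`. -/
def G2all : List (Fin 2 → ℂ) := longRoots ++ shortRoots
/-- The twelve vectors `2γ`, `γ ∈ G₂`. -/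
def twoG2 : List (Fin 2 → ℂ) := G2all.map (fun γ => (2 : ℂ) • γ)
/-- The six vectors `±2βⱼ`. -/
def twoShort : List (Fin 2 → ℂ) := shortRoots.map (fun γ => (2 : ℂ) • γ)
/-- The six vectors `±2αⱼ`. -/
def twoLong : List (Fin 2 → ℂ) := longRoots.map (fun γ => (2 : ℂ) • γ)
/-- The six vectors `±4βⱼ`. -/
def fourShort : List (Fin 2 → ℂ) := shortRoots.map (fun γ => (4 : ℂ) • γ)
/-- The eighteen vectors `2γ`, `γ ∈ AG₂`. -/
def twoAG2 : List (Fin 2 → ℂ) := twoG2 ++ fourShort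

/-- The quasi-invariance conditions for the configuration `AG₂` with
multiplicities `m_{αᵢ} = m`, `m_{βᵢ} = 3m`, `m_{2βᵢ} = 1`. -/
def QuasiInvAG2 (m : ℕ) (ψ : (Fin 2 → ℂ) → ℂ) : Prop :=
  (∀ α ∈ [vα₁, vα₂, vα₃], ∀ s : ℕ, 1 ≤ s → s ≤ m →
    ∀ z : Fin 2 → ℂ, bil α z = 0 →
      ψ (z + (s : ℂ) • α) = ψ (z - (s : ℂ) • α)) ∧
  (∀ β ∈ [vβ₁, vβ₂, vβ₃], ∀ s : ℕ, ((1 ≤ s ∧ s ≤ 3 * m) ∨ s = 3 * m + 2) →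
    ∀ z : Fin 2 → ℂ, bil β z = 0 →
      ψ (z + (s : ℂ) • β) = ψ (z - (s : ℂ) • β))

/-- The linear form `z ↦ ⟨γ, z⟩` as a polynomial in `z₁, z₂`. -/
def linForm (γ : Fin 2 → ℂ) : MvPolynomial (Fin 2) ℂ :=
  MvPolynomial.C (γ 0) * MvPolynomial.X 0 + MvPolynomial.C (γ 1) * MvPolynomial.X 1

/-- The highest-order term `∏ᵢ ⟨αᵢ,z⟩^m ⟨βᵢ,z⟩^{3m} ⟨2βᵢ,z⟩` of the polynomial
part of the Baker–Akhiezer function for `AG₂`. -/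
def topTerm (m : ℕ) : MvPolynomial (Fin 2) ℂ :=
  (linForm vα₁ * linForm vα₂ * linForm vα₃) ^ m *
    (linForm vβ₁ * linForm vβ₂ * linForm vβ₃) ^ (3 * m) *
    (linForm ((2 : ℂ) • vβ₁) * linForm ((2 : ℂ) • vβ₂) * linForm ((2 : ℂ) • vβ₃))

/-- A Baker–Akhiezer function for `AG₂` at `x`. -/
def IsBAFunction (m : ℕ) (x : Fin 2 → ℂ) (ψ : (Fin 2 → ℂ) → ℂ) : Prop :=
  ∃ P : MvPolynomial (Fin 2) ℂ,
    P.totalDegree = 12 * m + 3 ∧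
    MvPolynomial.homogeneousComponent (12 * m + 3) P = topTerm m ∧
    (∀ z, ψ z = MvPolynomial.eval z P * Complex.exp (bil z x)) ∧
    QuasiInvAG2 m ψ

open scoped Classical in
/-- The constant `κ_τ`: `3` for `τ = ±2βⱼ` and `1` for `τ = ±2αⱼ`. -/
noncomputable def kap (τ : Fin 2 → ℂ) : ℂ := if τ ∈ twoShort then 3 else 1

/-- The sum `∑_{τ : τ/2 ∈ G₂} κ_τ ⟨τ,γ⟩ exp⟨x,τ⟩`. -/
noncomputable def cSum (x γ : Fin 2 → ℂ) : ℂ :=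
  (twoG2.map (fun τ => kap τ * bil τ γ * Complex.exp (bil x τ))).sum

open Filter Topology

namespace AG2

/-- `V` has at most a simple pole at `s`: `V p * (p - s)` extends to a function with value `r` and
derivative `d` at `s`. -/
def TL (V : ℂ → ℂ) (s r d : ℂ) : Prop :=
  ∃ w : ℂ → ℂ, (∀ᶠ p in 𝓝[≠] s, V p * (p - s) = w p) ∧ HasDerivAt w d s ∧ w s = r

lemma TL.add {V W : ℂ → ℂ} {s r d r' d' : ℂ} (h : TL V s r d) (h' : TL W s r' d') :
    TL (fun p => V p + W p) s (r + r') (d + d') := by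
  obtain ⟨w, h1, h2, h3⟩ := h
  obtain ⟨w', h1', h2', h3'⟩ := h'
  refine ⟨fun p => w p + w' p, ?_, h2.add h2', by simp [h3, h3']⟩
  filter_upwards [h1, h1'] with p hp hp'
  rw [← hp, ← hp']; ring

lemma TL.mul {V Φ : ℂ → ℂ} {s r d Φ' : ℂ} (h : TL V s r d) (h' : HasDerivAt Φ Φ' s) :
    TL (fun p => V p * Φ p) s (r * Φ s) (d * Φ s + r * Φ') := by
  obtain ⟨w, h1, h2, h3⟩ := h
  refine ⟨fun p => w p * Φ p, ?_, ?_, by simp [h3]⟩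
  · filter_upwards [h1] with p hp
    rw [← hp]; ring
  · subst h3
    exact h2.mul h'

lemma TL.congr {V W : ℂ → ℂ} {s r d : ℂ} (h : TL V s r d) (h' : ∀ p, W p = V p) :
    TL W s r d := by
  have : W = V := funext h'
  rwa [this]

lemma TL.of_cont {V : ℂ → ℂ} {s : ℂ} (h : ContinuousAt V s) : TL V s 0 (V s) := by
  refine ⟨fun p => V p * (p - s), by simp, ?_, by simp⟩
  rw [hasDerivAt_iff_tendsto_slope]
  have h1 : Tendsto V (𝓝[≠] s) (𝓝 (V s)) := h.tendsto.mono_left nhdsWithin_le_nhds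
  refine h1.congr' ?_
  filter_upwards [self_mem_nhdsWithin] with p hp
  have : p - s ≠ 0 := sub_ne_zero.mpr hp
  simp [slope_def_field]
  field_simp

/-- the basic simple pole -/
lemma TL.frac (u w : ℂ) : TL (fun p => (p + u) / (p + w)) (-w) (-w + u) 1 := by
  refine ⟨fun p => p + u, ?_, ?_, rfl⟩
  · filter_upwards [self_mem_nhdsWithin] with p hp
    have : p + w ≠ 0 := by
      intro h; exact hp (by simp; linear_combination h)
    field_simp
    ring
  · exact (hasDerivAt_id' _).add_const _

lemma TL.tendsto {V : ℂ → ℂ} {s d : ℂ} (h : TL V s 0 d) : Tendsto V (𝓝[≠] s) (𝓝 d) := by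
  obtain ⟨w, h1, h2, h3⟩ := h
  rw [hasDerivAt_iff_tendsto_slope] at h2
  refine h2.congr' ?_
  filter_upwards [h1, self_mem_nhdsWithin] with p hp hps
  have : p - s ≠ 0 := sub_ne_zero.mpr hps
  rw [slope_def_field, h3, ← hp]
  field_simp
  ring

lemma tendsto_neg_punct (s : ℂ) : Tendsto (fun p : ℂ => -p) (𝓝[≠] s) (𝓝[≠] (-s)) := by
  refine tendsto_nhdsWithin_iff.mpr ⟨?_, ?_⟩
  · exact (continuous_neg.tendsto s).mono_left nhdsWithin_le_nhds
  · filter_upwards [self_mem_nhdsWithin] with p hp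
    simpa using hp

lemma TL.comp_neg {V : ℂ → ℂ} {s r d : ℂ} (h : TL V (-s) r d) :
    TL (fun p => V (-p)) s (-r) d := by
  obtain ⟨w, h1, h2, h3⟩ := h
  refine ⟨fun p => - w (-p), ?_, ?_, by simp [h3]⟩
  · filter_upwards [(tendsto_neg_punct s).eventually h1] with p hp
    rw [← hp]; ring
  · have h4 : HasDerivAt (fun p : ℂ => -p) (-1) s := (hasDerivAt_id' s).neg
    have h5 : HasDerivAt (fun p => w (-p)) (d * -1) s := h2.comp s h4
    have h6 : HasDerivAt (fun p => - w (-p)) (-(d * -1)) s := h5.neg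
    rwa [show -(d * -1) = d by ring] at h6

lemma limE {V : ℂ → ℂ} {s r d d' : ℂ} (h : TL V s r d) (h' : TL V (-s) r d') :
    ∃ L, Tendsto (fun p => V p + V (-p)) (𝓝[≠] s) (𝓝 L) := by
  have := h.add h'.comp_neg
  rw [add_neg_cancel] at this
  exact ⟨_, this.tendsto⟩

lemma limO {V : ℂ → ℂ} {s d : ℂ} (h : TL V s 0 d) (h' : TL V (-s) 0 d) :
    Tendsto (fun p => V p - V (-p)) (𝓝[≠] s) (𝓝 0) := by
  have h2 : Tendsto (fun p => V (-p)) (𝓝[≠] s) (𝓝 d) := h'.tendsto.comp (tendsto_neg_punct s)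
  simpa using h.tendsto.sub h2

/-! ### one-variable coefficient functions -/

def c1 (m t : ℂ) : ℂ := (t + -m) / (t + 0)
def c2 (m t : ℂ) : ℂ := (t + -m) / (t + 0) * ((t + (1 - m)) / (t + 1))
def e1 (m t : ℂ) : ℂ :=
  (t + -(3 * m)) / (t + 0) * ((t + -(3 * m + 2)) / (t + -1)) * ((t + (3 * m + 2)) / (t + 2))
def e2 (m t : ℂ) : ℂ := (t + (1 - 3 * m)) / (t + 0) * ((t + -(3 * m + 2)) / (t + 1))
def e3 (m t : ℂ) : ℂ :=
  (t + -(3 * m)) / (t + 0) * ((t + (2 - 3 * m)) / (t + 1)) * ((t + -(3 * m + 2)) / (t + 2))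

lemma da_frac {u w s : ℂ} (h : s + w ≠ 0) :
    DifferentiableAt ℂ (fun p => (p + u) / (p + w)) s := by
  fun_prop (disch := exact h)

lemma da_c1 {m s : ℂ} (h : s ≠ 0) : DifferentiableAt ℂ (c1 m) s :=
  da_frac (by simpa using h)
lemma da_c2 {m s : ℂ} (h : s ≠ 0) (h1 : s + 1 ≠ 0) : DifferentiableAt ℂ (c2 m) s :=
  (da_frac (by simpa using h)).mul (da_frac h1)
lemma da_e1 {m s : ℂ} (h : s ≠ 0) (h1 : s + -1 ≠ 0) (h2 : s + 2 ≠ 0) :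
    DifferentiableAt ℂ (e1 m) s :=
  ((da_frac (by simpa using h)).mul (da_frac h1)).mul (da_frac h2)
lemma da_e2 {m s : ℂ} (h : s ≠ 0) (h1 : s + 1 ≠ 0) : DifferentiableAt ℂ (e2 m) s :=
  (da_frac (by simpa using h)).mul (da_frac h1)
lemma da_e3 {m s : ℂ} (h : s ≠ 0) (h1 : s + 1 ≠ 0) (h2 : s + 2 ≠ 0) :
    DifferentiableAt ℂ (e3 m) s :=
  ((da_frac (by simpa using h)).mul (da_frac h1)).mul (da_frac h2)

/-- `κ` has at most a simple pole at `s`, with residue `r`. -/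
def HasPole (κ : ℂ → ℂ) (s r : ℂ) : Prop := ∃ d, TL κ s r d

lemma HasPole.mk' {u w s : ℂ} {Φ κ : ℂ → ℂ} (hs : s = -w)
    (hΦ : DifferentiableAt ℂ Φ s) (hκ : ∀ p, κ p = (p + u) / (p + w) * Φ p) (r : ℂ)
    (hr : r = (-w + u) * Φ s) : HasPole κ s r := by
  subst hs
  subst hr
  exact ⟨_, TL.congr ((TL.frac u w).mul hΦ.hasDerivAt) hκ⟩

lemma pole_c1_0 (m : ℂ) : HasPole (c1 m) 0 (-m) :=
  HasPole.mk' (u := -m) (w := 0) (Φ := fun _ => 1) (by simp) (by fun_prop)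
    (by intro p; simp [c1]) _ (by simp)

lemma pole_c2_0 (m : ℂ) : ∃ r, HasPole (c2 m) 0 r :=
  ⟨_, HasPole.mk' (u := -m) (w := 0) (Φ := fun t => (t + (1 - m)) / (t + 1)) (by simp)
    (da_frac (by simp)) (by intro p; simp [c2]) _ rfl⟩
lemma pole_c2_1 (m : ℂ) : ∃ r, HasPole (c2 m) (-1) r :=
  ⟨_, HasPole.mk' (u := 1 - m) (w := 1) (Φ := fun t => (t + -m) / (t + 0)) (by simp)
    (da_frac (by simp)) (by intro p; simp [c2]; ring) _ rfl⟩
lemma pole_e2_0 (m : ℂ) : ∃ r, HasPole (e2 m) 0 r :=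
  ⟨_, HasPole.mk' (u := 1 - 3 * m) (w := 0) (Φ := fun t => (t + -(3 * m + 2)) / (t + 1)) (by simp)
    (da_frac (by simp)) (by intro p; simp [e2]) _ rfl⟩
lemma pole_e2_1 (m : ℂ) : ∃ r, HasPole (e2 m) (-1) r :=
  ⟨_, HasPole.mk' (u := -(3 * m + 2)) (w := 1) (Φ := fun t => (t + (1 - 3 * m)) / (t + 0))
    (by simp) (da_frac (by simp)) (by intro p; simp [e2]; ring) _ rfl⟩
lemma pole_e1_0 (m : ℂ) : ∃ r, HasPole (e1 m) 0 r :=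
  ⟨_, HasPole.mk' (u := -(3 * m)) (w := 0)
    (Φ := fun t => ((t + -(3 * m + 2)) / (t + -1)) * ((t + (3 * m + 2)) / (t + 2))) (by simp)
    ((da_frac (by simp)).mul (da_frac (by simp))) (by intro p; simp [e1]; ring) _ rfl⟩
lemma pole_e1_1 (m : ℂ) :
    HasPole (e1 m) 1 (-((1 - 3 * m) * (1 + 3 * m) * (3 * m + 3) / 3)) :=
  HasPole.mk' (u := -(3 * m + 2)) (w := -1)
    (Φ := fun t => ((t + -(3 * m)) / (t + 0)) * ((t + (3 * m + 2)) / (t + 2))) (by simp)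
    ((da_frac (by simp)).mul (da_frac (by norm_num)))
    (by intro p; simp [e1]; ring) _ (by ring)
lemma pole_e1_2 (m : ℂ) :
    HasPole (e1 m) (-2) (3 * m * (3 * m + 2) * (3 * m + 4) / 6) :=
  HasPole.mk' (u := 3 * m + 2) (w := 2)
    (Φ := fun t => ((t + -(3 * m)) / (t + 0)) * ((t + -(3 * m + 2)) / (t + -1))) (by simp)
    ((da_frac (by simp)).mul (da_frac (by norm_num)))
    (by intro p; simp [e1]; ring) _ (by ring)
lemma pole_e3_0 (m : ℂ) : ∃ r, HasPole (e3 m) 0 r :=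
  ⟨_, HasPole.mk' (u := -(3 * m)) (w := 0)
    (Φ := fun t => ((t + (2 - 3 * m)) / (t + 1)) * ((t + -(3 * m + 2)) / (t + 2))) (by simp)
    ((da_frac (by simp)).mul (da_frac (by simp))) (by intro p; simp [e3]; ring) _ rfl⟩
lemma pole_e3_1 (m : ℂ) :
    HasPole (e3 m) (-1) (-((1 - 3 * m) * (1 + 3 * m) * (3 * m + 3))) :=
  HasPole.mk' (u := 2 - 3 * m) (w := 1)
    (Φ := fun t => ((t + -(3 * m)) / (t + 0)) * ((t + -(3 * m + 2)) / (t + 2))) (by simp)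
    ((da_frac (by simp)).mul (da_frac (by norm_num)))
    (by intro p; simp [e3]; ring) _ (by ring)
lemma pole_e3_2 (m : ℂ) :
    HasPole (e3 m) (-2) (-(3 * m * (3 * m + 2) * (3 * m + 4) / 2)) :=
  HasPole.mk' (u := -(3 * m + 2)) (w := 2)
    (Φ := fun t => ((t + -(3 * m)) / (t + 0)) * ((t + (2 - 3 * m)) / (t + 1))) (by simp)
    ((da_frac (by simp)).mul (da_frac (by norm_num)))
    (by intro p; simp [e3]; ring) _ (by ring)

lemma HasPole.of_da {κ : ℂ → ℂ} {s : ℂ} (h : DifferentiableAt ℂ κ s) : HasPole κ s 0 :=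
  ⟨_, TL.of_cont h.continuousAt⟩

lemma HasPole.mul {κ Φ : ℂ → ℂ} {s r : ℂ} (h : HasPole κ s r) (h' : DifferentiableAt ℂ Φ s) :
    HasPole (fun p => κ p * Φ p) s (r * Φ s) := by
  obtain ⟨d, hd⟩ := h
  exact ⟨_, hd.mul h'.hasDerivAt⟩

lemma HasPole.add {V W : ℂ → ℂ} {s r r' : ℂ} (h : HasPole V s r) (h' : HasPole W s r') :
    HasPole (fun p => V p + W p) s (r + r') := by
  obtain ⟨d, hd⟩ := h
  obtain ⟨d', hd'⟩ := h'
  exact ⟨_, hd.add hd'⟩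

/-- product with a function vanishing at the pole -/
lemma HasPole.mul_zero {κ l Φ : ℂ → ℂ} {s r Φ' : ℂ} (h : HasPole κ s r)
    (hl : DifferentiableAt ℂ l s) (hΦ : HasDerivAt Φ Φ' s) (h0 : Φ s = 0) :
    TL (fun p => κ p * l p * Φ p) s 0 (r * l s * Φ') := by
  obtain ⟨d, hd⟩ := h
  have := (hd.mul hl.hasDerivAt).mul hΦ
  rw [h0] at this
  simpa using this

lemma limE' {V : ℂ → ℂ} {s r : ℂ} (h : HasPole V s r) (h' : HasPole V (-s) r) :
    ∃ L, Tendsto (fun p => V p + V (-p)) (𝓝[≠] s) (𝓝 L) := by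
  obtain ⟨d, hd⟩ := h
  obtain ⟨d', hd'⟩ := h'
  exact limE hd hd'


/-! ### one-dimensional cancellation of poles -/

/-- integers (with signs, and zero) at which the quasi-invariance along short roots is imposed -/
def inB (m : ℕ) (s : ℤ) : Prop := |s| ≤ 3 * m ∨ |s| = 3 * m + 2
/-- the same for long roots -/
def inA (m : ℕ) (s : ℤ) : Prop := |s| ≤ m

lemma inB_neg {m : ℕ} {s : ℤ} (h : inB m s) : inB m (-s) := by simpa [inB] using h
lemma inA_neg {m : ℕ} {s : ℤ} (h : inA m s) : inA m (-s) := by simpa [inA] using h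

lemma num_e3 {m : ℕ} (hm : 1 ≤ m) {s : ℤ} (h : inB m s) : inB m (s + 3) ∨ e3 m s = 0 := by
  by_cases h' : inB m (s + 3)
  · exact Or.inl h'
  right
  have : s = 3 * m ∨ s = 3 * m - 2 ∨ s = 3 * m + 2 := by
    unfold inB at h h'
    rw [abs_le, abs_eq (by omega)] at h h'
    omega
  rcases this with rfl | rfl | rfl <;> simp [e3]

lemma num_e1 {m : ℕ} (hm : 1 ≤ m) {s : ℤ} (h : inB m s) : inB m (s + 1) ∨ e1 m s = 0 := by
  by_cases h' : inB m (s + 1)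
  · exact Or.inl h'
  right
  have : s = 3 * m ∨ s = -(3 * m + 2) ∨ s = 3 * m + 2 := by
    unfold inB at h h'
    rw [abs_le, abs_eq (by omega)] at h h'
    omega
  rcases this with rfl | rfl | rfl <;> simp [e1]

lemma num_e2 {m : ℕ} (hm : 1 ≤ m) {s : ℤ} (h : inB m s) : inB m (s + 2) ∨ e2 m s = 0 := by
  by_cases h' : inB m (s + 2)
  · exact Or.inl h'
  right
  have : s = 3 * m - 1 ∨ s = 3 * m + 2 := by
    unfold inB at h h'
    rw [abs_le, abs_eq (by omega)] at h h'
    omega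
  rcases this with rfl | rfl <;> simp [e2]

lemma num_c1 {m : ℕ} {s : ℤ} (h : inA m s) : inA m (s + 1) ∨ c1 m s = 0 := by
  by_cases h' : inA m (s + 1)
  · exact Or.inl h'
  right
  have : s = m := by
    unfold inA at h h'
    rw [abs_le] at h h'
    omega
  subst this; simp [c1]

lemma num_c2 {m : ℕ} (hm : 1 ≤ m) {s : ℤ} (h : inA m s) : inA m (s + 2) ∨ c2 m s = 0 := by
  by_cases h' : inA m (s + 2)
  · exact Or.inl h'
  right
  have : s = m ∨ s = m - 1 := by
    unfold inA at h h'
    rw [abs_le] at h h'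
    omega
  rcases this with rfl | rfl <;> simp [c2]

lemma deriv_even_of_odd {F : ℂ → ℂ} (h : ∀ p, F (-p) = - F p) (x : ℂ) :
    deriv F (-x) = deriv F x := by
  have h1 : deriv (fun p => F (-p)) x = - deriv F (-x) := deriv_comp_neg F x
  have h2 : (fun p => F (-p)) = fun p => - F p := funext h
  rw [h2, deriv.fun_neg] at h1
  linear_combination h1

/-- `F (p + c) - G p` -/
lemma hd_sub {F G : ℂ → ℂ} (hF : Differentiable ℂ F) (hG : Differentiable ℂ G) (c s : ℂ) :
    HasDerivAt (fun p => F (p + c) - G p) (deriv F (s + c) - deriv G s) s := by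
  have h1 : HasDerivAt (fun p => F (p + c)) (deriv F (s + c)) s :=
    (hF (s + c)).hasDerivAt.comp_add_const s c
  exact h1.sub (hG s).hasDerivAt

lemma HasPole.cast {V : ℂ → ℂ} {s r r' : ℂ} (h : HasPole V s r) (e : r' = r) : HasPole V s r' :=
  e ▸ h
lemma TL.cast {V : ℂ → ℂ} {s r d d' : ℂ} (h : TL V s r d) (e : d' = d) : TL V s r d' :=
  e ▸ h

section one_dim
variable {F G k l : ℂ → ℂ}

/-- the half of the terms with shifts `±1, ±3` -/
def WB (m : ℂ) (F G k l : ℂ → ℂ) (p : ℂ) : ℂ :=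
  e3 m p * l p * (F (p + 3) - G p) + e1 m p * k p * (F (p + 1) - G p)

lemma gen_term {κ : ℂ → ℂ} {s r : ℂ} (c : ℂ) (hF : Differentiable ℂ F) (hG : Differentiable ℂ G)
    (hk : DifferentiableAt ℂ k s) (hκ : HasPole κ s r) :
    HasPole (fun p => κ p * k p * (F (p + c) - G p)) s (r * k s * (F (s + c) - G s)) :=
  (hκ.mul hk).mul (hd_sub hF hG c s).differentiableAt

lemma reg_term {κ : ℂ → ℂ} {s : ℂ} (c : ℂ) (hF : Differentiable ℂ F) (hG : Differentiable ℂ G)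
    (hk : DifferentiableAt ℂ k s) (hκ : DifferentiableAt ℂ κ s) :
    TL (fun p => κ p * k p * (F (p + c) - G p)) s 0 (κ s * k s * (F (s + c) - G s)) :=
  TL.of_cont ((hκ.mul hk).mul (hd_sub hF hG c s).differentiableAt).continuousAt

lemma pole_term {κ : ℂ → ℂ} {s r : ℂ} (c : ℂ) (hF : Differentiable ℂ F) (hG : Differentiable ℂ G)
    (hk : DifferentiableAt ℂ k s) (hκ : HasPole κ s r) (h0 : F (s + c) - G s = 0) :
    TL (fun p => κ p * k p * (F (p + c) - G p)) s 0
      (r * k s * (deriv F (s + c) - deriv G s)) :=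
  hκ.mul_zero hk (hd_sub hF hG c s) h0

lemma nat_ge3 {s : ℕ} (hs : 3 ≤ s) (j : ℤ) (hj : |j| ≤ 2) : (s : ℂ) + j ≠ 0 ∧ -(s : ℂ) + j ≠ 0 := by
  rw [abs_le] at hj
  constructor
  · intro h
    have : (s : ℤ) + j = 0 := by exact_mod_cast h
    omega
  · intro h
    have : -(s : ℤ) + j = 0 := by exact_mod_cast h
    omega

lemma WB_even (m : ℕ) (hF : Differentiable ℂ F) (hG : Differentiable ℂ G)
    (eF : ∀ p, F (-p) = F p) (eG : ∀ p, G (-p) = G p) (s : ℕ)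
    (hk : DifferentiableAt ℂ k s) (hk' : DifferentiableAt ℂ k (-s))
    (hl : DifferentiableAt ℂ l s) (hl' : DifferentiableAt ℂ l (-s))
    (h1 : k 1 = 3 * l (-1)) (h2 : k (-2) = 3 * l (-2)) :
    ∃ L, Tendsto (fun p => WB m F G k l p + WB m F G k l (-p)) (𝓝[≠] (s : ℂ)) (𝓝 L) := by
  obtain rfl | rfl | rfl | hs : s = 0 ∨ s = 1 ∨ s = 2 ∨ 3 ≤ s := by omega
  · obtain ⟨r, hr⟩ := pole_e3_0 m
    obtain ⟨r', hr'⟩ := pole_e1_0 m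
    simp only [Nat.cast_zero, neg_zero] at *
    have := (gen_term 3 hF hG hl hr).add (gen_term 1 hF hG hk hr')
    exact limE' this (by rw [neg_zero]; exact this)
  · simp only [Nat.cast_one] at *
    have a1 := (gen_term 3 hF hG hl (HasPole.of_da (da_e3 (m := m) (s := 1) (by norm_num)
      (by norm_num) (by norm_num)))).add (gen_term 1 hF hG hk (pole_e1_1 m))
    have a2 := (gen_term 3 hF hG hl' (pole_e3_1 m)).add (gen_term 1 hF hG hk'
      (HasPole.of_da (da_e1 (m := m) (s := -1) (by norm_num) (by norm_num) (by norm_num))))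
    refine limE' a1 (HasPole.cast a2 ?_)
    rw [h1, eG 1, show (-1 : ℂ) + 3 = 2 by norm_num, show (1 : ℂ) + 1 = 2 by norm_num]
    ring
  · simp only [Nat.cast_ofNat] at *
    have a1 := (gen_term 3 hF hG hl (HasPole.of_da (da_e3 (m := m) (s := 2) (by norm_num)
      (by norm_num) (by norm_num)))).add (gen_term 1 hF hG hk
      (HasPole.of_da (da_e1 (m := m) (s := 2) (by norm_num) (by norm_num) (by norm_num))))
    have a2 := (gen_term 3 hF hG hl' (pole_e3_2 m)).add (gen_term 1 hF hG hk' (pole_e1_2 m))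
    refine limE' a1 (HasPole.cast a2 ?_)
    rw [h2, show (-2 : ℂ) + 1 = -1 by norm_num, show (-2 : ℂ) + 3 = 1 by norm_num, eF 1]
    ring
  · have z0 := nat_ge3 hs 0 (by simp)
    have z1 := nat_ge3 hs 1 (by simp)
    have z1' := nat_ge3 hs (-1) (by simp)
    have z2 := nat_ge3 hs 2 (by simp)
    push_cast at z0 z1 z1' z2
    simp only [add_zero] at z0
    have a1 := (gen_term 3 hF hG hl (HasPole.of_da (da_e3 (m := m) z0.1 z1.1 z2.1))).add
      (gen_term 1 hF hG hk (HasPole.of_da (da_e1 (m := m) z0.1 z1'.1 z2.1)))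
    have a2 := (gen_term 3 hF hG hl' (HasPole.of_da (da_e3 (m := m) z0.2 z1.2 z2.2))).add
      (gen_term 1 hF hG hk' (HasPole.of_da (da_e1 (m := m) z0.2 z1'.2 z2.2)))
    refine limE' a1 (HasPole.cast a2 ?_)
    ring

/-- a regular term vanishes -/
lemma reg_zero {P : ℤ → Prop} {κ : ℂ → ℂ} {s c : ℤ} {x y : ℂ}
    (vF : ∀ j : ℤ, P j → F j = 0) (vG : ∀ j : ℤ, P j → G j = 0) (hs : P s)
    (h : P (s + c) ∨ κ s = 0) (hx : x = s) (hy : y = c) :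
    κ x * k x * (F (x + y) - G x) = 0 := by
  subst hx hy
  rcases h with h | h
  · have := vF _ h
    push_cast at this
    rw [this, vG _ hs]; ring
  · rw [h]; ring

lemma WB_odd {m : ℕ} (hm : 1 ≤ m) (hF : Differentiable ℂ F) (hG : Differentiable ℂ G)
    (oF : ∀ p, F (-p) = - F p) (oG : ∀ p, G (-p) = - G p)
    (vF : ∀ j : ℤ, inB m j → F j = 0) (vG : ∀ j : ℤ, inB m j → G j = 0) (s : ℕ)
    (hs : inB m s)
    (hk : DifferentiableAt ℂ k s) (hk' : DifferentiableAt ℂ k (-s))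
    (hl : DifferentiableAt ℂ l s) (hl' : DifferentiableAt ℂ l (-s))
    (h1 : k 1 = 3 * l (-1)) (h2 : k (-2) = 3 * l (-2)) :
    Tendsto (fun p => WB m F G k l p - WB m F G k l (-p)) (𝓝[≠] (s : ℂ)) (𝓝 0) := by
  have small : ∀ j : ℤ, |j| ≤ 3 → inB m j := fun j hj => Or.inl (by omega)
  have sF : ∀ j : ℤ, |j| ≤ 3 → F j = 0 := fun j hj => vF j (small j hj)
  have sG : ∀ j : ℤ, |j| ≤ 3 → G j = 0 := fun j hj => vG j (small j hj)
  have F0 := sF 0 (by norm_num)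
  have F1 := sF 1 (by norm_num)
  have F2 := sF 2 (by norm_num)
  have F3 := sF 3 (by norm_num)
  have F1' := sF (-1) (by norm_num)
  have G0 := sG 0 (by norm_num)
  have G1 := sG 1 (by norm_num)
  have G2 := sG 2 (by norm_num)
  have G1' := sG (-1) (by norm_num)
  have G2' := sG (-2) (by norm_num)
  push_cast at F0 F1 F2 F3 F1' G0 G1 G2 G1' G2'
  have rz := fun (κ k : ℂ → ℂ) (s c : ℤ) (x y : ℂ) => reg_zero (k := k) (κ := κ) (s := s) (c := c)
    (x := x) (y := y) vF vG
  obtain rfl | rfl | rfl | h3 : s = 0 ∨ s = 1 ∨ s = 2 ∨ 3 ≤ s := by omega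
  · obtain ⟨r, hr⟩ := pole_e3_0 m
    obtain ⟨r', hr'⟩ := pole_e1_0 m
    simp only [Nat.cast_zero, neg_zero] at *
    have := (pole_term 3 hF hG hl hr (by simp [F3, G0])).add
      (pole_term 1 hF hG hk hr' (by simp [F1, G0]))
    rw [add_zero] at this
    exact limO this (by rw [neg_zero]; exact this)
  · simp only [Nat.cast_one] at *
    have a1 := (reg_term 3 hF hG hl (da_e3 (m := m) (s := 1) (by norm_num)
      (by norm_num) (by norm_num))).add
      (pole_term 1 hF hG hk (pole_e1_1 m) (by norm_num [F2, G1]))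
    have a2 := (pole_term 3 hF hG hl' (pole_e3_1 m) (by norm_num [F2, G1'])).add
      (reg_term 1 hF hG hk' (da_e1 (m := m) (s := -1) (by norm_num) (by norm_num) (by norm_num)))
    rw [add_zero] at a1 a2
    refine limO a1 (TL.cast a2 ?_)
    rw [rz (e3 m) l 1 3 1 3 hs (num_e3 hm hs) (by simp) (by simp),
      rz (e1 m) k (-1) 1 (-1) 1 (inB_neg hs) (num_e1 hm (inB_neg hs)) (by simp) (by simp),
      h1, deriv_even_of_odd oG, show (-1 : ℂ) + 3 = 2 by norm_num,
      show (1 : ℂ) + 1 = 2 by norm_num]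
    ring
  · simp only [Nat.cast_ofNat] at *
    have a1 := (reg_term 3 hF hG hl (da_e3 (m := m) (s := 2) (by norm_num)
      (by norm_num) (by norm_num))).add (reg_term 1 hF hG hk
      (da_e1 (m := m) (s := 2) (by norm_num) (by norm_num) (by norm_num)))
    have a2 := (pole_term 3 hF hG hl' (pole_e3_2 m) (by norm_num [F1, G2'])).add
      (pole_term 1 hF hG hk' (pole_e1_2 m) (by norm_num [F1', G2']))
    rw [add_zero] at a1 a2
    refine limO a1 (TL.cast a2 ?_)
    rw [rz (e3 m) l 2 3 2 3 hs (num_e3 hm hs) (by simp) (by simp),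
      rz (e1 m) k 2 1 2 1 hs (num_e1 hm hs) (by simp) (by simp),
      h2, show (-2 : ℂ) + 1 = -1 by norm_num, show (-2 : ℂ) + 3 = 1 by norm_num,
      deriv_even_of_odd oF]
    ring
  · have z0 := nat_ge3 h3 0 (by simp)
    have z1 := nat_ge3 h3 1 (by simp)
    have z1' := nat_ge3 h3 (-1) (by simp)
    have z2 := nat_ge3 h3 2 (by simp)
    push_cast at z0 z1 z1' z2
    simp only [add_zero] at z0
    have a1 := (reg_term 3 hF hG hl (da_e3 (m := m) z0.1 z1.1 z2.1)).add
      (reg_term 1 hF hG hk (da_e1 (m := m) z0.1 z1'.1 z2.1))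
    have a2 := (reg_term 3 hF hG hl' (da_e3 (m := m) z0.2 z1.2 z2.2)).add
      (reg_term 1 hF hG hk' (da_e1 (m := m) z0.2 z1'.2 z2.2))
    rw [add_zero] at a1 a2
    refine limO a1 (TL.cast a2 ?_)
    rw [rz (e3 m) l s 3 s 3 hs (num_e3 hm hs) (by simp) (by simp),
      rz (e1 m) k s 1 s 1 hs (num_e1 hm hs) (by simp) (by simp),
      rz (e3 m) l (-s) 3 (-s) 3 (inB_neg hs) (num_e3 hm (inB_neg hs)) (by simp) (by simp),
      rz (e1 m) k (-s) 1 (-s) 1 (inB_neg hs) (num_e1 hm (inB_neg hs)) (by simp) (by simp)]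

/-- terms with shift `2` whose coefficient has simple poles at `0` and `-1` only -/
lemma two_even {κ : ℂ → ℂ} (h0 : ∃ r, HasPole κ 0 r) (h1 : ∃ r, HasPole κ (-1) r)
    (hκ : ∀ s : ℂ, s ≠ 0 → s + 1 ≠ 0 → DifferentiableAt ℂ κ s)
    (hF : Differentiable ℂ F) (eF : ∀ p, F (-p) = F p) (s : ℕ)
    (hk : DifferentiableAt ℂ k s) (hk' : DifferentiableAt ℂ k (-s)) :
    ∃ L, Tendsto (fun p => κ p * k p * (F (p + 2) - F p) +
      κ (-p) * k (-p) * (F (-p + 2) - F (-p))) (𝓝[≠] (s : ℂ)) (𝓝 L) := by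
  obtain rfl | rfl | hs : s = 0 ∨ s = 1 ∨ 2 ≤ s := by omega
  · obtain ⟨r, hr⟩ := h0
    simp only [Nat.cast_zero, neg_zero] at *
    have := gen_term 2 hF hF hk hr
    exact limE' this (by simpa using this)
  · obtain ⟨r, hr⟩ := h1
    simp only [Nat.cast_one] at *
    have a1 := gen_term 2 hF hF hk (HasPole.of_da (hκ 1 (by norm_num) (by norm_num)))
    have a2 := gen_term 2 hF hF hk' hr
    refine limE' a1 ?_
    convert a2 using 1
    rw [show (-1 : ℂ) + 2 = 1 by norm_num, eF 1]
    ring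
  · have e : (s : ℂ) ≠ 0 := by exact_mod_cast (by omega : s ≠ 0)
    have e1 : (s : ℂ) + 1 ≠ 0 := by exact_mod_cast (by omega : s + 1 ≠ 0)
    have e2 : -(s : ℂ) + 1 ≠ 0 := by
      intro h
      have : -(s : ℤ) + 1 = 0 := by exact_mod_cast h
      omega
    have a1 := gen_term 2 hF hF hk (HasPole.of_da (hκ s e e1))
    have a2 := gen_term 2 hF hF hk' (HasPole.of_da (hκ (-s) (neg_ne_zero.mpr e) e2))
    refine limE' a1 ?_
    convert a2 using 1
    ring

lemma two_odd {P : ℤ → Prop} {κ : ℂ → ℂ} (h0 : ∃ r, HasPole κ 0 r ∧ (r = 0 ∨ P 2))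
    (h1 : ∃ r, HasPole κ (-1) r)
    (hκ : ∀ s : ℂ, s ≠ 0 → s + 1 ≠ 0 → DifferentiableAt ℂ κ s)
    (P0 : P 0) (P1 : P 1) (Pn : ∀ s, P s → P (-s)) (num : ∀ s, P s → P (s + 2) ∨ κ s = 0)
    (hF : Differentiable ℂ F) (oF : ∀ p, F (-p) = - F p)
    (vF : ∀ j : ℤ, P j → F j = 0) (s : ℕ) (hs : P s)
    (hk : DifferentiableAt ℂ k s) (hk' : DifferentiableAt ℂ k (-s)) :
    Tendsto (fun p => κ p * k p * (F (p + 2) - F p) -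
      κ (-p) * k (-p) * (F (-p + 2) - F (-p))) (𝓝[≠] (s : ℂ)) (𝓝 0) := by
  have F0 := vF 0 P0
  have F1 := vF 1 P1
  have F1' := vF (-1) (Pn _ P1)
  push_cast at F0 F1 F1'
  have rz := fun (s c : ℤ) (x y : ℂ) => reg_zero (k := k) (κ := κ) (s := s) (c := c)
    (x := x) (y := y) vF vF
  obtain rfl | rfl | h2 : s = 0 ∨ s = 1 ∨ 2 ≤ s := by omega
  · obtain ⟨r, hr, hr2⟩ := h0
    simp only [Nat.cast_zero, neg_zero] at *
    obtain ⟨d, hd⟩ : ∃ d, TL (fun p => κ p * k p * (F (p + 2) - F p)) 0 0 d := by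
      rcases hr2 with rfl | hr2
      · obtain ⟨d, hd⟩ := gen_term 2 hF hF hk hr
        exact ⟨d, by simpa using hd⟩
      · have F2 := vF 2 hr2
        push_cast at F2
        exact ⟨_, pole_term 2 hF hF hk hr (by simp [F2, F0])⟩
    exact limO hd (by rw [neg_zero]; exact hd)
  · obtain ⟨r, hr⟩ := h1
    simp only [Nat.cast_one] at *
    have a1 := reg_term 2 hF hF hk (hκ 1 (by norm_num) (by norm_num))
    have a2 := pole_term 2 hF hF hk' hr (by norm_num [F1, F1'])
    refine limO a1 (TL.cast a2 ?_)
    rw [rz 1 2 1 2 hs (num _ hs) (by simp) (by simp), show (-1 : ℂ) + 2 = 1 by norm_num,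
      deriv_even_of_odd oF]
    ring
  · have e : (s : ℂ) ≠ 0 := by exact_mod_cast (by omega : s ≠ 0)
    have e1 : (s : ℂ) + 1 ≠ 0 := by exact_mod_cast (by omega : s + 1 ≠ 0)
    have e2 : -(s : ℂ) + 1 ≠ 0 := by
      intro h
      have : -(s : ℤ) + 1 = 0 := by exact_mod_cast h
      omega
    have a1 := reg_term 2 hF hF hk (hκ s e e1)
    have a2 := reg_term 2 hF hF hk' (hκ (-s) (neg_ne_zero.mpr e) e2)
    refine limO a1 (TL.cast a2 ?_)
    rw [rz s 2 s 2 hs (num _ hs) (by simp) (by simp),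
      rz (-s) 2 (-s) 2 (Pn _ hs) (num _ (Pn _ hs)) (by simp) (by simp)]

lemma one_even {κ : ℂ → ℂ} (h0 : ∃ r, HasPole κ 0 r)
    (hκ : ∀ s : ℂ, s ≠ 0 → DifferentiableAt ℂ κ s)
    (hF : Differentiable ℂ F) (hG : Differentiable ℂ G) (s : ℕ)
    (hk : DifferentiableAt ℂ k s) (hk' : DifferentiableAt ℂ k (-s)) :
    ∃ L, Tendsto (fun p => κ p * k p * (F (p + 1) - G p) +
      κ (-p) * k (-p) * (F (-p + 1) - G (-p))) (𝓝[≠] (s : ℂ)) (𝓝 L) := by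
  obtain rfl | hs : s = 0 ∨ s ≠ 0 := by omega
  · obtain ⟨r, hr⟩ := h0
    simp only [Nat.cast_zero, neg_zero] at *
    have := gen_term 1 hF hG hk hr
    exact limE' this (by rw [neg_zero]; exact this)
  · have e : (s : ℂ) ≠ 0 := by exact_mod_cast hs
    have a1 := gen_term 1 hF hG hk (HasPole.of_da (hκ s e))
    have a2 := gen_term 1 hF hG hk' (HasPole.of_da (hκ (-s) (neg_ne_zero.mpr e)))
    refine limE' a1 (HasPole.cast a2 ?_)
    ring

lemma one_odd {P : ℤ → Prop} {κ : ℂ → ℂ} (h0 : ∃ r, HasPole κ 0 r)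
    (hκ : ∀ s : ℂ, s ≠ 0 → DifferentiableAt ℂ κ s)
    (P0 : P 0) (P1 : P 1) (Pn : ∀ s, P s → P (-s)) (num : ∀ s, P s → P (s + 1) ∨ κ s = 0)
    (hF : Differentiable ℂ F) (hG : Differentiable ℂ G)
    (vF : ∀ j : ℤ, P j → F j = 0) (vG : ∀ j : ℤ, P j → G j = 0) (s : ℕ) (hs : P s)
    (hk : DifferentiableAt ℂ k s) (hk' : DifferentiableAt ℂ k (-s)) :
    Tendsto (fun p => κ p * k p * (F (p + 1) - G p) -
      κ (-p) * k (-p) * (F (-p + 1) - G (-p))) (𝓝[≠] (s : ℂ)) (𝓝 0) := by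
  have F1 := vF 1 P1
  have G0 := vG 0 P0
  push_cast at F1 G0
  have rz := fun (s c : ℤ) (x y : ℂ) => reg_zero (k := k) (κ := κ) (s := s) (c := c)
    (x := x) (y := y) vF vG
  obtain rfl | h2 : s = 0 ∨ s ≠ 0 := by omega
  · obtain ⟨r, hr⟩ := h0
    simp only [Nat.cast_zero, neg_zero] at *
    have := pole_term 1 hF hG hk hr (by simp [F1, G0])
    exact limO this (by rw [neg_zero]; exact this)
  · have e : (s : ℂ) ≠ 0 := by exact_mod_cast h2
    have a1 := reg_term 1 hF hG hk (hκ s e)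
    have a2 := reg_term 1 hF hG hk' (hκ (-s) (neg_ne_zero.mpr e))
    refine limO a1 (TL.cast a2 ?_)
    rw [rz s 1 s 1 hs (num _ hs) (by simp) (by simp),
      rz (-s) 1 (-s) 1 (Pn _ hs) (num _ (Pn _ hs)) (by simp) (by simp)]

lemma zero_even {s : ℂ} (hF : Differentiable ℂ F) (hG : Differentiable ℂ G)
    (hk : DifferentiableAt ℂ k s) :
    ∃ L, Tendsto (fun p => k p * (F p - G p)) (𝓝[≠] s) (𝓝 L) := by
  have : ContinuousAt (fun p => k p * (F p - G p)) s :=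
    (hk.mul ((hF s).sub (hG s))).continuousAt
  exact ⟨_, this.tendsto.mono_left nhdsWithin_le_nhds⟩

lemma zero_odd {s : ℂ} (hF : Differentiable ℂ F) (hG : Differentiable ℂ G)
    (hk : DifferentiableAt ℂ k s) (h1 : F s = 0) (h2 : G s = 0) :
    Tendsto (fun p => k p * (F p - G p)) (𝓝[≠] s) (𝓝 0) := by
  have : ContinuousAt (fun p => k p * (F p - G p)) s :=
    (hk.mul ((hF s).sub (hG s))).continuousAt
  have := this.tendsto.mono_left (nhdsWithin_le_nhds (s := {s}ᶜ))
  simpa [h1, h2] using this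

end one_dim


/-! ### the difference operator -/

def l3 (m q p : ℂ) : ℂ := c2 m ((q + p) / 2) * c1 m q * c1 m ((p - q) / 2) * e3 m ((p + 3 * q) / 2)
def k1 (m q p : ℂ) : ℂ :=
  3 * e2 m ((p + 3 * q) / 2) * e1 m ((3 * q - p) / 2) * c1 m q * c1 m ((q + p) / 2)
def k2 (m q p : ℂ) : ℂ :=
  3 * e1 m ((p + 3 * q) / 2) * e1 m ((p - 3 * q) / 2) * c1 m ((q + p) / 2) * c1 m ((p - q) / 2)
def l0 (m q p : ℂ) : ℂ :=
  c2 m q * c1 m ((q - p) / 2) * c1 m ((q + p) / 2) * e3 m ((p + 3 * q) / 2) *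
    e3 m ((3 * q - p) / 2)

def D (m : ℂ) (f : ℂ → ℂ → ℂ) (p q : ℂ) : ℂ :=
  e3 m p * l3 m q p * (f (p + 3) (q + 1) - f p q)
  + e3 m (-p) * l3 m q (-p) * (f (p + -3) (q + 1) - f p q)
  + e3 m p * l3 m (-q) p * (f (p + 3) (q + -1) - f p q)
  + e3 m (-p) * l3 m (-q) (-p) * (f (p + -3) (q + -1) - f p q)
  + e1 m p * k1 m q p * (f (p + 1) (q + 1) - f p q)
  + e1 m (-p) * k1 m q (-p) * (f (p + -1) (q + 1) - f p q)
  + e1 m p * k1 m (-q) p * (f (p + 1) (q + -1) - f p q)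
  + e1 m (-p) * k1 m (-q) (-p) * (f (p + -1) (q + -1) - f p q)
  + e2 m p * k2 m q p * (f (p + 2) (q + 0) - f p q)
  + e2 m (-p) * k2 m q (-p) * (f (p + -2) (q + 0) - f p q)
  + l0 m q p * (f (p + 0) (q + 2) - f p q)
  + l0 m (-q) p * (f (p + 0) (q + -2) - f p q)

def rot (f : ℂ → ℂ → ℂ) (p q : ℂ) : ℂ := f ((p - 3 * q) / 2) ((p + q) / 2)

lemma D_rot (m : ℂ) (f : ℂ → ℂ → ℂ) : D m (rot f) = rot (D m f) := by
  funext p q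
  simp only [D, rot, l3, k1, k2, l0]
  ring_nf

lemma half_frac (X u w : ℂ) : (X / 2 + u) / (X / 2 + w) = (X + 2 * u) / (X + 2 * w) := by
  rw [← mul_div_mul_left (X / 2 + u) (X / 2 + w) (two_ne_zero (α := ℂ))]
  congr 1 <;> ring

lemma k1_one (m q : ℂ) (h : ∀ j : ℤ, 3 * q ≠ j) : k1 m q 1 = 3 * l3 m q (-1) := by
  have g : ∀ j : ℤ, q - j ≠ 0 := fun j hj => h (3 * j) (by push_cast; linear_combination 3 * hj)
  have g3 : ∀ j : ℤ, 3 * q - j ≠ 0 := fun j hj => h j (by linear_combination hj)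
  have a1 : q ≠ 0 := by simpa using g 0
  have a2 : q - 1 ≠ 0 := by simpa using g 1
  have a3 : q + 1 ≠ 0 := by simpa using g (-1)
  have b1 : 3 * q - 1 ≠ 0 := by simpa using g3 1
  have b2 : 3 * q + 1 ≠ 0 := by simpa using g3 (-1)
  simp only [k1, l3, c1, c2, e1, e2, e3, half_frac]
  rw [show 1 + 3 * q + 2 * 0 = 3 * q + 1 by ring, show 1 + 3 * q + 2 * 1 = 3 * (q + 1) by ring,
    show 3 * q - 1 + 2 * 0 = 3 * q - 1 by ring, show 3 * q - 1 + 2 * -1 = 3 * (q - 1) by ring,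
    show 3 * q - 1 + 2 * 2 = 3 * (q + 1) by ring, show q + 1 + 2 * 0 = q + 1 by ring,
    show q + -1 + 2 * 0 = q - 1 by ring, show q + -1 + 2 * 1 = q + 1 by ring,
    show -1 - q + 2 * 0 = -(q + 1) by ring, show -1 + 3 * q + 2 * 0 = 3 * q - 1 by ring,
    show -1 + 3 * q + 2 * 1 = 3 * q + 1 by ring, show -1 + 3 * q + 2 * 2 = 3 * (q + 1) by ring,
    add_zero]
  field_simp
  ring

lemma k1_two (m q : ℂ) (h : ∀ j : ℤ, 3 * q ≠ j) : k1 m q (-2) = 3 * l3 m q (-2) := by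
  have g : ∀ j : ℤ, q - j ≠ 0 := fun j hj => h (3 * j) (by push_cast; linear_combination 3 * hj)
  have g3 : ∀ j : ℤ, 3 * q - j ≠ 0 := fun j hj => h j (by linear_combination hj)
  have a1 : q ≠ 0 := by simpa using g 0
  have a2 : q - 2 ≠ 0 := by simpa using g 2
  have a3 : q + 2 ≠ 0 := by simpa using g (-2)
  have b1 : 3 * q - 2 ≠ 0 := by simpa using g3 2
  have b2 : 3 * q + 2 ≠ 0 := by simpa using g3 (-2)
  simp only [k1, l3, c1, c2, e1, e2, e3, half_frac]
  rw [show -2 + 3 * q + 2 * 0 = 3 * q - 2 by ring, show -2 + 3 * q + 2 * 1 = 3 * q by ring,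
    show -2 + 3 * q + 2 * 2 = 3 * q + 2 by ring,
    show 3 * q - -2 + 2 * 0 = 3 * q + 2 by ring, show 3 * q - -2 + 2 * -1 = 3 * q by ring,
    show 3 * q - -2 + 2 * 2 = 3 * (q + 2) by ring, show q + -2 + 2 * 0 = q - 2 by ring,
    show q + -2 + 2 * 1 = q by ring,
    show -2 - q + 2 * 0 = -(q + 2) by ring,
    add_zero]
  field_simp
  ring

/-! ### regularity of `D f` for quasi-invariant `f` -/

/-- genericity -/
def Gen (q : ℂ) : Prop := ∀ j : ℤ, 3 * q ≠ j

lemma Gen.neg {q : ℂ} (h : Gen q) : Gen (-q) := fun j hj =>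
  h (-j) (by push_cast; linear_combination -hj)

lemma Gen.ne {q X : ℂ} (h : Gen q) (a : ℤ) (hX : X = 0 → 3 * q = a) : X ≠ 0 := fun h0 => h a (hX h0)

/-- not an integer -/
def NI (X : ℂ) : Prop := ∀ w : ℤ, X + w ≠ 0

lemma Gen.half {q X x : ℂ} (hq : Gen q) (u v s : ℤ) (hx : x = s) (hX : X = (u * q + v * x) / 2)
    (hu : u = 1 ∨ u = -1 ∨ u = 3 ∨ u = -3) : NI X := by
  intro w
  subst hX hx
  rcases hu with rfl | rfl | rfl | rfl
  · exact hq.ne (-3 * (v * s) - 6 * w) (fun h => by push_cast at *; linear_combination 6 * h)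
  · exact hq.ne (3 * (v * s) + 6 * w) (fun h => by push_cast at *; linear_combination -6 * h)
  · exact hq.ne (- (v * s) - 2 * w) (fun h => by push_cast at *; linear_combination 2 * h)
  · exact hq.ne ((v * s) + 2 * w) (fun h => by push_cast at *; linear_combination -2 * h)

lemma Gen.ni {q : ℂ} (hq : Gen q) : NI q := fun w =>
  hq.ne (-3 * w) (fun h => by push_cast at *; linear_combination 3 * h)

lemma NI.c1 {X m : ℂ} (h : NI X) : DifferentiableAt ℂ (c1 m) X := da_c1 (by simpa using h 0)
lemma NI.c2 {X m : ℂ} (h : NI X) : DifferentiableAt ℂ (c2 m) X :=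
  da_c2 (by simpa using h 0) (by simpa using h 1)
lemma NI.e1 {X m : ℂ} (h : NI X) : DifferentiableAt ℂ (e1 m) X :=
  da_e1 (by simpa using h 0) (by simpa using h (-1)) (by simpa using h 2)
lemma NI.e2 {X m : ℂ} (h : NI X) : DifferentiableAt ℂ (e2 m) X :=
  da_e2 (by simpa using h 0) (by simpa using h 1)
lemma NI.e3 {X m : ℂ} (h : NI X) : DifferentiableAt ℂ (e3 m) X :=
  da_e3 (by simpa using h 0) (by simpa using h 1) (by simpa using h 2)

lemma dac {κ g : ℂ → ℂ} {s : ℂ} (h : DifferentiableAt ℂ κ (g s)) (hg : DifferentiableAt ℂ g s) :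
    DifferentiableAt ℂ (fun t => κ (g t)) s := h.comp s hg

lemma da_l3 (m : ℂ) {q x : ℂ} (hq : Gen q) (s : ℤ) (hx : x = s) :
    DifferentiableAt ℂ (l3 m q) x := by
  have h1 : DifferentiableAt ℂ (fun p => c2 m ((q + p) / 2)) x := dac (κ := c2 m)
    (hq.half 1 1 s hx (by push_cast; ring) (by simp)).c2 (by fun_prop)
  have h2 : DifferentiableAt ℂ (fun p => c1 m ((p - q) / 2)) x := dac (κ := c1 m)
    (hq.half (-1) 1 s hx (by push_cast; ring) (by simp)).c1 (by fun_prop)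
  have h3 : DifferentiableAt ℂ (fun p => e3 m ((p + 3 * q) / 2)) x := dac (κ := e3 m)
    (hq.half 3 1 s hx (by push_cast; ring) (by simp)).e3 (by fun_prop)
  unfold l3
  fun_prop

lemma da_k1 (m : ℂ) {q x : ℂ} (hq : Gen q) (s : ℤ) (hx : x = s) :
    DifferentiableAt ℂ (k1 m q) x := by
  have h1 : DifferentiableAt ℂ (fun p => e1 m ((3 * q - p) / 2)) x := dac (κ := e1 m)
    (hq.half 3 (-1) s hx (by push_cast; ring) (by simp)).e1 (by fun_prop)
  have h2 : DifferentiableAt ℂ (fun p => c1 m ((q + p) / 2)) x := dac (κ := c1 m)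
    (hq.half 1 1 s hx (by push_cast; ring) (by simp)).c1 (by fun_prop)
  have h3 : DifferentiableAt ℂ (fun p => e2 m ((p + 3 * q) / 2)) x := dac (κ := e2 m)
    (hq.half 3 1 s hx (by push_cast; ring) (by simp)).e2 (by fun_prop)
  unfold k1
  fun_prop

lemma da_k2 (m : ℂ) {q x : ℂ} (hq : Gen q) (s : ℤ) (hx : x = s) :
    DifferentiableAt ℂ (k2 m q) x := by
  have h1 : DifferentiableAt ℂ (fun p => e1 m ((p - 3 * q) / 2)) x := dac (κ := e1 m)
    (hq.half (-3) 1 s hx (by push_cast; ring) (by simp)).e1 (by fun_prop)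
  have h2 : DifferentiableAt ℂ (fun p => c1 m ((q + p) / 2)) x := dac (κ := c1 m)
    (hq.half 1 1 s hx (by push_cast; ring) (by simp)).c1 (by fun_prop)
  have h3 : DifferentiableAt ℂ (fun p => e1 m ((p + 3 * q) / 2)) x := dac (κ := e1 m)
    (hq.half 3 1 s hx (by push_cast; ring) (by simp)).e1 (by fun_prop)
  have h4 : DifferentiableAt ℂ (fun p => c1 m ((p - q) / 2)) x := dac (κ := c1 m)
    (hq.half (-1) 1 s hx (by push_cast; ring) (by simp)).c1 (by fun_prop)
  unfold k2
  fun_prop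

lemma da_l0 (m : ℂ) {q x : ℂ} (hq : Gen q) (s : ℤ) (hx : x = s) :
    DifferentiableAt ℂ (l0 m q) x := by
  have h1 : DifferentiableAt ℂ (fun p => e3 m ((3 * q - p) / 2)) x := dac (κ := e3 m)
    (hq.half 3 (-1) s hx (by push_cast; ring) (by simp)).e3 (by fun_prop)
  have h2 : DifferentiableAt ℂ (fun p => c1 m ((q + p) / 2)) x := dac (κ := c1 m)
    (hq.half 1 1 s hx (by push_cast; ring) (by simp)).c1 (by fun_prop)
  have h3 : DifferentiableAt ℂ (fun p => e3 m ((p + 3 * q) / 2)) x := dac (κ := e3 m)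
    (hq.half 3 1 s hx (by push_cast; ring) (by simp)).e3 (by fun_prop)
  have h4 : DifferentiableAt ℂ (fun p => c1 m ((q - p) / 2)) x := dac (κ := c1 m)
    (hq.half 1 (-1) s hx (by push_cast; ring) (by simp)).c1 (by fun_prop)
  unfold l0
  fun_prop

lemma pole_c2_0' (m : ℂ) : HasPole (c2 m) 0 (-m * (1 - m)) :=
  HasPole.mk' (u := -m) (w := 0) (Φ := fun t => (t + (1 - m)) / (t + 1)) (by simp)
    (da_frac (by simp)) (by intro p; simp [c2]) _ (by simp)

/-- even / odd limits -/
lemma lim_even {X : ℂ → ℂ} {s : ℂ} (e : ∀ p, X (-p) = X p)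
    (h : ∃ L, Tendsto X (𝓝[≠] s) (𝓝 L)) :
    ∃ L, Tendsto X (𝓝[≠] s) (𝓝 L) ∧ Tendsto X (𝓝[≠] (-s)) (𝓝 L) := by
  obtain ⟨L, hL⟩ := h
  refine ⟨L, hL, ?_⟩
  have := tendsto_neg_punct (-s)
  rw [neg_neg] at this
  refine (hL.comp this).congr e

lemma lim_odd {X : ℂ → ℂ} {s : ℂ} (e : ∀ p, X (-p) = - X p)
    (h : Tendsto X (𝓝[≠] s) (𝓝 0)) :
    Tendsto X (𝓝[≠] (-s)) (𝓝 0) := by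
  have := tendsto_neg_punct (-s)
  rw [neg_neg] at this
  have h2 := (h.comp this).neg
  rw [neg_zero] at h2
  exact h2.congr (fun p => by simp [e])

lemma lim_add {X Y : ℂ → ℂ} {l : Filter ℂ} (hX : ∃ L, Tendsto X l (𝓝 L))
    (hY : ∃ L, Tendsto Y l (𝓝 L)) : ∃ L, Tendsto (fun p => X p + Y p) l (𝓝 L) := by
  obtain ⟨L, hL⟩ := hX
  obtain ⟨L', hL'⟩ := hY
  exact ⟨_, hL.add hL'⟩

lemma lim_add0 {X Y : ℂ → ℂ} {l : Filter ℂ} (hX : Tendsto X l (𝓝 0))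
    (hY : Tendsto Y l (𝓝 0)) : Tendsto (fun p => X p + Y p) l (𝓝 0) := by
  simpa using hX.add hY

/-- entire in each variable -/
def Ent (f : ℂ → ℂ → ℂ) : Prop :=
  (∀ q, Differentiable ℂ (fun p => f p q)) ∧ ∀ p, Differentiable ℂ (f p)

/-- quasi-invariance along the first axis -/
def QB (m : ℕ) (f : ℂ → ℂ → ℂ) : Prop := ∀ s : ℕ, inB m s → ∀ q, f s q = f (-s) q
def QA (m : ℕ) (f : ℂ → ℂ → ℂ) : Prop := ∀ s : ℕ, inA m s → ∀ p, f p s = f p (-s)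

lemma beta_even {m : ℕ} {f : ℂ → ℂ → ℂ} (hf : Ent f) (e : ∀ p q, f (-p) q = f p q)
    {q : ℂ} (hq : Gen q) (s : ℕ) :
    ∃ L, Tendsto (fun p => D m f p q) (𝓝[≠] (s : ℂ)) (𝓝 L) ∧
      Tendsto (fun p => D m f p q) (𝓝[≠] (-s : ℂ)) (𝓝 L) := by
  have e3' : ∀ p c q, f (p + -c) q = f (-p + c) q := fun p c q => by
    rw [← e]; congr 1; ring
  have hs : (s : ℂ) = (s : ℤ) := by simp
  have hs' : -(s : ℂ) = (-s : ℤ) := by simp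
  have l0e : ∀ q p : ℂ, l0 m q (-p) = l0 m q p := fun q p => by
    simp only [l0]; ring_nf
  refine lim_even ?_ ?_
  · intro p
    simp only [D, e3', neg_neg, e, l0e, add_zero]
    ring
  have w1 := WB_even m (hf.1 (q + 1)) (hf.1 q) (fun p => e p _) (fun p => e p _) s
    (da_k1 m hq _ hs) (da_k1 m hq _ hs') (da_l3 m hq _ hs) (da_l3 m hq _ hs')
    (k1_one m q hq) (k1_two m q hq)
  have w2 := WB_even m (hf.1 (q + -1)) (hf.1 q) (fun p => e p _) (fun p => e p _) s
    (da_k1 m hq.neg _ hs) (da_k1 m hq.neg _ hs') (da_l3 m hq.neg _ hs) (da_l3 m hq.neg _ hs')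
    (k1_one m (-q) hq.neg) (k1_two m (-q) hq.neg)
  have w3 := two_even (pole_e2_0 m) (pole_e2_1 m) (fun s h h' => da_e2 h h') (hf.1 q)
    (fun p => e p _) s (da_k2 m hq _ hs) (da_k2 m hq _ hs')
  have w4 := zero_even (hf.1 (q + 2)) (hf.1 q) (da_l0 m hq _ hs)
  have w5 := zero_even (hf.1 (q + -2)) (hf.1 q) (da_l0 m hq.neg _ hs)
  obtain ⟨L, hL⟩ := lim_add (lim_add (lim_add w1 w2) w3) (lim_add w4 w5)
  refine ⟨L, hL.congr fun p => ?_⟩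
  simp only [D, e3', WB, e, l0e, add_zero]
  ring

lemma beta_odd {m : ℕ} (hm : 1 ≤ m) {f : ℂ → ℂ → ℂ} (hf : Ent f) (e : ∀ p q, f (-p) q = - f p q)
    (hv : ∀ j : ℤ, inB m j → ∀ q, f j q = 0)
    {q : ℂ} (hq : Gen q) (s : ℕ) (hsB : inB m s) :
    Tendsto (fun p => D m f p q) (𝓝[≠] (s : ℂ)) (𝓝 0) ∧
      Tendsto (fun p => D m f p q) (𝓝[≠] (-s : ℂ)) (𝓝 0) := by
  have e3' : ∀ p c q, f (p + -c) q = - f (-p + c) q := fun p c q => by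
    rw [← e]; congr 1; ring
  have hs : (s : ℂ) = (s : ℤ) := by simp
  have hs' : -(s : ℂ) = (-s : ℤ) := by simp
  have l0e : ∀ q p : ℂ, l0 m q (-p) = l0 m q p := fun q p => by
    simp only [l0]; ring_nf
  have main : Tendsto (fun p => D m f p q) (𝓝[≠] (s : ℂ)) (𝓝 0) := by
    have w1 := WB_odd hm (hf.1 (q + 1)) (hf.1 q) (fun p => e p _) (fun p => e p _)
      (fun j hj => hv j hj _) (fun j hj => hv j hj _) s hsB
      (da_k1 m hq _ hs) (da_k1 m hq _ hs') (da_l3 m hq _ hs) (da_l3 m hq _ hs')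
      (k1_one m q hq) (k1_two m q hq)
    have w2 := WB_odd hm (hf.1 (q + -1)) (hf.1 q) (fun p => e p _) (fun p => e p _)
      (fun j hj => hv j hj _) (fun j hj => hv j hj _) s hsB
      (da_k1 m hq.neg _ hs) (da_k1 m hq.neg _ hs') (da_l3 m hq.neg _ hs) (da_l3 m hq.neg _ hs')
      (k1_one m (-q) hq.neg) (k1_two m (-q) hq.neg)
    obtain ⟨r, hr⟩ := pole_e2_0 m
    have small : ∀ j : ℤ, |j| ≤ 3 → inB m j := fun j hj => Or.inl (by omega)
    have w3 := two_odd (P := inB m) ⟨r, hr, Or.inr (small 2 (by simp))⟩ (pole_e2_1 m)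
      (fun s h h' => da_e2 h h') (small 0 (by simp)) (small 1 (by simp))
      (fun s h => inB_neg h) (fun s h => num_e2 hm h) (hf.1 q)
      (fun p => e p _) (fun j hj => hv j hj _) s hsB (da_k2 m hq _ hs) (da_k2 m hq _ hs')
    have z := fun q => hv s hsB q
    simp only [Int.cast_natCast] at z
    have w4 := zero_odd (hf.1 (q + 2)) (hf.1 q) (da_l0 m hq _ hs) (z _) (z _)
    have w5 := zero_odd (hf.1 (q + -2)) (hf.1 q) (da_l0 m hq.neg _ hs) (z _) (z _)
    have hL := lim_add0 (lim_add0 (lim_add0 w1 w2) w3) (lim_add0 w4 w5)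
    refine hL.congr fun p => ?_
    simp only [D, e3', WB, e, add_zero]
    ring
  refine ⟨main, lim_odd ?_ main⟩
  intro p
  simp only [D, e3', neg_neg, e, l0e, add_zero]
  ring

lemma beta {m : ℕ} (hm : 1 ≤ m) {f : ℂ → ℂ → ℂ} (hf : Ent f) (hQ : QB m f)
    {q : ℂ} (hq : Gen q) (s : ℕ) (hsB : inB m s) :
    ∃ L, Tendsto (fun p => D m f p q) (𝓝[≠] (s : ℂ)) (𝓝 L) ∧
      Tendsto (fun p => D m f p q) (𝓝[≠] (-s : ℂ)) (𝓝 L) := by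
  have d1 : ∀ q, Differentiable ℂ (fun p => f (-p) q) := fun q =>
    (hf.1 q).comp (g := fun p => f p q) differentiable_neg
  have h1 : Ent (fun p q => (f p q + f (-p) q) / 2) :=
    ⟨fun q => ((hf.1 q).add (d1 q)).div_const 2, fun p => ((hf.2 p).add (hf.2 (-p))).div_const 2⟩
  have h2 : Ent (fun p q => (f p q - f (-p) q) / 2) :=
    ⟨fun q => ((hf.1 q).sub (d1 q)).div_const 2, fun p => ((hf.2 p).sub (hf.2 (-p))).div_const 2⟩
  obtain ⟨L, hL, hL'⟩ := beta_even (m := m) h1 (fun p q => by simp only [neg_neg]; ring) hq s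
  obtain ⟨h0, h0'⟩ := beta_odd hm h2 (fun p q => by simp only [neg_neg]; ring) (by
    intro j hj q
    obtain ⟨n, rfl | rfl⟩ := j.eq_nat_or_neg
    · have := hQ n hj q
      simp [this]
    · have := hQ n (by simpa using inB_neg hj) q
      simp [this]) hq s hsB
  refine ⟨L, ?_, ?_⟩
  · have := hL.add h0
    rw [add_zero] at this
    refine this.congr fun p => ?_
    simp only [D]; ring
  · have := hL'.add h0'
    rw [add_zero] at this
    refine this.congr fun p => ?_
    simp only [D]; ring

/-! ### the same along long roots -/

def g3 (m p q : ℂ) : ℂ :=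
  e3 m p * c2 m ((q + p) / 2) * c1 m ((p - q) / 2) * e3 m ((p + 3 * q) / 2)
def g1 (m p q : ℂ) : ℂ :=
  3 * e1 m p * e2 m ((p + 3 * q) / 2) * e1 m ((3 * q - p) / 2) * c1 m ((q + p) / 2)
def g2 (m p q : ℂ) : ℂ := e2 m p * k2 m q p
def g0 (m p q : ℂ) : ℂ :=
  c1 m ((q - p) / 2) * c1 m ((q + p) / 2) * e3 m ((p + 3 * q) / 2) * e3 m ((3 * q - p) / 2)

lemma da_g3 (m : ℂ) {p x : ℂ} (hp : Gen p) (s : ℤ) (hx : x = s) :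
    DifferentiableAt ℂ (g3 m p) x := by
  have h1 : DifferentiableAt ℂ (fun q => c2 m ((q + p) / 2)) x := dac (κ := c2 m)
    (hp.half 1 1 s hx (by push_cast; ring) (by simp)).c2 (by fun_prop)
  have h2 : DifferentiableAt ℂ (fun q => c1 m ((p - q) / 2)) x := dac (κ := c1 m)
    (hp.half 1 (-1) s hx (by push_cast; ring) (by simp)).c1 (by fun_prop)
  have h3 : DifferentiableAt ℂ (fun q => e3 m ((p + 3 * q) / 2)) x := dac (κ := e3 m)
    (hp.half 1 3 s hx (by push_cast; ring) (by simp)).e3 (by fun_prop)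
  unfold g3
  fun_prop

lemma da_g1 (m : ℂ) {p x : ℂ} (hp : Gen p) (s : ℤ) (hx : x = s) :
    DifferentiableAt ℂ (g1 m p) x := by
  have h1 : DifferentiableAt ℂ (fun q => e1 m ((3 * q - p) / 2)) x := dac (κ := e1 m)
    (hp.half (-1) 3 s hx (by push_cast; ring) (by simp)).e1 (by fun_prop)
  have h2 : DifferentiableAt ℂ (fun q => c1 m ((q + p) / 2)) x := dac (κ := c1 m)
    (hp.half 1 1 s hx (by push_cast; ring) (by simp)).c1 (by fun_prop)
  have h3 : DifferentiableAt ℂ (fun q => e2 m ((p + 3 * q) / 2)) x := dac (κ := e2 m)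
    (hp.half 1 3 s hx (by push_cast; ring) (by simp)).e2 (by fun_prop)
  unfold g1
  fun_prop

lemma da_g2 (m : ℂ) {p x : ℂ} (hp : Gen p) (s : ℤ) (hx : x = s) :
    DifferentiableAt ℂ (g2 m p) x := by
  have h1 : DifferentiableAt ℂ (fun q => e1 m ((p - 3 * q) / 2)) x := dac (κ := e1 m)
    (hp.half 1 (-3) s hx (by push_cast; ring) (by simp)).e1 (by fun_prop)
  have h2 : DifferentiableAt ℂ (fun q => c1 m ((q + p) / 2)) x := dac (κ := c1 m)
    (hp.half 1 1 s hx (by push_cast; ring) (by simp)).c1 (by fun_prop)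
  have h3 : DifferentiableAt ℂ (fun q => e1 m ((p + 3 * q) / 2)) x := dac (κ := e1 m)
    (hp.half 1 3 s hx (by push_cast; ring) (by simp)).e1 (by fun_prop)
  have h4 : DifferentiableAt ℂ (fun q => c1 m ((p - q) / 2)) x := dac (κ := c1 m)
    (hp.half 1 (-1) s hx (by push_cast; ring) (by simp)).c1 (by fun_prop)
  unfold g2 k2
  fun_prop

lemma da_g0 (m : ℂ) {p x : ℂ} (hp : Gen p) (s : ℤ) (hx : x = s) :
    DifferentiableAt ℂ (g0 m p) x := by
  have h1 : DifferentiableAt ℂ (fun q => e3 m ((3 * q - p) / 2)) x := dac (κ := e3 m)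
    (hp.half (-1) 3 s hx (by push_cast; ring) (by simp)).e3 (by fun_prop)
  have h2 : DifferentiableAt ℂ (fun q => c1 m ((q + p) / 2)) x := dac (κ := c1 m)
    (hp.half 1 1 s hx (by push_cast; ring) (by simp)).c1 (by fun_prop)
  have h3 : DifferentiableAt ℂ (fun q => e3 m ((p + 3 * q) / 2)) x := dac (κ := e3 m)
    (hp.half 1 3 s hx (by push_cast; ring) (by simp)).e3 (by fun_prop)
  have h4 : DifferentiableAt ℂ (fun q => c1 m ((q - p) / 2)) x := dac (κ := c1 m)
    (hp.half (-1) 1 s hx (by push_cast; ring) (by simp)).c1 (by fun_prop)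
  unfold g0
  fun_prop

lemma alpha_even {m : ℕ} {f : ℂ → ℂ → ℂ} (hf : Ent f) (e : ∀ p q, f p (-q) = f p q)
    {p : ℂ} (hp : Gen p) (s : ℕ) :
    ∃ L, Tendsto (fun q => D m f p q) (𝓝[≠] (s : ℂ)) (𝓝 L) ∧
      Tendsto (fun q => D m f p q) (𝓝[≠] (-s : ℂ)) (𝓝 L) := by
  have e3' : ∀ p c q, f p (q + -c) = f p (-q + c) := fun p c q => by
    rw [← e]; congr 1; ring
  have hs : (s : ℂ) = (s : ℤ) := by simp
  have hs' : -(s : ℂ) = (-s : ℤ) := by simp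
  have k2e : ∀ q p : ℂ, k2 m (-q) p = k2 m q p := fun q p => by
    simp only [k2]; ring_nf
  refine lim_even ?_ ?_
  · intro q
    simp only [D, e3', neg_neg, e, k2e, add_zero]
    ring
  have T := fun (c : ℂ) (k : ℂ → ℂ) => one_even (k := k) ⟨_, pole_c1_0 m⟩ (fun s h => da_c1 h)
    (hf.2 (p + c)) (hf.2 p) s
  have w1 := T 3 _ (da_g3 m hp _ hs) (da_g3 m hp _ hs')
  have w2 := T (-3) _ (da_g3 m hp.neg _ hs) (da_g3 m hp.neg _ hs')
  have w3 := T 1 _ (da_g1 m hp _ hs) (da_g1 m hp _ hs')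
  have w4 := T (-1) _ (da_g1 m hp.neg _ hs) (da_g1 m hp.neg _ hs')
  have w5 := two_even (pole_c2_0 m) (pole_c2_1 m) (fun s h h' => da_c2 h h') (hf.2 p)
    (fun q => e p _) s (da_g0 m hp _ hs) (da_g0 m hp _ hs')
  have w6 := zero_even (hf.2 (p + 2)) (hf.2 p) (da_g2 m hp _ hs)
  have w7 := zero_even (hf.2 (p + -2)) (hf.2 p) (da_g2 m hp.neg _ hs)
  obtain ⟨L, hL⟩ := lim_add (lim_add (lim_add w1 w2) (lim_add w3 w4)) (lim_add w5 (lim_add w6 w7))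
  refine ⟨L, hL.congr fun q => ?_⟩
  simp only [D, e3', e, add_zero, l3, l0, k1, g3, g1, g0, g2]
  ring_nf

lemma alpha_odd {m : ℕ} (hm : 1 ≤ m) {f : ℂ → ℂ → ℂ} (hf : Ent f) (e : ∀ p q, f p (-q) = - f p q)
    (hv : ∀ j : ℤ, inA m j → ∀ p, f p j = 0)
    {p : ℂ} (hp : Gen p) (s : ℕ) (hsA : inA m s) :
    Tendsto (fun q => D m f p q) (𝓝[≠] (s : ℂ)) (𝓝 0) ∧
      Tendsto (fun q => D m f p q) (𝓝[≠] (-s : ℂ)) (𝓝 0) := by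
  have e3' : ∀ p c q, f p (q + -c) = - f p (-q + c) := fun p c q => by
    rw [← e]; congr 1; ring
  have hs : (s : ℂ) = (s : ℤ) := by simp
  have hs' : -(s : ℂ) = (-s : ℤ) := by simp
  have k2e : ∀ q p : ℂ, k2 m (-q) p = k2 m q p := fun q p => by
    simp only [k2]; ring_nf
  have small : ∀ j : ℤ, |j| ≤ 1 → inA m j := fun j hj => by unfold inA; omega
  have main : Tendsto (fun q => D m f p q) (𝓝[≠] (s : ℂ)) (𝓝 0) := by
    have T := fun (c : ℂ) (k : ℂ → ℂ) => one_odd (P := inA m) (k := k) ⟨_, pole_c1_0 m⟩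
      (fun s h => da_c1 h) (small 0 (by simp)) (small 1 (by simp))
      (fun s h => inA_neg h) (fun s h => num_c1 h)
      (hf.2 (p + c)) (hf.2 p) (fun j hj => hv j hj _) (fun j hj => hv j hj _) s hsA
    have w1 := T 3 _ (da_g3 m hp _ hs) (da_g3 m hp _ hs')
    have w2 := T (-3) _ (da_g3 m hp.neg _ hs) (da_g3 m hp.neg _ hs')
    have w3 := T 1 _ (da_g1 m hp _ hs) (da_g1 m hp _ hs')
    have w4 := T (-1) _ (da_g1 m hp.neg _ hs) (da_g1 m hp.neg _ hs')
    have w5 := two_odd (P := inA m) ⟨_, pole_c2_0' m, by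
        by_cases h : m = 1
        · left; subst h; simp
        · right; unfold inA; rw [abs_of_nonneg (by norm_num)]; omega⟩ (pole_c2_1 m)
      (fun s h h' => da_c2 h h') (small 0 (by simp)) (small 1 (by simp))
      (fun s h => inA_neg h) (fun s h => num_c2 hm h) (hf.2 p)
      (fun q => e p _) (fun j hj => hv j hj _) s hsA (da_g0 m hp _ hs) (da_g0 m hp _ hs')
    have z := fun q => hv s hsA q
    simp only [Int.cast_natCast] at z
    have w6 := zero_odd (hf.2 (p + 2)) (hf.2 p) (da_g2 m hp _ hs) (z _) (z _)
    have w7 := zero_odd (hf.2 (p + -2)) (hf.2 p) (da_g2 m hp.neg _ hs) (z _) (z _)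
    have hL := lim_add0 (lim_add0 (lim_add0 w1 w2) (lim_add0 w3 w4))
      (lim_add0 w5 (lim_add0 w6 w7))
    refine hL.congr fun q => ?_
    simp only [D, e3', e, add_zero, l3, l0, k1, g3, g1, g0, g2]
    ring_nf
  refine ⟨main, lim_odd ?_ main⟩
  intro q
  simp only [D, e3', neg_neg, e, k2e, add_zero]
  ring

lemma alpha {m : ℕ} (hm : 1 ≤ m) {f : ℂ → ℂ → ℂ} (hf : Ent f) (hQ : QA m f)
    {p : ℂ} (hp : Gen p) (s : ℕ) (hsA : inA m s) :
    ∃ L, Tendsto (fun q => D m f p q) (𝓝[≠] (s : ℂ)) (𝓝 L) ∧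
      Tendsto (fun q => D m f p q) (𝓝[≠] (-s : ℂ)) (𝓝 L) := by
  have d1 : ∀ p, Differentiable ℂ (fun q => f p (-q)) := fun p =>
    (hf.2 p).comp differentiable_neg
  have h1 : Ent (fun p q => (f p q + f p (-q)) / 2) :=
    ⟨fun q => ((hf.1 q).add (hf.1 (-q))).div_const 2, fun p => ((hf.2 p).add (d1 p)).div_const 2⟩
  have h2 : Ent (fun p q => (f p q - f p (-q)) / 2) :=
    ⟨fun q => ((hf.1 q).sub (hf.1 (-q))).div_const 2, fun p => ((hf.2 p).sub (d1 p)).div_const 2⟩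
  obtain ⟨L, hL, hL'⟩ := alpha_even (m := m) h1 (fun p q => by simp only [neg_neg]; ring) hp s
  obtain ⟨h0, h0'⟩ := alpha_odd hm h2 (fun p q => by simp only [neg_neg]; ring) (by
    intro j hj p
    obtain ⟨n, rfl | rfl⟩ := j.eq_nat_or_neg
    · have := hQ n hj p
      simp [this]
    · have := hQ n (by simpa using inA_neg hj) p
      simp [this]) hp s hsA
  refine ⟨L, ?_, ?_⟩
  · have := hL.add h0
    rw [add_zero] at this
    refine this.congr fun p => ?_
    simp only [D]; ring
  · have := hL'.add h0'
    rw [add_zero] at this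
    refine this.congr fun p => ?_
    simp only [D]; ring

/-! ### rotations, the regular set -/

def RR (z : ℂ × ℂ) : ℂ × ℂ := ((z.1 - 3 * z.2) / 2, (z.1 + z.2) / 2)
def Ri (z : ℂ × ℂ) : ℂ × ℂ := ((z.1 + 3 * z.2) / 2, (z.2 - z.1) / 2)

lemma RR_Ri (z : ℂ × ℂ) : RR (Ri z) = z := by
  ext <;> simp [RR, Ri] <;> ring
lemma Ri_RR (z : ℂ × ℂ) : Ri (RR z) = z := by
  ext <;> simp [RR, Ri] <;> ring

lemma RR_Ri_iter (k : ℕ) (z : ℂ × ℂ) : RR^[k] (Ri^[k] z) = z :=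
  (Function.LeftInverse.iterate RR_Ri k) z
lemma Ri_RR_iter (k : ℕ) (z : ℂ × ℂ) : Ri^[k] (RR^[k] z) = z :=
  (Function.LeftInverse.iterate Ri_RR k) z

lemma rot_iter (k : ℕ) (f : ℂ → ℂ → ℂ) (p q : ℂ) :
    rot^[k] f p q = f (RR^[k] (p, q)).1 (RR^[k] (p, q)).2 := by
  induction k generalizing f p q with
  | zero => rfl
  | succ k ih =>
    rw [Function.iterate_succ_apply, ih, Function.iterate_succ_apply']
    rfl

lemma D_rot_iter (m : ℂ) (k : ℕ) (f : ℂ → ℂ → ℂ) : D m (rot^[k] f) = rot^[k] (D m f) := by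
  induction k with
  | zero => rfl
  | succ k ih =>
    rw [Function.iterate_succ_apply', D_rot, ih, Function.iterate_succ_apply']

lemma cont_RR (k : ℕ) : Continuous RR^[k] := by
  apply Continuous.iterate
  unfold RR; fun_prop

lemma diff_RR (k : ℕ) : Differentiable ℂ RR^[k] := by
  apply Differentiable.iterate
  unfold RR; fun_prop

/-- all the forms take values outside `{-2,…,2}` -/
def U (z : ℂ × ℂ) : Prop := ∀ j ∈ Finset.Icc (-2 : ℤ) 2,
  z.1 ≠ j ∧ (z.1 + 3 * z.2) / 2 ≠ j ∧ (3 * z.2 - z.1) / 2 ≠ j ∧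
  z.2 ≠ j ∧ (z.2 - z.1) / 2 ≠ j ∧ (z.2 + z.1) / 2 ≠ j

lemma Icc_neg {j : ℤ} (h : j ∈ Finset.Icc (-2 : ℤ) 2) : -j ∈ Finset.Icc (-2 : ℤ) 2 := by
  simp at *; omega

lemma U_RR {z : ℂ × ℂ} (h : U z) : U (RR z) := by
  intro j hj
  obtain ⟨h1, h2, h3, h4, h5, h6⟩ := h j hj
  obtain ⟨h1', h2', h3', h4', h5', h6'⟩ := h (-j) (Icc_neg hj)
  push_cast at *
  simp only [RR]
  refine ⟨fun h => h3' ?_, fun h => h1 ?_, fun h => h2 ?_, fun h => h6 ?_, fun h => h4 ?_,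
    fun h => h5' ?_⟩
  · linear_combination -h
  · linear_combination h
  · linear_combination h
  · linear_combination h
  · linear_combination h
  · linear_combination -h

lemma U_Ri {z : ℂ × ℂ} (h : U z) : U (Ri z) := by
  intro j hj
  obtain ⟨h1, h2, h3, h4, h5, h6⟩ := h j hj
  obtain ⟨h1', h2', h3', h4', h5', h6'⟩ := h (-j) (Icc_neg hj)
  push_cast at *
  simp only [Ri]
  refine ⟨fun h => h2 ?_, fun h => h3 ?_, fun h => h1' ?_, fun h => h5 ?_, fun h => h6' ?_,
    fun h => h4 ?_⟩
  · linear_combination h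
  · linear_combination h
  · linear_combination -h
  · linear_combination h
  · linear_combination -h
  · linear_combination h

lemma U_RR_iter (k : ℕ) {z : ℂ × ℂ} (h : U z) : U (RR^[k] z) := by
  induction k with
  | zero => exact h
  | succ k ih => rw [Function.iterate_succ_apply']; exact U_RR ih
lemma U_Ri_iter (k : ℕ) {z : ℂ × ℂ} (h : U z) : U (Ri^[k] z) := by
  induction k with
  | zero => exact h
  | succ k ih => rw [Function.iterate_succ_apply']; exact U_Ri ih

lemma ev_ne {a b c s : ℂ} (ha : a ≠ 0) {g : ℂ → ℂ} (hg : ∀ p, g p = a * p + b) :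
    ∀ᶠ p in 𝓝[≠] s, g p ≠ c := by
  have h0 : g = fun p => a * p + b := funext hg
  by_cases h : g s = c
  · filter_upwards [self_mem_nhdsWithin] with p hp hc
    apply hp
    rw [← h, hg, hg] at hc
    exact mul_left_cancel₀ ha (by linear_combination hc)
  · have hc : ContinuousAt g s := by rw [h0]; fun_prop
    exact (hc.eventually_ne h).filter_mono nhdsWithin_le_nhds

lemma U_ev1 {q : ℂ} (hq : Gen q) (s : ℂ) : ∀ᶠ p in 𝓝[≠] s, U (p, q) := by
  unfold U
  rw [Filter.eventually_all_finset]
  intro j _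
  refine (ev_ne (a := 1) (b := 0) (by norm_num) (by intro p; ring)).and
    ((ev_ne (a := 1 / 2) (b := 3 * q / 2) (by norm_num) (by intro p; ring)).and
    ((ev_ne (a := -1 / 2) (b := 3 * q / 2) (by norm_num) (by intro p; ring)).and
    (Filter.Eventually.and ?_
    ((ev_ne (a := -1 / 2) (b := q / 2) (by norm_num) (by intro p; ring)).and
    (ev_ne (a := 1 / 2) (b := q / 2) (by norm_num) (by intro p; ring))))))
  filter_upwards with p h
  exact hq (3 * j) (by push_cast; linear_combination 3 * h)

lemma U_ev2 {p : ℂ} (hp : Gen p) (s : ℂ) : ∀ᶠ q in 𝓝[≠] s, U (p, q) := by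
  unfold U
  rw [Filter.eventually_all_finset]
  intro j _
  refine (Filter.Eventually.and ?_
    ((ev_ne (a := 3 / 2) (b := p / 2) (by norm_num) (by intro p; ring)).and
    ((ev_ne (a := 3 / 2) (b := -p / 2) (by norm_num) (by intro p; ring)).and
    ((ev_ne (a := 1) (b := 0) (by norm_num) (by intro p; ring)).and
    ((ev_ne (a := 1 / 2) (b := -p / 2) (by norm_num) (by intro p; ring)).and
    (ev_ne (a := 1 / 2) (b := p / 2) (by norm_num) (by intro p; ring)))))))
  filter_upwards with p h
  exact hp (3 * j) (by push_cast; linear_combination 3 * h)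

lemma dense_Gen : Dense {q : ℂ | Gen q} := by
  have h : {q : ℂ | Gen q} = (Set.range (fun j : ℤ => (j : ℂ) / 3))ᶜ := by
    ext q
    simp only [Gen, Set.mem_ofPred_eq, Set.mem_compl_iff, Set.mem_range, not_exists]
    refine forall_congr' fun j => not_congr ⟨fun h => by rw [← h]; ring, fun h => by rw [← h]; ring⟩
  rw [h]
  exact Set.Countable.dense_compl ℝ (Set.countable_range _)

lemma eq_of_Gen {f g : ℂ → ℂ} (hf : Continuous f) (hg : Continuous g)
    (h : ∀ q, Gen q → f q = g q) (q : ℂ) : f q = g q :=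
  congrFun (Continuous.ext_on dense_Gen hf hg h) q

/-! ### polynomials -/

abbrev Pol := MvPolynomial (Fin 2) ℂ

def ev (P : Pol) (z : ℂ × ℂ) : ℂ := MvPolynomial.eval ![z.1, z.2] P

@[simp] lemma ev_add (P Q : Pol) (z) : ev (P + Q) z = ev P z + ev Q z := by simp [ev]
@[simp] lemma ev_mul (P Q : Pol) (z) : ev (P * Q) z = ev P z * ev Q z := by simp [ev]
@[simp] lemma ev_sub (P Q : Pol) (z) : ev (P - Q) z = ev P z - ev Q z := by simp [ev]
@[simp] lemma ev_one (z) : ev 1 z = 1 := by simp [ev]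
@[simp] lemma ev_zero (z) : ev 0 z = 0 := by simp [ev]
@[simp] lemma ev_C (c : ℂ) (z) : ev (MvPolynomial.C c) z = c := by simp [ev]
@[simp] lemma ev_X0 (z) : ev (MvPolynomial.X 0) z = z.1 := by simp [ev]
@[simp] lemma ev_X1 (z) : ev (MvPolynomial.X 1) z = z.2 := by simp [ev]

lemma ev_diff (P : Pol) : Differentiable ℂ (ev P) := by
  induction P using MvPolynomial.induction_on with
  | C a => simp only [funext (ev_C a)]; fun_prop
  | add p q hp hq => 
    have : ev (p + q) = fun z => ev p z + ev q z := funext (ev_add p q)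
    rw [this]; fun_prop
  | mul_X p i hp =>
    have : ev (p * MvPolynomial.X i) = fun z => ev p z * ev (MvPolynomial.X i) z :=
      funext (ev_mul p _)
    rw [this]
    refine hp.mul ?_
    fin_cases i
    · simp only [Fin.zero_eta, funext ev_X0]; fun_prop
    · simp only [Fin.mk_one, funext ev_X1]; fun_prop

lemma ev_ext {P Q : Pol} (h : ∀ z, ev P z = ev Q z) : P = Q := by
  apply MvPolynomial.funext
  intro x
  have := h (x 0, x 1)
  have e : ![x 0, x 1] = x := by ext i; fin_cases i <;> rfl
  simpa [ev, e] using this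

lemma ev_bind (φ : Fin 2 → Pol) (P : Pol) (z) :
    ev (MvPolynomial.bind₁ φ P) z = ev P (ev (φ 0) z, ev (φ 1) z) := by
  simp only [ev]
  rw [← MvPolynomial.coe_aeval_eq_eval, ← MvPolynomial.coe_aeval_eq_eval]
  simp only [RingHom.coe_coe]
  rw [MvPolynomial.aeval_bind₁]
  congr 2
  ext i; fin_cases i <;> rfl

lemma dvd_of_vanish {l N : Pol} (u v : ℂ)
    (hl : ∀ z : ℂ × ℂ, ∀ t : ℂ, ev l (z.1 + t * u, z.2 + t * v) = ev l z + t)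
    (h : ∀ z, ev l z = 0 → ev N z = 0) : ∃ N1, N = l * N1 := by
  set φ : Fin 2 → Pol := ![MvPolynomial.X 0 - l * MvPolynomial.C u,
    MvPolynomial.X 1 - l * MvPolynomial.C v] with hφ
  have h0 : MvPolynomial.bind₁ φ N = 0 := by
    apply ev_ext
    intro z
    rw [ev_bind]
    simp only [hφ, Matrix.cons_val_zero, Matrix.cons_val_one, ev_sub, ev_mul, ev_C, ev_X0, ev_X1,
      ev_zero]
    apply h
    have := hl z (- ev l z)
    rw [add_neg_cancel] at this
    rw [← this]
    congr 1
    ext <;> simp <;> ring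
  have h1 : ((Ideal.Quotient.mkₐ ℂ (Ideal.span {l})).comp (MvPolynomial.bind₁ φ)) =
      Ideal.Quotient.mkₐ ℂ (Ideal.span {l}) := by
    apply MvPolynomial.algHom_ext
    intro i
    have hl0 : Ideal.Quotient.mk (Ideal.span {l}) l = 0 :=
      Ideal.Quotient.eq_zero_iff_mem.mpr (Ideal.mem_span_singleton_self l)
    fin_cases i <;> simp [hφ, hl0]
  have h2 := DFunLike.congr_fun h1 N
  simp only [AlgHom.comp_apply, h0, map_zero] at h2
  have h3 := Ideal.Quotient.eq_zero_iff_mem.mp h2.symm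
  exact Ideal.mem_span_singleton.mp h3

/-! ### rational functions with controlled denominators, removal of denominators -/

def Good (l : Pol) : Prop :=
  (∃ u v : ℂ, ∀ z : ℂ × ℂ, ∀ t : ℂ, ev l (z.1 + t * u, z.2 + t * v) = ev l z + t) ∧
  ∃ (k : ℕ) (s : ℤ), (|s| ≤ 2 ∧ ∀ z, ev l z = (Ri^[k] z).1 - s) ∨
    (|s| ≤ 1 ∧ ∀ z, ev l z = (Ri^[k] z).2 - s)

lemma Good.ne {l : Pol} (h : Good l) {z : ℂ × ℂ} (hz : U z) : ev l z ≠ 0 := by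
  obtain ⟨_, k, s, ⟨hs, h⟩ | ⟨hs, h⟩⟩ := h
  · rw [h, sub_ne_zero]
    rw [abs_le] at hs
    exact (U_Ri_iter k hz s (by simp; omega)).1
  · rw [h, sub_ne_zero]
    rw [abs_le] at hs
    exact (U_Ri_iter k hz s (by simp; omega)).2.2.2.1

def HL (G : ℂ × ℂ → ℂ) : Prop := ∀ (k : ℕ) (s : ℤ),
  (|s| ≤ 2 → ∀ q, Gen q → ∃ L, Tendsto (fun p => G (RR^[k] (p, q))) (𝓝[≠] (s : ℂ)) (𝓝 L)) ∧
  (|s| ≤ 1 → ∀ p, Gen p → ∃ L, Tendsto (fun q => G (RR^[k] (p, q))) (𝓝[≠] (s : ℂ)) (𝓝 L))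

lemma lim_zero {s : ℂ} {N Q G : ℂ → ℂ} (hN : Continuous N) (hQ : Continuous Q)
    (hG : ∃ L, Tendsto G (𝓝[≠] s) (𝓝 L)) (h : ∀ᶠ p in 𝓝[≠] s, N p = (p - s) * Q p * G p) :
    N s = 0 := by
  obtain ⟨L, hL⟩ := hG
  have h1 : Tendsto N (𝓝[≠] s) (𝓝 (N s)) := (hN.tendsto s).mono_left nhdsWithin_le_nhds
  have h2 : Tendsto (fun p => (p - s) * Q p) (𝓝[≠] s) (𝓝 ((s - s) * Q s)) :=
    ((by fun_prop : Continuous fun p => (p - s) * Q p).tendsto s).mono_left nhdsWithin_le_nhds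
  have h3 := h2.mul hL
  have h4 := h3.congr' (h.mono fun p hp => hp.symm)
  simpa using tendsto_nhds_unique h1 h4

lemma rem_one {l N Q : Pol} (hl : Good l) {G : ℂ × ℂ → ℂ} (hG : HL G)
    (h : ∀ z, U z → ev N z = ev l z * ev Q z * G z) :
    ∃ N1 : Pol, ∀ z, U z → ev N1 z = ev Q z * G z := by
  have hl' := hl
  obtain ⟨⟨u, v, hd⟩, k, s, hc⟩ := hl
  have cN : Continuous fun z => ev N (RR^[k] z) := (ev_diff N).continuous.comp (cont_RR k)
  have cQ : Continuous fun z => ev Q (RR^[k] z) := (ev_diff Q).continuous.comp (cont_RR k)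
  obtain ⟨N1, hN1⟩ : ∃ N1, N = l * N1 := by
    refine dvd_of_vanish u v hd ?_
    rcases hc with ⟨hs, hc⟩ | ⟨hs, hc⟩
    · have key : ∀ q, ev N (RR^[k] (s, q)) = 0 := by
        refine eq_of_Gen (cN.comp (by fun_prop : Continuous fun q : ℂ => ((s : ℂ), q)))
          continuous_const ?_
        intro q hq
        refine lim_zero (s := s) (N := fun p => ev N (RR^[k] (p, q)))
          (Q := fun p => ev Q (RR^[k] (p, q)))
          (cN.comp (by fun_prop : Continuous fun p : ℂ => (p, q)))
          (cQ.comp (by fun_prop : Continuous fun p : ℂ => (p, q))) ((hG k s).1 hs q hq) ?_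
        filter_upwards [U_ev1 hq s] with p hp
        rw [h _ (U_RR_iter k hp), hc, Ri_RR_iter]
      intro z hz
      have e1 : (Ri^[k] z).1 = s := by
        rw [hc] at hz; linear_combination hz
      have := key (Ri^[k] z).2
      rw [← e1, Prod.mk.eta, RR_Ri_iter] at this
      exact this
    · have key : ∀ p, ev N (RR^[k] (p, s)) = 0 := by
        refine eq_of_Gen (cN.comp (by fun_prop : Continuous fun p : ℂ => (p, (s : ℂ))))
          continuous_const ?_
        intro p hp
        refine lim_zero (s := s) (N := fun q => ev N (RR^[k] (p, q)))
          (Q := fun q => ev Q (RR^[k] (p, q)))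
          (cN.comp (by fun_prop : Continuous fun q : ℂ => (p, q)))
          (cQ.comp (by fun_prop : Continuous fun q : ℂ => (p, q))) ((hG k s).2 hs p hp) ?_
        filter_upwards [U_ev2 hp s] with q hq
        rw [h _ (U_RR_iter k hq), hc, Ri_RR_iter]
      intro z hz
      have e1 : (Ri^[k] z).2 = s := by
        rw [hc] at hz; linear_combination hz
      have := key (Ri^[k] z).1
      rw [← e1, Prod.mk.eta, RR_Ri_iter] at this
      exact this
  refine ⟨N1, fun z hz => ?_⟩
  have := h z hz
  rw [hN1, ev_mul, mul_assoc] at this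
  exact mul_left_cancel₀ (hl'.ne hz) this

lemma rem_all {G : ℂ × ℂ → ℂ} (hG : HL G) (L : List Pol) (hL : ∀ l ∈ L, Good l) (N : Pol)
    (h : ∀ z, U z → ev N z = ev L.prod z * G z) : ∃ P : Pol, ∀ z, U z → ev P z = G z := by
  induction L generalizing N with
  | nil => exact ⟨N, fun z hz => by simpa using h z hz⟩
  | cons l L ih =>
    obtain ⟨N1, h1⟩ := rem_one (l := l) (N := N) (Q := L.prod) (hL l (by simp)) hG
      (by intro z hz; rw [h z hz, List.prod_cons, ev_mul])
    exact ih (fun l hl => hL l (by simp [hl])) N1 h1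

def Rat (g : ℂ × ℂ → ℂ) : Prop := ∃ (L : List Pol) (N : Pol), (∀ l ∈ L, Good l) ∧
  ∀ z, U z → ev N z = ev L.prod z * g z

lemma Rat.congr {g g' : ℂ × ℂ → ℂ} (h : Rat g) (e : ∀ z, g' z = g z) : Rat g' := by
  rwa [funext e]

lemma Rat.poly (P : Pol) : Rat (ev P) := ⟨[], P, by simp, by simp⟩

lemma Rat.mul {g g' : ℂ × ℂ → ℂ} (h : Rat g) (h' : Rat g') : Rat (fun z => g z * g' z) := by
  obtain ⟨L, N, h1, h2⟩ := h
  obtain ⟨L', N', h1', h2'⟩ := h'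
  refine ⟨L ++ L', N * N', ?_, ?_⟩
  · intro l hl
    rcases List.mem_append.mp hl with h | h
    exacts [h1 l h, h1' l h]
  · intro z hz
    rw [ev_mul, h2 z hz, h2' z hz, List.prod_append, ev_mul]; ring

lemma Rat.add {g g' : ℂ × ℂ → ℂ} (h : Rat g) (h' : Rat g') : Rat (fun z => g z + g' z) := by
  obtain ⟨L, N, h1, h2⟩ := h
  obtain ⟨L', N', h1', h2'⟩ := h'
  refine ⟨L ++ L', N * L'.prod + N' * L.prod, ?_, ?_⟩
  · intro l hl
    rcases List.mem_append.mp hl with h | h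
    exacts [h1 l h, h1' l h]
  · intro z hz
    rw [ev_add, ev_mul, ev_mul, h2 z hz, h2' z hz, List.prod_append, ev_mul]; ring

lemma Rat.const (c : ℂ) : Rat (fun _ => c) := (Rat.poly (MvPolynomial.C c)).congr (by simp)

/-- forms proportional to short roots, resp. long roots -/
def FB (t : ℂ × ℂ → ℂ) : Prop := ∃ T : Pol, (∀ z, ev T z = t z) ∧
  (∃ u v : ℂ, ∀ z : ℂ × ℂ, ∀ x : ℂ, t (z.1 + x * u, z.2 + x * v) = t z + x) ∧
  ∃ k : ℕ, ∀ z, t z = (Ri^[k] z).1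
def FA (t : ℂ × ℂ → ℂ) : Prop := ∃ T : Pol, (∀ z, ev T z = t z) ∧
  (∃ u v : ℂ, ∀ z : ℂ × ℂ, ∀ x : ℂ, t (z.1 + x * u, z.2 + x * v) = t z + x) ∧
  ∃ k : ℕ, ∀ z, t z = (Ri^[k] z).2

lemma FB.frac {t : ℂ × ℂ → ℂ} (h : FB t) (u w : ℂ) (s : ℤ) (hs : |s| ≤ 2) (hw : w = -s) :
    Rat (fun z => (t z + u) / (t z + w)) := by
  obtain ⟨T, hT, ⟨a, b, hd⟩, k, hk⟩ := h
  have g : Good (T + MvPolynomial.C w) := by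
    refine ⟨⟨a, b, fun z x => ?_⟩, k, s, Or.inl ⟨hs, fun z => ?_⟩⟩
    · simp only [ev_add, ev_C, hT, hd]; ring
    · simp only [ev_add, ev_C, hT, hk, hw]; ring
  refine ⟨[T + MvPolynomial.C w], T + MvPolynomial.C u, by simpa using g, fun z hz => ?_⟩
  have := g.ne hz
  simp only [ev_add, ev_C, hT, List.prod_singleton] at *
  field_simp

lemma FA.frac {t : ℂ × ℂ → ℂ} (h : FA t) (u w : ℂ) (s : ℤ) (hs : |s| ≤ 1) (hw : w = -s) :
    Rat (fun z => (t z + u) / (t z + w)) := by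
  obtain ⟨T, hT, ⟨a, b, hd⟩, k, hk⟩ := h
  have g : Good (T + MvPolynomial.C w) := by
    refine ⟨⟨a, b, fun z x => ?_⟩, k, s, Or.inr ⟨hs, fun z => ?_⟩⟩
    · simp only [ev_add, ev_C, hT, hd]; ring
    · simp only [ev_add, ev_C, hT, hk, hw]; ring
  refine ⟨[T + MvPolynomial.C w], T + MvPolynomial.C u, by simpa using g, fun z hz => ?_⟩
  have := g.ne hz
  simp only [ev_add, ev_C, hT, List.prod_singleton] at *
  field_simp

lemma FA.c1 {t : ℂ × ℂ → ℂ} (h : FA t) (m : ℂ) : Rat (fun z => c1 m (t z)) :=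
  h.frac _ _ 0 (by simp) (by simp)
lemma FA.c2 {t : ℂ × ℂ → ℂ} (h : FA t) (m : ℂ) : Rat (fun z => c2 m (t z)) :=
  (h.frac _ _ 0 (by simp) (by simp)).mul (h.frac _ _ (-1) (by simp) (by simp))
lemma FB.e1 {t : ℂ × ℂ → ℂ} (h : FB t) (m : ℂ) : Rat (fun z => e1 m (t z)) :=
  ((h.frac _ _ 0 (by simp) (by simp)).mul (h.frac _ _ 1 (by simp) (by simp))).mul
    (h.frac _ _ (-2) (by simp) (by simp))
lemma FB.e2 {t : ℂ × ℂ → ℂ} (h : FB t) (m : ℂ) : Rat (fun z => e2 m (t z)) :=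
  (h.frac _ _ 0 (by simp) (by simp)).mul (h.frac _ _ (-1) (by simp) (by simp))
lemma FB.e3 {t : ℂ × ℂ → ℂ} (h : FB t) (m : ℂ) : Rat (fun z => e3 m (t z)) :=
  ((h.frac _ _ 0 (by simp) (by simp)).mul (h.frac _ _ (-1) (by simp) (by simp))).mul
    (h.frac _ _ (-2) (by simp) (by simp))

lemma FB.mk' {t : ℂ × ℂ → ℂ} (a b u v : ℂ) (k : ℕ) (h : ∀ z, t z = a * z.1 + b * z.2)
    (huv : a * u + b * v = 1) (hk : ∀ z : ℂ × ℂ, a * z.1 + b * z.2 = (Ri^[k] z).1) : FB t := by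
  refine ⟨MvPolynomial.C a * MvPolynomial.X 0 + MvPolynomial.C b * MvPolynomial.X 1,
    by simp [h], ⟨u, v, fun z x => ?_⟩, k, fun z => by rw [h, hk]⟩
  simp only [h]
  linear_combination x * huv

lemma FA.mk' {t : ℂ × ℂ → ℂ} (a b u v : ℂ) (k : ℕ) (h : ∀ z, t z = a * z.1 + b * z.2)
    (huv : a * u + b * v = 1) (hk : ∀ z : ℂ × ℂ, a * z.1 + b * z.2 = (Ri^[k] z).2) : FA t := by
  refine ⟨MvPolynomial.C a * MvPolynomial.X 0 + MvPolynomial.C b * MvPolynomial.X 1,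
    by simp [h], ⟨u, v, fun z x => ?_⟩, k, fun z => by rw [h, hk]⟩
  simp only [h]
  linear_combination x * huv

section
variable {t : ℂ × ℂ → ℂ}
lemma FB0 (h : ∀ z, t z = 1 * z.1 + 0 * z.2) : FB t :=
  FB.mk' 1 0 1 0 0 h (by ring) (by intro z; simp)
lemma FB1 (h : ∀ z, t z = 1 / 2 * z.1 + 3 / 2 * z.2) : FB t :=
  FB.mk' _ _ 2 0 1 h (by ring) (by intro z; simp [Ri]; ring)
lemma FB2 (h : ∀ z, t z = -1 / 2 * z.1 + 3 / 2 * z.2) : FB t :=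
  FB.mk' _ _ (-2) 0 2 h (by ring) (by intro z; simp [Ri]; ring)
lemma FB3 (h : ∀ z, t z = -1 * z.1 + 0 * z.2) : FB t :=
  FB.mk' _ _ (-1) 0 3 h (by ring) (by intro z; simp [Ri]; ring)
lemma FB4 (h : ∀ z, t z = -1 / 2 * z.1 + -3 / 2 * z.2) : FB t :=
  FB.mk' _ _ (-2) 0 4 h (by ring) (by intro z; simp [Ri]; ring)
lemma FB5 (h : ∀ z, t z = 1 / 2 * z.1 + -3 / 2 * z.2) : FB t :=
  FB.mk' _ _ 2 0 5 h (by ring) (by intro z; simp [Ri]; ring)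
lemma FA0 (h : ∀ z, t z = 0 * z.1 + 1 * z.2) : FA t :=
  FA.mk' _ _ 0 1 0 h (by ring) (by intro z; simp)
lemma FA1 (h : ∀ z, t z = -1 / 2 * z.1 + 1 / 2 * z.2) : FA t :=
  FA.mk' _ _ 0 2 1 h (by ring) (by intro z; simp [Ri]; ring)
lemma FA2 (h : ∀ z, t z = -1 / 2 * z.1 + -1 / 2 * z.2) : FA t :=
  FA.mk' _ _ 0 (-2) 2 h (by ring) (by intro z; simp [Ri]; ring)
lemma FA3 (h : ∀ z, t z = 0 * z.1 + -1 * z.2) : FA t :=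
  FA.mk' _ _ 0 (-1) 3 h (by ring) (by intro z; simp [Ri]; ring)
lemma FA4 (h : ∀ z, t z = 1 / 2 * z.1 + -1 / 2 * z.2) : FA t :=
  FA.mk' _ _ 0 (-2) 4 h (by ring) (by intro z; simp [Ri]; ring)
lemma FA5 (h : ∀ z, t z = 1 / 2 * z.1 + 1 / 2 * z.2) : FA t :=
  FA.mk' _ _ 0 2 5 h (by ring) (by intro z; simp [Ri]; ring)
end

/-! ### the polynomial step -/

def EE (y z : ℂ × ℂ) : ℂ := exp (z.1 * y.1 + z.2 * y.2)
def psi (y : ℂ × ℂ) (P : Pol) (p q : ℂ) : ℂ := ev P (p, q) * EE y (p, q)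
def sh (y : ℂ × ℂ) (P : Pol) (c d : ℂ) (z : ℂ × ℂ) : ℂ :=
  EE y (c, d) * ev P (z.1 + c, z.2 + d) - ev P z

lemma EE_ne (y z : ℂ × ℂ) : EE y z ≠ 0 := exp_ne_zero _

lemma psi_sub (y : ℂ × ℂ) (P : Pol) (c d p q : ℂ) :
    psi y P (p + c) (q + d) - psi y P p q = sh y P c d (p, q) * EE y (p, q) := by
  have : EE y (p + c, q + d) = EE y (c, d) * EE y (p, q) := by
    simp only [EE, ← Complex.exp_add]; ring_nf
  simp only [psi, sh, this]; ring

def HH (m : ℂ) (y : ℂ × ℂ) (μ : ℂ) (P : Pol) (z : ℂ × ℂ) : ℂ :=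
  e3 m z.1 * l3 m z.2 z.1 * sh y P 3 1 z
  + e3 m (-z.1) * l3 m z.2 (-z.1) * sh y P (-3) 1 z
  + e3 m z.1 * l3 m (-z.2) z.1 * sh y P 3 (-1) z
  + e3 m (-z.1) * l3 m (-z.2) (-z.1) * sh y P (-3) (-1) z
  + e1 m z.1 * k1 m z.2 z.1 * sh y P 1 1 z
  + e1 m (-z.1) * k1 m z.2 (-z.1) * sh y P (-1) 1 z
  + e1 m z.1 * k1 m (-z.2) z.1 * sh y P 1 (-1) z
  + e1 m (-z.1) * k1 m (-z.2) (-z.1) * sh y P (-1) (-1) z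
  + e2 m z.1 * k2 m z.2 z.1 * sh y P 2 0 z
  + e2 m (-z.1) * k2 m z.2 (-z.1) * sh y P (-2) 0 z
  + l0 m z.2 z.1 * sh y P 0 2 z
  + l0 m (-z.2) z.1 * sh y P 0 (-2) z
  + -μ * ev P z

lemma D_psi (m : ℂ) (y : ℂ × ℂ) (μ : ℂ) (P : Pol) (p q : ℂ) :
    D m (psi y P) p q - μ * psi y P p q = HH m y μ P (p, q) * EE y (p, q) := by
  simp only [D, psi_sub, HH]
  simp only [psi]
  ring

lemma ev_shift (P : Pol) (c d : ℂ) : ∃ Q : Pol, ∀ z, ev Q z = ev P (z.1 + c, z.2 + d) :=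
  ⟨MvPolynomial.bind₁ ![MvPolynomial.X 0 + MvPolynomial.C c, MvPolynomial.X 1 + MvPolynomial.C d] P,
    fun z => by rw [ev_bind]; simp⟩

lemma rat_sh (y : ℂ × ℂ) (P : Pol) (c d : ℂ) : Rat (sh y P c d) := by
  obtain ⟨Q, hQ⟩ := ev_shift P c d
  refine (Rat.poly (MvPolynomial.C (EE y (c, d)) * Q - P)).congr fun z => ?_
  simp [sh, hQ]

section
variable (m : ℂ) {q p : ℂ × ℂ → ℂ}
lemma rat_l3 (h1 : FA (fun z => (q z + p z) / 2)) (h2 : FA q) (h3 : FA (fun z => (p z - q z) / 2))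
    (h4 : FB (fun z => (p z + 3 * q z) / 2)) : Rat (fun z => l3 m (q z) (p z)) :=
  (((h1.c2 m).mul (h2.c1 m)).mul (h3.c1 m)).mul (h4.e3 m)
lemma rat_k1 (h1 : FB (fun z => (p z + 3 * q z) / 2)) (h2 : FB (fun z => (3 * q z - p z) / 2))
    (h3 : FA q) (h4 : FA (fun z => (q z + p z) / 2)) : Rat (fun z => k1 m (q z) (p z)) :=
  ((((Rat.const 3).mul (h1.e2 m)).mul (h2.e1 m)).mul (h3.c1 m)).mul (h4.c1 m)
lemma rat_k2 (h1 : FB (fun z => (p z + 3 * q z) / 2)) (h2 : FB (fun z => (p z - 3 * q z) / 2))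
    (h3 : FA (fun z => (q z + p z) / 2)) (h4 : FA (fun z => (p z - q z) / 2)) :
    Rat (fun z => k2 m (q z) (p z)) :=
  ((((Rat.const 3).mul (h1.e1 m)).mul (h2.e1 m)).mul (h3.c1 m)).mul (h4.c1 m)
lemma rat_l0 (h0 : FA q) (h1 : FA (fun z => (q z - p z) / 2)) (h2 : FA (fun z => (q z + p z) / 2))
    (h3 : FB (fun z => (p z + 3 * q z) / 2)) (h4 : FB (fun z => (3 * q z - p z) / 2)) :
    Rat (fun z => l0 m (q z) (p z)) :=
  ((((h0.c2 m).mul (h1.c1 m)).mul (h2.c1 m)).mul (h3.e3 m)).mul (h4.e3 m)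
end

lemma rat_HH (m : ℂ) (y : ℂ × ℂ) (μ : ℂ) (P : Pol) : Rat (HH m y μ P) := by
  have bp : FB (fun z => z.1) := FB0 (by intro z; ring)
  have bn : FB (fun z => -z.1) := FB3 (by intro z; ring)
  have t1 := ((bp.e3 m).mul (rat_l3 m (q := fun z => z.2) (p := fun z => z.1)
    (FA5 (by intro z; ring)) (FA0 (by intro z; ring)) (FA4 (by intro z; ring))
    (FB1 (by intro z; ring)))).mul (rat_sh y P 3 1)
  have t2 := ((bn.e3 m).mul (rat_l3 m (q := fun z => z.2) (p := fun z => -z.1)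
    (FA1 (by intro z; ring)) (FA0 (by intro z; ring)) (FA2 (by intro z; ring))
    (FB2 (by intro z; ring)))).mul (rat_sh y P (-3) 1)
  have t3 := ((bp.e3 m).mul (rat_l3 m (q := fun z => -z.2) (p := fun z => z.1)
    (FA4 (by intro z; ring)) (FA3 (by intro z; ring)) (FA5 (by intro z; ring))
    (FB5 (by intro z; ring)))).mul (rat_sh y P 3 (-1))
  have t4 := ((bn.e3 m).mul (rat_l3 m (q := fun z => -z.2) (p := fun z => -z.1)
    (FA2 (by intro z; ring)) (FA3 (by intro z; ring)) (FA1 (by intro z; ring))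
    (FB4 (by intro z; ring)))).mul (rat_sh y P (-3) (-1))
  have t5 := ((bp.e1 m).mul (rat_k1 m (q := fun z => z.2) (p := fun z => z.1)
    (FB1 (by intro z; ring)) (FB2 (by intro z; ring)) (FA0 (by intro z; ring))
    (FA5 (by intro z; ring)))).mul (rat_sh y P 1 1)
  have t6 := ((bn.e1 m).mul (rat_k1 m (q := fun z => z.2) (p := fun z => -z.1)
    (FB2 (by intro z; ring)) (FB1 (by intro z; ring)) (FA0 (by intro z; ring))
    (FA1 (by intro z; ring)))).mul (rat_sh y P (-1) 1)
  have t7 := ((bp.e1 m).mul (rat_k1 m (q := fun z => -z.2) (p := fun z => z.1)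
    (FB5 (by intro z; ring)) (FB4 (by intro z; ring)) (FA3 (by intro z; ring))
    (FA4 (by intro z; ring)))).mul (rat_sh y P 1 (-1))
  have t8 := ((bn.e1 m).mul (rat_k1 m (q := fun z => -z.2) (p := fun z => -z.1)
    (FB4 (by intro z; ring)) (FB5 (by intro z; ring)) (FA3 (by intro z; ring))
    (FA2 (by intro z; ring)))).mul (rat_sh y P (-1) (-1))
  have t9 := ((bp.e2 m).mul (rat_k2 m (q := fun z => z.2) (p := fun z => z.1)
    (FB1 (by intro z; ring)) (FB5 (by intro z; ring)) (FA5 (by intro z; ring))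
    (FA4 (by intro z; ring)))).mul (rat_sh y P 2 0)
  have t10 := ((bn.e2 m).mul (rat_k2 m (q := fun z => z.2) (p := fun z => -z.1)
    (FB2 (by intro z; ring)) (FB4 (by intro z; ring)) (FA1 (by intro z; ring))
    (FA2 (by intro z; ring)))).mul (rat_sh y P (-2) 0)
  have t11 := (rat_l0 m (q := fun z => z.2) (p := fun z => z.1)
    (FA0 (by intro z; ring)) (FA1 (by intro z; ring)) (FA5 (by intro z; ring))
    (FB1 (by intro z; ring)) (FB2 (by intro z; ring))).mul (rat_sh y P 0 2)
  have t12 := (rat_l0 m (q := fun z => -z.2) (p := fun z => z.1)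
    (FA3 (by intro z; ring)) (FA2 (by intro z; ring)) (FA4 (by intro z; ring))
    (FB5 (by intro z; ring)) (FB4 (by intro z; ring))).mul (rat_sh y P 0 (-2))
  exact (((((((((((t1.add t2).add t3).add t4).add t5).add t6).add t7).add t8).add t9).add t10).add
    t11).add t12).add ((Rat.const (-μ)).mul (Rat.poly P))

/-- full quasi-invariance -/
def QI (m : ℕ) (f : ℂ → ℂ → ℂ) : Prop := ∀ k : ℕ, QB m (rot^[k] f) ∧ QA m (rot^[k] f)

lemma psi_diff (y : ℂ × ℂ) (P : Pol) : Differentiable ℂ (fun z : ℂ × ℂ => psi y P z.1 z.2) := by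
  have h : Differentiable ℂ (fun z : ℂ × ℂ => EE y z) := by unfold EE; fun_prop
  exact (ev_diff P).mul h

lemma rot_diff {f : ℂ → ℂ → ℂ} (hf : Differentiable ℂ (fun z : ℂ × ℂ => f z.1 z.2)) (k : ℕ) :
    Differentiable ℂ (fun z : ℂ × ℂ => rot^[k] f z.1 z.2) := by
  have : (fun z : ℂ × ℂ => rot^[k] f z.1 z.2) = (fun z : ℂ × ℂ => f z.1 z.2) ∘ RR^[k] :=
    funext fun z => rot_iter k f z.1 z.2
  rw [this]
  exact hf.comp (diff_RR k)

lemma Ent.of_diff {f : ℂ → ℂ → ℂ} (hf : Differentiable ℂ (fun z : ℂ × ℂ => f z.1 z.2)) : Ent f :=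
  ⟨fun q => hf.comp (by fun_prop : Differentiable ℂ fun p : ℂ => (p, q)),
   fun p => hf.comp (by fun_prop : Differentiable ℂ fun q : ℂ => (p, q))⟩

lemma lim_int {P : ℤ → Prop} {X : ℂ → ℂ} (Pn : ∀ s, P s → P (-s))
    (h : ∀ s : ℕ, P s → ∃ L, Tendsto X (𝓝[≠] (s : ℂ)) (𝓝 L) ∧ Tendsto X (𝓝[≠] (-s : ℂ)) (𝓝 L))
    (s : ℤ) (hs : P s) : ∃ L, Tendsto X (𝓝[≠] (s : ℂ)) (𝓝 L) := by
  obtain ⟨n, rfl | rfl⟩ := s.eq_nat_or_neg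
  · obtain ⟨L, h1, h2⟩ := h n hs
    exact ⟨L, by simpa using h1⟩
  · obtain ⟨L, h1, h2⟩ := h n (by simpa using Pn _ hs)
    exact ⟨L, by simpa using h2⟩

lemma HL_HH {m : ℕ} (hm : 1 ≤ m) (y : ℂ × ℂ) (μ : ℂ) (P : Pol) (hQ : QI m (psi y P)) :
    HL (HH m y μ P) := by
  have key : ∀ z, HH m y μ P z = (D m (psi y P) z.1 z.2 - μ * psi y P z.1 z.2) / EE y z := by
    intro z
    rw [D_psi, eq_div_iff (EE_ne y z)]
  intro k s
  have hE := Ent.of_diff (rot_diff (psi_diff y P) k)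
  have cE : Continuous fun z => EE y (RR^[k] z) := by
    have : Continuous (EE y) := by unfold EE; fun_prop
    exact this.comp (cont_RR k)
  have cψ : Continuous fun z : ℂ × ℂ => rot^[k] (psi y P) z.1 z.2 :=
    (rot_diff (psi_diff y P) k).continuous
  have key2 : ∀ p q, HH m y μ P (RR^[k] (p, q)) =
      (D m (rot^[k] (psi y P)) p q - μ * rot^[k] (psi y P) p q) / EE y (RR^[k] (p, q)) := by
    intro p q
    rw [key, D_rot_iter, rot_iter, rot_iter]
  have fin : ∀ (g : ℂ → ℂ × ℂ), Continuous g →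
      (∃ L, Tendsto (fun p => D m (rot^[k] (psi y P)) (g p).1 (g p).2) (𝓝[≠] (s : ℂ)) (𝓝 L)) →
      ∃ L, Tendsto (fun p => HH m y μ P (RR^[k] (g p))) (𝓝[≠] (s : ℂ)) (𝓝 L) := by
    rintro g hg ⟨L, hL⟩
    have h1 : Tendsto (fun p => rot^[k] (psi y P) (g p).1 (g p).2) (𝓝[≠] (s : ℂ)) (𝓝 _) :=
      ((cψ.comp hg).tendsto (s : ℂ)).mono_left nhdsWithin_le_nhds
    have h2 : Tendsto (fun p => EE y (RR^[k] (g p))) (𝓝[≠] (s : ℂ)) (𝓝 _) :=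
      ((cE.comp hg).tendsto (s : ℂ)).mono_left nhdsWithin_le_nhds
    have h3 := (hL.sub (h1.const_mul μ)).div h2 (EE_ne _ _)
    exact ⟨_, h3.congr fun p => (key2 _ _).symm⟩
  refine ⟨fun hs q hq => fin (fun p => (p, q)) (by fun_prop) ?_,
    fun hs p hp => fin (fun q => (p, q)) (by fun_prop) ?_⟩
  · exact lim_int (P := inB m) (fun s h => inB_neg h) (fun s h => beta hm hE (hQ k).1 hq s h) s
      (Or.inl (by omega))
  · exact lim_int (P := inA m) (fun s h => inA_neg h) (fun s h => alpha hm hE (hQ k).2 hp s h) s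
      (by unfold inA; omega)

lemma eq_of_lims {X Y : ℂ → ℂ} {s L : ℂ} (hX : Continuous X) (hY : Tendsto Y (𝓝[≠] s) (𝓝 L))
    (h : ∀ᶠ p in 𝓝[≠] s, X p = Y p) : X s = L := by
  have h1 : Tendsto X (𝓝[≠] s) (𝓝 (X s)) := (hX.tendsto s).mono_left nhdsWithin_le_nhds
  exact tendsto_nhds_unique (h1.congr' h) hY

lemma step_QI {m : ℕ} (hm : 1 ≤ m) (y : ℂ × ℂ) (μ : ℂ) (P P' : Pol) (hQ : QI m (psi y P))
    (h : ∀ z, U z → ev P' z = HH m y μ P z) : QI m (psi y P') := by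
  intro k
  have hE := Ent.of_diff (rot_diff (psi_diff y P) k)
  have hE' := Ent.of_diff (rot_diff (psi_diff y P') k)
  have key : ∀ p q, U (p, q) → rot^[k] (psi y P') p q =
      D m (rot^[k] (psi y P)) p q - μ * rot^[k] (psi y P) p q := by
    intro p q hz
    rw [D_rot_iter, rot_iter, rot_iter, rot_iter, D_psi, ← h _ (U_RR_iter k hz)]
    rfl
  have T : ∀ {X : ℂ → ℂ} (hX : Differentiable ℂ X) (s : ℂ),
      Tendsto X (𝓝[≠] s) (𝓝 (X s)) := fun hX s =>
    (hX.continuous.tendsto s).mono_left nhdsWithin_le_nhds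
  constructor
  · intro s hs
    refine eq_of_Gen (hE'.2 _).continuous (hE'.2 _).continuous fun q hq => ?_
    obtain ⟨L, h1, h2⟩ := beta hm hE (hQ k).1 hq s hs
    have a1 := eq_of_lims (hE'.1 q).continuous (h1.sub ((T (hE.1 q) s).const_mul μ))
      ((U_ev1 hq _).mono fun p hp => key p q hp)
    have a2 := eq_of_lims (hE'.1 q).continuous (h2.sub ((T (hE.1 q) (-s)).const_mul μ))
      ((U_ev1 hq _).mono fun p hp => key p q hp)
    rw [a1, a2, (hQ k).1 s hs q]
  · intro s hs
    refine eq_of_Gen (hE'.1 _).continuous (hE'.1 _).continuous fun p hp => ?_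
    obtain ⟨L, h1, h2⟩ := alpha hm hE (hQ k).2 hp s hs
    have a1 := eq_of_lims (hE'.2 p).continuous (h1.sub ((T (hE.2 p) s).const_mul μ))
      ((U_ev2 hp _).mono fun q hq => key p q hq)
    have a2 := eq_of_lims (hE'.2 p).continuous (h2.sub ((T (hE.2 p) (-s)).const_mul μ))
      ((U_ev2 hp _).mono fun q hq => key p q hq)
    rw [a1, a2, (hQ k).2 s hs p]

theorem poly_step {m : ℕ} (hm : 1 ≤ m) (y : ℂ × ℂ) (μ : ℂ) (P : Pol) (hQ : QI m (psi y P)) :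
    ∃ P' : Pol, (∀ z, U z → ev P' z = HH m y μ P z) ∧ QI m (psi y P') := by
  obtain ⟨L, N, hL, hN⟩ := rat_HH m y μ P
  obtain ⟨P', hP'⟩ := rem_all (HL_HH hm y μ P hQ) L hL N hN
  exact ⟨P', hP', step_QI hm y μ P P' hQ hP'⟩

/-! ### asymptotics at infinity -/

def As (g : ℂ → ℂ) (c : ℂ) : Prop :=
  ∃ h : ℂ → ℂ, HasDerivAt h c 0 ∧ h 0 = 1 ∧ ∀ ε : ℂ, ε ≠ 0 → g ε = h ε

lemma As.mul {f g : ℂ → ℂ} {a b : ℂ} (hf : As f a) (hg : As g b) :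
    As (fun ε => f ε * g ε) (a + b) := by
  obtain ⟨f', h1, h2, h3⟩ := hf
  obtain ⟨g', k1, k2, k3⟩ := hg
  refine ⟨fun ε => f' ε * g' ε, ?_, by simp [h2, k2], fun ε he => by simp only [h3 ε he, k3 ε he]⟩
  have := h1.mul k1
  rw [h2, k2] at this
  exact this.congr_deriv (by ring)

lemma As.cc {f : ℂ → ℂ} {a b : ℂ} (hf : As f a) (h : a = b) : As f b := h ▸ hf

lemma As.frac {g : ℂ → ℂ} (b σ : ℂ) (hb : b ≠ 0) (hσ : σ * σ = 1) (u w : ℂ)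
    (hg : ∀ ε, g ε = σ * (b / ε)) : As (fun ε => (g ε + u) / (g ε + w)) ((u - w) * σ * b⁻¹) := by
  refine ⟨fun ε => (b + σ * u * ε) / (b + σ * w * ε), ?_, by simp [hb], fun ε he => ?_⟩
  · have h1 : ∀ u : ℂ, HasDerivAt (fun ε : ℂ => b + σ * u * ε) (σ * u) 0 := fun u => by
      simpa using ((hasDerivAt_id (0 : ℂ)).const_mul (σ * u)).const_add b
    have := (h1 u).div (h1 w) (by simpa using hb)
    refine this.congr_deriv ?_
    simp only [mul_zero, add_zero]
    field_simp
  · have hs : σ ≠ 0 := by rintro rfl; simp at hσ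
    have e : ∀ u, b + σ * u * ε = (σ * ε) * (g ε + u) := fun u => by
      rw [hg]; field_simp; linear_combination (-b) * hσ
    simp only [e]
    rw [mul_div_mul_left _ _ (mul_ne_zero hs he)]

section
variable (m : ℂ) {g : ℂ → ℂ} (b σ : ℂ) (hb : b ≠ 0) (hσ : σ * σ = 1) (hg : ∀ ε, g ε = σ * (b / ε))
lemma As.c1 {g : ℂ → ℂ} (b σ : ℂ) (hb : b ≠ 0) (hσ : σ * σ = 1)
    (hg : ∀ ε, g ε = σ * (b / ε)) : As (fun ε => c1 m (g ε)) (-m * σ * b⁻¹) :=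
  (As.frac b σ hb hσ _ _ hg).cc (by ring)
lemma As.c2 {g : ℂ → ℂ} (b σ : ℂ) (hb : b ≠ 0) (hσ : σ * σ = 1)
    (hg : ∀ ε, g ε = σ * (b / ε)) : As (fun ε => c2 m (g ε)) (-(2 * m) * σ * b⁻¹) :=
  ((As.frac b σ hb hσ _ _ hg).mul (As.frac b σ hb hσ _ _ hg)).cc (by ring)
lemma As.e1 {g : ℂ → ℂ} (b σ : ℂ) (hb : b ≠ 0) (hσ : σ * σ = 1)
    (hg : ∀ ε, g ε = σ * (b / ε)) : As (fun ε => e1 m (g ε)) (-(3 * m + 1) * σ * b⁻¹) :=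
  (((As.frac b σ hb hσ _ _ hg).mul (As.frac b σ hb hσ _ _ hg)).mul
    (As.frac b σ hb hσ _ _ hg)).cc (by ring)
lemma As.e2 {g : ℂ → ℂ} (b σ : ℂ) (hb : b ≠ 0) (hσ : σ * σ = 1)
    (hg : ∀ ε, g ε = σ * (b / ε)) : As (fun ε => e2 m (g ε)) (-(2 * (3 * m + 1)) * σ * b⁻¹) :=
  ((As.frac b σ hb hσ _ _ hg).mul (As.frac b σ hb hσ _ _ hg)).cc (by ring)
lemma As.e3 {g : ℂ → ℂ} (b σ : ℂ) (hb : b ≠ 0) (hσ : σ * σ = 1)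
    (hg : ∀ ε, g ε = σ * (b / ε)) : As (fun ε => e3 m (g ε)) (-(3 * (3 * m + 1)) * σ * b⁻¹) :=
  (((As.frac b σ hb hσ _ _ hg).mul (As.frac b σ hb hσ _ _ hg)).mul
    (As.frac b σ hb hσ _ _ hg)).cc (by ring)
end

def b2 (z : ℂ × ℂ) : ℂ := (z.1 + 3 * z.2) / 2
def b3 (z : ℂ × ℂ) : ℂ := (3 * z.2 - z.1) / 2
def a2 (z : ℂ × ℂ) : ℂ := (z.2 - z.1) / 2
def a3 (z : ℂ × ℂ) : ℂ := (z.2 + z.1) / 2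

def Reg (z : ℂ × ℂ) : Prop := z.1 ≠ 0 ∧ b2 z ≠ 0 ∧ b3 z ≠ 0 ∧ z.2 ≠ 0 ∧ a2 z ≠ 0 ∧ a3 z ≠ 0

def CC (m : ℂ) (z τ : ℂ × ℂ) : ℂ :=
  -(m * (τ.2 * z.2⁻¹ + a2 τ * (a2 z)⁻¹ + a3 τ * (a3 z)⁻¹)
    + (3 * m + 1) * (τ.1 * z.1⁻¹ + b2 τ * (b2 z)⁻¹ + b3 τ * (b3 z)⁻¹))

section
variable (m : ℂ)
lemma as_l3 {q p : ℂ → ℂ} (z : ℂ × ℂ) (hz : Reg z) (hq : ∀ ε, q ε = z.2 / ε)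
    (hp : ∀ ε, p ε = z.1 / ε) :
    As (fun ε => e3 m (p ε) * l3 m (q ε) (p ε)) (CC m z (3, 1)) := by
  obtain ⟨h1, h2, h3, h4, h5, h6⟩ := hz
  have o : (1 : ℂ) * 1 = 1 := by norm_num
  have o' : (-1 : ℂ) * -1 = 1 := by norm_num
  refine ((As.e3 m _ 1 h1 o (by intro ε; rw [hp]; ring)).mul
    ((((As.c2 m _ 1 h6 o (by intro ε; rw [hp, hq]; simp only [a3]; ring)).mul
    (As.c1 m _ 1 h4 o (by intro ε; rw [hq]; ring))).mul
    (As.c1 m _ (-1) h5 o' (by intro ε; rw [hp, hq]; simp only [a2]; ring))).mul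
    (As.e3 m _ 1 h2 o (by intro ε; rw [hp, hq]; simp only [b2]; ring)))).cc ?_
  rw [CC]
  generalize (b2 z)⁻¹ = B2; generalize (b3 z)⁻¹ = B3
  generalize (a2 z)⁻¹ = A2; generalize (a3 z)⁻¹ = A3
  simp only [a2, a3, b2, b3]
  ring

lemma as_k1 {q p : ℂ → ℂ} (z : ℂ × ℂ) (hz : Reg z) (hq : ∀ ε, q ε = z.2 / ε)
    (hp : ∀ ε, p ε = z.1 / ε) :
    As (fun ε => e1 m (p ε) * k1 m (q ε) (p ε) / 3) (CC m z (1, 1)) := by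
  obtain ⟨h1, h2, h3, h4, h5, h6⟩ := hz
  have o : (1 : ℂ) * 1 = 1 := by norm_num
  have T := ((As.e1 m _ 1 h1 o (g := p) (by intro ε; rw [hp]; ring)).mul
    ((((As.e2 m _ 1 h2 o (g := fun ε => (p ε + 3 * q ε) / 2)
      (by intro ε; rw [hp, hq]; simp only [b2]; ring)).mul
    (As.e1 m _ 1 h3 o (g := fun ε => (3 * q ε - p ε) / 2)
      (by intro ε; rw [hp, hq]; simp only [b3]; ring))).mul
    (As.c1 m _ 1 h4 o (g := q) (by intro ε; rw [hq]; ring))).mul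
    (As.c1 m _ 1 h6 o (g := fun ε => (q ε + p ε) / 2)
      (by intro ε; rw [hp, hq]; simp only [a3]; ring))))
  have T2 := T.cc (b := CC m z (1, 1)) (by
    rw [CC]
    generalize (b2 z)⁻¹ = B2; generalize (b3 z)⁻¹ = B3
    generalize (a2 z)⁻¹ = A2; generalize (a3 z)⁻¹ = A3
    simp only [a2, a3, b2, b3]
    ring)
  obtain ⟨f, f1, f2, f3⟩ := T2
  refine ⟨f, f1, f2, fun ε he => ?_⟩
  rw [← f3 ε he]; simp only [k1]; ring

lemma as_k2 {q p : ℂ → ℂ} (z : ℂ × ℂ) (hz : Reg z) (hq : ∀ ε, q ε = z.2 / ε)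
    (hp : ∀ ε, p ε = z.1 / ε) :
    As (fun ε => e2 m (p ε) * k2 m (q ε) (p ε) / 3) (CC m z (2, 0)) := by
  obtain ⟨h1, h2, h3, h4, h5, h6⟩ := hz
  have o : (1 : ℂ) * 1 = 1 := by norm_num
  have o' : (-1 : ℂ) * -1 = 1 := by norm_num
  have T := ((As.e2 m _ 1 h1 o (g := p) (by intro ε; rw [hp]; ring)).mul
    ((((As.e1 m _ 1 h2 o (g := fun ε => (p ε + 3 * q ε) / 2)
      (by intro ε; rw [hp, hq]; simp only [b2]; ring)).mul
    (As.e1 m _ (-1) h3 o' (g := fun ε => (p ε - 3 * q ε) / 2)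
      (by intro ε; rw [hp, hq]; simp only [b3]; ring))).mul
    (As.c1 m _ 1 h6 o (g := fun ε => (q ε + p ε) / 2)
      (by intro ε; rw [hp, hq]; simp only [a3]; ring))).mul
    (As.c1 m _ (-1) h5 o' (g := fun ε => (p ε - q ε) / 2)
      (by intro ε; rw [hp, hq]; simp only [a2]; ring))))
  have T2 := T.cc (b := CC m z (2, 0)) (by
    rw [CC]
    generalize (b2 z)⁻¹ = B2; generalize (b3 z)⁻¹ = B3
    generalize (a2 z)⁻¹ = A2; generalize (a3 z)⁻¹ = A3
    simp only [a2, a3, b2, b3]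
    ring)
  obtain ⟨f, f1, f2, f3⟩ := T2
  refine ⟨f, f1, f2, fun ε he => ?_⟩
  rw [← f3 ε he]; simp only [k2]; ring

lemma as_l0 {q p : ℂ → ℂ} (z : ℂ × ℂ) (hz : Reg z) (hq : ∀ ε, q ε = z.2 / ε)
    (hp : ∀ ε, p ε = z.1 / ε) :
    As (fun ε => l0 m (q ε) (p ε)) (CC m z (0, 2)) := by
  obtain ⟨h1, h2, h3, h4, h5, h6⟩ := hz
  have o : (1 : ℂ) * 1 = 1 := by norm_num
  refine ((((((As.c2 m _ 1 h4 o (by intro ε; rw [hq]; ring)).mul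
    (As.c1 m _ 1 h5 o (by intro ε; rw [hp, hq]; simp only [a2]; ring))).mul
    (As.c1 m _ 1 h6 o (by intro ε; rw [hp, hq]; simp only [a3]; ring))).mul
    (As.e3 m _ 1 h2 o (by intro ε; rw [hp, hq]; simp only [b2]; ring)))).mul
    (As.e3 m _ 1 h3 o (by intro ε; rw [hp, hq]; simp only [b3]; ring))).cc ?_
  rw [CC]
  generalize (b2 z)⁻¹ = B2; generalize (b3 z)⁻¹ = B3
  generalize (a2 z)⁻¹ = A2; generalize (a3 z)⁻¹ = A3
  simp only [a2, a3, b2, b3]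
  ring
end

lemma Reg.n1 {z : ℂ × ℂ} (h : Reg z) : Reg (-z.1, z.2) := by
  obtain ⟨h1, h2, h3, h4, h5, h6⟩ := h
  simp only [Reg, a2, a3, b2, b3] at *
  refine ⟨by simpa using h1, fun h => h3 ?_, fun h => h2 ?_, h4, fun h => h6 ?_, fun h => h5 ?_⟩ <;>
  linear_combination h

lemma Reg.n2 {z : ℂ × ℂ} (h : Reg z) : Reg (z.1, -z.2) := by
  obtain ⟨h1, h2, h3, h4, h5, h6⟩ := h
  simp only [Reg, a2, a3, b2, b3] at *
  refine ⟨h1, fun h => h3 ?_, fun h => h2 ?_, by simpa using h4, fun h => h6 ?_, fun h => h5 ?_⟩ <;>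
  linear_combination -h

lemma CC_n1 (m : ℂ) (z : ℂ × ℂ) (c d : ℂ) : CC m (-z.1, z.2) (c, d) = CC m z (-c, d) := by
  have e1 : b2 (-z.1, z.2) = b3 z := by simp only [b2, b3]; ring
  have e2 : b3 (-z.1, z.2) = b2 z := by simp only [b2, b3]; ring
  have e3 : a2 (-z.1, z.2) = a3 z := by simp only [a2, a3]; ring
  have e4 : a3 (-z.1, z.2) = a2 z := by simp only [a2, a3]; ring
  rw [CC, CC, e1, e2, e3, e4]
  generalize (b2 z)⁻¹ = B2; generalize (b3 z)⁻¹ = B3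
  generalize (a2 z)⁻¹ = A2; generalize (a3 z)⁻¹ = A3
  simp only [a2, a3, b2, b3]
  ring

lemma CC_n2 (m : ℂ) (z : ℂ × ℂ) (c d : ℂ) : CC m (z.1, -z.2) (c, d) = CC m z (c, -d) := by
  have e1 : b2 (z.1, -z.2) = -b3 z := by simp only [b2, b3]; ring
  have e2 : b3 (z.1, -z.2) = -b2 z := by simp only [b2, b3]; ring
  have e3 : a2 (z.1, -z.2) = -a3 z := by simp only [a2, a3]; ring
  have e4 : a3 (z.1, -z.2) = -a2 z := by simp only [a2, a3]; ring
  rw [CC, CC, e1, e2, e3, e4]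
  simp only [inv_neg]
  generalize (b2 z)⁻¹ = B2; generalize (b3 z)⁻¹ = B3
  generalize (a2 z)⁻¹ = A2; generalize (a3 z)⁻¹ = A3
  simp only [a2, a3, b2, b3]
  ring

/-! ### homogeneous components -/

def hc (i : ℕ) (P : Pol) : Pol := MvPolynomial.homogeneousComponent i P

def dl (τ : ℂ × ℂ) : Derivation ℂ Pol Pol :=
  MvPolynomial.mkDerivation ℂ ![MvPolynomial.C τ.1, MvPolynomial.C τ.2]

lemma homog_scale {P : Pol} {n : ℕ} (h : P.IsHomogeneous n) (ε : ℂ) (z : ℂ × ℂ) :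
    ev P (ε * z.1, ε * z.2) = ε ^ n * ev P z := by
  simp only [ev, MvPolynomial.eval_eq', Finset.mul_sum]
  refine Finset.sum_congr rfl fun d hd => ?_
  have := h (MvPolynomial.mem_support_iff.mp hd)
  have e : d 0 + d 1 = n := by
    rw [← this]
    simp [Finsupp.weight_apply, Finsupp.sum_fintype]
  simp only [Fin.prod_univ_two, Matrix.cons_val_zero, Matrix.cons_val_one]
  rw [← e]; ring

def SS (P : Pol) (d : ℕ) (ε : ℂ) (w : ℂ × ℂ) : ℂ :=
  ∑ i ∈ Finset.range (d + 1), ε ^ (d - i) * ev (hc i P) w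

lemma ev_sum {ι : Type*} (s : Finset ι) (f : ι → Pol) (z) :
    ev (∑ i ∈ s, f i) z = ∑ i ∈ s, ev (f i) z := by
  simp [ev]

lemma sum_hc {P : Pol} {d : ℕ} (h : P.totalDegree ≤ d) :
    ∑ i ∈ Finset.range (d + 1), hc i P = P := by
  conv_rhs => rw [← MvPolynomial.sum_homogeneousComponent P]
  symm
  refine Finset.sum_subset (fun i hi => ?_) (fun i _ hi => ?_)
  · simp at *; omega
  · refine MvPolynomial.homogeneousComponent_eq_zero _ _ ?_
    simp at hi; omega

lemma SS_eq {P : Pol} {d : ℕ} (h : P.totalDegree ≤ d) {ε : ℂ} (he : ε ≠ 0) (w : ℂ × ℂ) :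
    ε ^ d * ev P (w.1 / ε, w.2 / ε) = SS P d ε w := by
  conv_lhs => rw [← sum_hc h, ev_sum, Finset.mul_sum]
  refine Finset.sum_congr rfl fun i hi => ?_
  have e : (w.1 / ε, w.2 / ε) = (ε⁻¹ * w.1, ε⁻¹ * w.2) := by
    ext <;> simp <;> ring
  rw [e, homog_scale (P := hc i P) (MvPolynomial.homogeneousComponent_isHomogeneous i P), ← mul_assoc]
  congr 1
  have : i ≤ d := by simp at hi; omega
  obtain ⟨j, rfl⟩ := Nat.exists_eq_add_of_le this
  rw [Nat.add_sub_cancel_left, pow_add, inv_pow]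
  field_simp

lemma deriv_ev (Q : Pol) (z τ : ℂ × ℂ) :
    HasDerivAt (fun ε : ℂ => ev Q (z.1 + ε * τ.1, z.2 + ε * τ.2)) (ev (dl τ Q) z) 0 := by
  induction Q using MvPolynomial.induction_on with
  | C a =>
    simp only [ev_C]
    have : dl τ (MvPolynomial.C a) = 0 := Derivation.map_algebraMap (dl τ) a
    rw [this, ev_zero]
    exact hasDerivAt_const _ _
  | add p q hp hq =>
    simp only [ev_add, map_add]
    exact hp.add hq
  | mul_X p i hp =>
    have hX : HasDerivAt (fun ε : ℂ => ev (MvPolynomial.X i) (z.1 + ε * τ.1, z.2 + ε * τ.2))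
        (ev (dl τ (MvPolynomial.X i)) z) 0 := by
      have k : ∀ a b : ℂ, HasDerivAt (fun ε : ℂ => a + ε * b) b 0 := fun a b => by
        simpa using ((hasDerivAt_id (0 : ℂ)).mul_const b).const_add a
      fin_cases i
      · simp only [Fin.zero_eta, dl, MvPolynomial.mkDerivation_X, ev_X0]
        simpa using k z.1 τ.1
      · simp only [Fin.mk_one, dl, MvPolynomial.mkDerivation_X, ev_X1]
        simpa using k z.2 τ.2
    simp only [ev_mul, Derivation.leibniz, ev_add, smul_eq_mul]
    refine (hp.mul hX).congr_deriv ?_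
    simp; ring

def s1 (P : Pol) (d : ℕ) (z : ℂ × ℂ) : ℂ :=
  ∑ i ∈ Finset.range (d + 1), ((d - i : ℕ) : ℂ) * 0 ^ (d - i - 1) * ev (hc i P) z

lemma SS_zero (P : Pol) (d : ℕ) (z : ℂ × ℂ) : SS P d 0 z = ev (hc d P) z := by
  rw [SS, Finset.sum_range_succ, Finset.sum_eq_zero]
  · simp
  · intro i hi
    have : d - i ≠ 0 := by simp at hi; omega
    simp [this]

lemma SS_deriv (P : Pol) (d : ℕ) (z τ : ℂ × ℂ) :
    HasDerivAt (fun ε : ℂ => SS P d ε (z.1 + ε * τ.1, z.2 + ε * τ.2))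
      (s1 P d z + ev (dl τ (hc d P)) z) 0 := by
  have h : HasDerivAt (fun ε : ℂ => SS P d ε (z.1 + ε * τ.1, z.2 + ε * τ.2))
      (∑ i ∈ Finset.range (d + 1), (((d - i : ℕ) : ℂ) * 0 ^ (d - i - 1) * ev (hc i P) z
        + 0 ^ (d - i) * ev (dl τ (hc i P)) z)) 0 := by
    refine HasDerivAt.fun_sum fun i _ => ?_
    refine ((hasDerivAt_pow (d - i) (0 : ℂ)).mul (deriv_ev (hc i P) z τ)).congr_deriv ?_
    simp
  refine h.congr_deriv ?_
  rw [Finset.sum_add_distrib, s1]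
  congr 1
  rw [Finset.sum_range_succ, Finset.sum_eq_zero]
  · simp
  · intro i hi
    have : d - i ≠ 0 := by simp at hi; omega
    simp [this]

lemma SS_deriv0 (P : Pol) (d : ℕ) (z : ℂ × ℂ) :
    HasDerivAt (fun ε : ℂ => SS P d ε z) (s1 P d z) 0 := by
  have := SS_deriv P d z (0, 0)
  simp only [mul_zero, add_zero] at this
  refine this.congr_deriv ?_
  have e : ev (dl (0, 0) (hc d P)) z = 0 := by
    have h := deriv_ev (hc d P) z (0, 0)
    simp only [mul_zero, add_zero] at h
    exact h.unique (hasDerivAt_const _ _)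
  rw [e, add_zero]

def Delta : Pol :=
  let C := MvPolynomial.C (R := ℂ) (σ := Fin 2)
  let X := MvPolynomial.X (R := ℂ) (σ := Fin 2)
  X 0 * (C (1/2) * (X 0 + C 3 * X 1)) * (C (1/2) * (C 3 * X 1 - X 0)) *
    (X 1) * (C (1/2) * (X 1 - X 0)) * (C (1/2) * (X 1 + X 0))

lemma ev_Delta (z : ℂ × ℂ) : ev Delta z = z.1 * b2 z * b3 z * z.2 * a2 z * a3 z := by
  simp only [Delta, ev_mul, ev_add, ev_sub, ev_C, ev_X0, ev_X1, b2, b3, a2, a3]; ring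

lemma eq_of_Reg {P Q : Pol} (h : ∀ z, Reg z → ev P z = ev Q z) : P = Q := by
  have hD : Delta ≠ 0 := by
    intro h
    have := ev_Delta (1, 2)
    rw [h, ev_zero] at this
    simp only [b2, b3, a2, a3] at this
    norm_num at this
  have : Delta * (P - Q) = 0 := by
    apply ev_ext
    intro z
    rw [ev_mul, ev_zero, ev_sub]
    by_cases hz : ev Delta z = 0
    · rw [hz, zero_mul]
    · rw [ev_Delta] at hz
      rw [h z, sub_self, mul_zero]
      simp only [mul_ne_zero_iff] at hz
      obtain ⟨⟨⟨⟨⟨h1, h2⟩, h3⟩, h4⟩, h5⟩, h6⟩ := hz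
      exact ⟨h1, h2, h3, h4, h5, h6⟩
  rcases mul_eq_zero.mp this with h | h
  · exact absurd h hD
  · exact sub_eq_zero.mp h

lemma top_tendsto {P : Pol} {d : ℕ} (h : P.totalDegree ≤ d) (z : ℂ × ℂ) :
    Tendsto (fun ε : ℂ => ε ^ d * ev P (z.1 / ε, z.2 / ε)) (𝓝[≠] 0) (𝓝 (ev (hc d P) z)) := by
  have := ((SS_deriv0 P d z).continuousAt.tendsto).mono_left (nhdsWithin_le_nhds (s := {0}ᶜ))
  rw [SS_zero] at this
  refine this.congr' ?_
  filter_upwards [self_mem_nhdsWithin] with ε he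
  exact (SS_eq h he z).symm

lemma converse {P R : Pol} {k : ℕ} (h : ∀ z, Reg z →
    Tendsto (fun ε : ℂ => ε ^ k * ev P (z.1 / ε, z.2 / ε)) (𝓝[≠] 0) (𝓝 (ev R z))) :
    P.totalDegree ≤ k ∧ hc k P = R := by
  have hd : P.totalDegree ≤ k := by
    by_contra hn
    push Not at hn
    set n := P.totalDegree with hn'
    have h0 : hc n P = 0 := by
      apply eq_of_Reg
      intro z hz
      rw [ev_zero]
      refine tendsto_nhds_unique (top_tendsto (le_of_eq hn'.symm) z) ?_
      have e : Tendsto (fun ε : ℂ => ε ^ (n - k)) (𝓝[≠] 0) (𝓝 0) := by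
        have : Tendsto (fun ε : ℂ => ε ^ (n - k)) (𝓝 0) (𝓝 (0 ^ (n - k))) :=
          (continuous_pow (n - k)).tendsto 0
        rw [zero_pow (by omega)] at this
        exact this.mono_left nhdsWithin_le_nhds
      have := e.mul (h z hz)
      rw [zero_mul] at this
      refine this.congr fun ε => ?_
      rw [← mul_assoc, ← pow_add]
      congr 2; omega
    have hP : P ≠ 0 := by
      rintro rfl; simp [hn'] at hn
    obtain ⟨d, hd, hd'⟩ := Finset.exists_mem_eq_sup P.support
      (MvPolynomial.support_nonempty.mpr hP) (fun s => s.sum fun _ e => e)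
    have hdeg : d.degree = n := by
      rw [hn', MvPolynomial.totalDegree, hd']; rfl
    have := MvPolynomial.coeff_homogeneousComponent n P d
    rw [if_pos hdeg] at this
    have h0' : MvPolynomial.homogeneousComponent n P = 0 := h0
    rw [h0', MvPolynomial.coeff_zero] at this
    exact MvPolynomial.mem_support_iff.mp hd this.symm
  exact ⟨hd, eq_of_Reg fun z hz => tendsto_nhds_unique (top_tendsto hd z) (h z hz)⟩

/-! ### leading terms of the step -/

def Tm (f : ℂ → ℂ) (L : ℂ) : Prop :=
  ∃ T : ℂ → ℂ, HasDerivAt T L 0 ∧ T 0 = 0 ∧ ∀ ε : ℂ, ε ≠ 0 → f ε = T ε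

lemma Tm.add {f g : ℂ → ℂ} {a b : ℂ} (hf : Tm f a) (hg : Tm g b) :
    Tm (fun ε => f ε + g ε) (a + b) := by
  obtain ⟨f', h1, h2, h3⟩ := hf
  obtain ⟨g', k1, k2, k3⟩ := hg
  exact ⟨fun ε => f' ε + g' ε, h1.add k1, by simp [h2, k2],
    fun ε he => by simp only [h3 ε he, k3 ε he]⟩

lemma Tm.lim {f : ℂ → ℂ} {a : ℂ} (hf : Tm f a) :
    Tendsto (fun ε => ε⁻¹ * f ε) (𝓝[≠] 0) (𝓝 a) := by
  obtain ⟨T, h1, h2, h3⟩ := hf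
  have := hasDerivAt_iff_tendsto_slope.mp h1
  refine this.congr' ?_
  filter_upwards [self_mem_nhdsWithin] with ε he
  rw [slope_def_field, h2, h3 ε he]
  simp [div_eq_inv_mul]

lemma term {g a : ℂ → ℂ} {C : ℂ} (ha : As a C) (κ : ℂ) (y : ℂ × ℂ) {P : Pol} {d : ℕ}
    (h : P.totalDegree ≤ d) (z : ℂ × ℂ) (τ : ℂ × ℂ) (hg : ∀ ε, g ε = κ * a ε) :
    Tm (fun ε => ε ^ d * (g ε * sh y P τ.1 τ.2 (z.1 / ε, z.2 / ε)
        - κ * (EE y τ - 1) * ev P (z.1 / ε, z.2 / ε)))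
      (κ * (C * (EE y τ - 1) * ev (hc d P) z + EE y τ * ev (dl τ (hc d P)) z)) := by
  obtain ⟨f, f1, f2, f3⟩ := ha
  refine ⟨fun ε => κ * (f ε * (EE y τ * SS P d ε (z.1 + ε * τ.1, z.2 + ε * τ.2) - SS P d ε z))
    - κ * (EE y τ - 1) * SS P d ε z, ?_, ?_, ?_⟩
  · refine (((f1.mul (((SS_deriv P d z τ).const_mul (EE y τ)).sub (SS_deriv0 P d z))).const_mul κ).sub
      ((SS_deriv0 P d z).const_mul (κ * (EE y τ - 1)))).congr_deriv ?_
    simp only [Pi.sub_apply, zero_mul, add_zero, f2, SS_zero]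
    ring
  · simp only [zero_mul, add_zero, f2, SS_zero]
    ring
  · intro ε he
    beta_reduce
    rw [← SS_eq h he, ← SS_eq h he, ← f3 ε he, hg]
    have e : ((z.1 + ε * τ.1) / ε, (z.2 + ε * τ.2) / ε) = (z.1 / ε + τ.1, z.2 / ε + τ.2) := by
      ext <;> simp <;> field_simp
    simp only [sh, e]
    ring

def mu (y : ℂ × ℂ) : ℂ :=
  1 * (EE y (3, 1) - 1) + 1 * (EE y (-3, 1) - 1) + 1 * (EE y (3, -1) - 1) + 1 * (EE y (-3, -1) - 1)
  + 3 * (EE y (1, 1) - 1) + 3 * (EE y (-1, 1) - 1) + 3 * (EE y (1, -1) - 1)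
  + 3 * (EE y (-1, -1) - 1) + 3 * (EE y (2, 0) - 1) + 3 * (EE y (-2, 0) - 1)
  + 1 * (EE y (0, 2) - 1) + 1 * (EE y (0, -2) - 1)

def vv (y : ℂ × ℂ) : ℂ × ℂ :=
  (3 * EE y (3, 1) - 3 * EE y (-3, 1) + 3 * EE y (3, -1) - 3 * EE y (-3, -1)
  + 3 * EE y (1, 1) - 3 * EE y (-1, 1) + 3 * EE y (1, -1) - 3 * EE y (-1, -1)
  + 6 * EE y (2, 0) - 6 * EE y (-2, 0),
  EE y (3, 1) + EE y (-3, 1) - EE y (3, -1) - EE y (-3, -1)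
  + 3 * EE y (1, 1) + 3 * EE y (-1, 1) - 3 * EE y (1, -1) - 3 * EE y (-1, -1)
  + 2 * EE y (0, 2) - 2 * EE y (0, -2))

lemma HH_lim (m : ℂ) (y : ℂ × ℂ) {P : Pol} {d : ℕ} (h : P.totalDegree ≤ d + 1) (z : ℂ × ℂ)
    (hz : Reg z) : Tendsto (fun ε => ε ^ d * HH m y (mu y) P (z.1 / ε, z.2 / ε)) (𝓝[≠] 0)
    (𝓝 (
      let L := fun κ c d' => κ * (CC m z (c, d') * (EE y (c, d') - 1) * ev (hc (d + 1) P) z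
        + EE y (c, d') * ev (dl (c, d') (hc (d + 1) P)) z)
      L 1 3 1 + L 1 (-3) 1 + L 1 3 (-1) + L 1 (-3) (-1)
      + L 3 1 1 + L 3 (-1) 1 + L 3 1 (-1) + L 3 (-1) (-1)
      + L 3 2 0 + L 3 (-2) 0 + L 1 0 2 + L 1 0 (-2))) := by
  have q1 : ∀ ε : ℂ, z.2 / ε = z.2 / ε := fun ε => rfl
  have p1 : ∀ ε : ℂ, z.1 / ε = z.1 / ε := fun ε => rfl
  have q2 : ∀ ε : ℂ, -(z.2 / ε) = -z.2 / ε := fun ε => by ring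
  have p2 : ∀ ε : ℂ, -(z.1 / ε) = -z.1 / ε := fun ε => by ring
  have r1 := hz.n1
  have r2 := hz.n2
  have r3 := hz.n1.n2
  have t1 := term (as_l3 m z hz q1 p1) 1 y h z (3, 1) (fun ε => (one_mul _).symm)
  have t2 := term ((as_l3 m _ r1 q1 p2).cc (CC_n1 m z _ _)) 1 y h z (-3, 1)
    (fun ε => (one_mul _).symm)
  have t3 := term ((as_l3 m _ r2 q2 p1).cc (CC_n2 m z _ _)) 1 y h z (3, -1)
    (fun ε => (one_mul _).symm)
  have t4 := term ((as_l3 m _ r3 q2 p2).cc ((CC_n2 m (-z.1, z.2) _ _).trans (CC_n1 m z _ _)))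
    1 y h z (-3, -1) (fun ε => (one_mul _).symm)
  have t5 := term (as_k1 m z hz q1 p1) 3 y h z (1, 1)
    (fun ε => (mul_div_cancel₀ _ three_ne_zero).symm)
  have t6 := term ((as_k1 m _ r1 q1 p2).cc (CC_n1 m z _ _)) 3 y h z (-1, 1)
    (fun ε => (mul_div_cancel₀ _ three_ne_zero).symm)
  have t7 := term ((as_k1 m _ r2 q2 p1).cc (CC_n2 m z _ _)) 3 y h z (1, -1)
    (fun ε => (mul_div_cancel₀ _ three_ne_zero).symm)
  have t8 := term ((as_k1 m _ r3 q2 p2).cc ((CC_n2 m (-z.1, z.2) _ _).trans (CC_n1 m z _ _)))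
    3 y h z (-1, -1) (fun ε => (mul_div_cancel₀ _ three_ne_zero).symm)
  have t9 := term (as_k2 m z hz q1 p1) 3 y h z (2, 0)
    (fun ε => (mul_div_cancel₀ _ three_ne_zero).symm)
  have t10 := term ((as_k2 m _ r1 q1 p2).cc (CC_n1 m z _ _)) 3 y h z (-2, 0)
    (fun ε => (mul_div_cancel₀ _ three_ne_zero).symm)
  have t11 := term (as_l0 m z hz q1 p1) 1 y h z (0, 2) (fun ε => (one_mul _).symm)
  have t12 := term ((as_l0 m _ r2 q2 p1).cc (CC_n2 m z _ _)) 1 y h z (0, -2)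
    (fun ε => (one_mul _).symm)
  have T := (((((((((((t1.add t2).add t3).add t4).add t5).add t6).add t7).add t8).add t9).add
    t10).add t11).add t12).lim
  refine T.congr' ?_
  filter_upwards [self_mem_nhdsWithin] with ε he
  have he' : ε⁻¹ * ε ^ (d + 1) = ε ^ d := by
    have : ε ≠ 0 := he
    rw [pow_succ]; field_simp
  rw [← he']
  simp only [HH, mu]
  ring

/-! ### iteration -/

def lf (c : ℂ × ℂ) : Pol :=
  MvPolynomial.C c.1 * MvPolynomial.X 0 + MvPolynomial.C c.2 * MvPolynomial.X 1

lemma ev_lf (c z : ℂ × ℂ) : ev (lf c) z = c.1 * z.1 + c.2 * z.2 := by simp [lf]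

lemma dl_C (τ : ℂ × ℂ) (a : ℂ) : dl τ (MvPolynomial.C a) = 0 :=
  Derivation.map_algebraMap (dl τ) a

lemma dl_lf (τ c : ℂ × ℂ) : dl τ (lf c) = MvPolynomial.C (c.1 * τ.1 + c.2 * τ.2) := by
  simp only [lf, map_add, Derivation.leibniz, dl_C, smul_zero, add_zero, smul_eq_mul]
  simp [dl, MvPolynomial.mkDerivation_X]

lemma dl_lin (τ : ℂ × ℂ) (R : Pol) (z) :
    ev (dl τ R) z = τ.1 * ev (dl (1, 0) R) z + τ.2 * ev (dl (0, 1) R) z := by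
  have : dl τ = MvPolynomial.C (σ := Fin 2) τ.1 • dl (1, 0)
      + MvPolynomial.C (σ := Fin 2) τ.2 • dl (0, 1) := by
    apply MvPolynomial.derivation_ext
    intro i
    fin_cases i <;> simp [dl, MvPolynomial.mkDerivation_X]
  rw [this]
  simp

def prodL (L : List (ℂ × ℂ)) : Pol := (L.map lf).prod

lemma prodL_cons (c : ℂ × ℂ) (L : List (ℂ × ℂ)) : prodL (c :: L) = lf c * prodL L := by
  simp [prodL]

lemma dl_prodL (L : List (ℂ × ℂ)) (τ z : ℂ × ℂ) (h : ∀ c ∈ L, ev (lf c) z ≠ 0) :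
    ev (dl τ (prodL L)) z =
      ev (prodL L) z * (L.map fun c => ev (lf c) τ * (ev (lf c) z)⁻¹).sum := by
  induction L with
  | nil => simp [prodL]
  | cons c L ih =>
    have h1 := h c (by simp)
    rw [prodL_cons, Derivation.leibniz, smul_eq_mul, smul_eq_mul, ev_add, ev_mul, ev_mul, ev_mul,
      ih fun c hc => h c (by simp [hc]), dl_lf, ev_C, List.map_cons, List.sum_cons, ev_lf c τ]
    field_simp
    ring

lemma dl_iter_mul (τ c : ℂ × ℂ) (F : Pol) (n : ℕ) :
    (dl τ)^[n + 1] (lf c * F) = lf c * (dl τ)^[n + 1] F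
      + MvPolynomial.C ((n + 1) * ev (lf c) τ) * (dl τ)^[n] F := by
  induction n with
  | zero =>
    simp only [Function.iterate_succ, Function.iterate_zero, Function.comp, id,
      Derivation.leibniz, smul_eq_mul, dl_lf, ev_lf]
    simp; ring
  | succ n ih =>
    rw [Function.iterate_succ_apply', ih, map_add, Derivation.leibniz, Derivation.leibniz, dl_C,
      dl_lf, ← Function.iterate_succ_apply' (dl τ) n F, ← Function.iterate_succ_apply' (dl τ) (n+1) F]
    simp only [smul_eq_mul, ev_lf]
    push_cast
    simp only [map_mul, map_add, map_one, map_natCast]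
    ring

lemma dl_iter_C (τ : ℂ × ℂ) (n : ℕ) (a : ℂ) : (dl τ)^[n + 1] (MvPolynomial.C a) = 0 := by
  rw [Function.iterate_succ_apply, dl_C]
  exact Function.iterate_fixed (map_zero _) n

lemma dl_prodL_iter (τ : ℂ × ℂ) (L : List (ℂ × ℂ)) :
    (dl τ)^[L.length] (prodL L) =
      MvPolynomial.C (L.length.factorial * (L.map fun c => ev (lf c) τ).prod) := by
  induction L with
  | nil => simp [prodL]
  | cons c L ih =>
    rw [prodL_cons, List.length_cons, dl_iter_mul, ih, Function.iterate_succ_apply', ih, dl_C,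
      mul_zero, zero_add, ← map_mul, List.map_cons, List.prod_cons, Nat.factorial_succ]
    push_cast
    congr 1; ring

def Lam (m : ℕ) : List (ℂ × ℂ) :=
  List.replicate m (0, 1) ++ (List.replicate m (-1/2, 1/2) ++ (List.replicate m (1/2, 1/2) ++
  (List.replicate (3 * m + 1) (1, 0) ++ (List.replicate (3 * m + 1) (1/2, 3/2) ++
  List.replicate (3 * m + 1) (-1/2, 3/2)))))

def AA (m : ℕ) : Pol := prodL (Lam m)

lemma Lam_length (m : ℕ) : (Lam m).length = 12 * m + 3 := by
  simp [Lam]; omega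

lemma lf_vals (z : ℂ × ℂ) : ev (lf (0, 1)) z = z.2 ∧ ev (lf (-1/2, 1/2)) z = a2 z ∧
    ev (lf (1/2, 1/2)) z = a3 z ∧ ev (lf (1, 0)) z = z.1 ∧ ev (lf (1/2, 3/2)) z = b2 z ∧
    ev (lf (-1/2, 3/2)) z = b3 z := by
  simp only [ev_lf, a2, a3, b2, b3]
  refine ⟨?_, ?_, ?_, ?_, ?_, ?_⟩ <;> ring

lemma Lam_prod (m : ℕ) (z : ℂ × ℂ) : ((Lam m).map fun c => ev (lf c) z).prod =
    z.2 ^ m * (a2 z ^ m * (a3 z ^ m * (z.1 ^ (3 * m + 1) * (b2 z ^ (3 * m + 1) *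
      b3 z ^ (3 * m + 1))))) := by
  obtain ⟨h1, h2, h3, h4, h5, h6⟩ := lf_vals z
  simp only [Lam, List.map_append, List.map_replicate, List.prod_append, List.prod_replicate, h1,
    h2, h3, h4, h5, h6]

lemma ev_prodL (L : List (ℂ × ℂ)) (z) : ev (prodL L) z = (L.map fun c => ev (lf c) z).prod := by
  induction L with
  | nil => simp [prodL]
  | cons c L ih => rw [prodL_cons, ev_mul, ih]; simp

lemma dl_AA (m : ℕ) (τ z : ℂ × ℂ) (hz : Reg z) :
    ev (dl τ (AA m)) z = - ev (AA m) z * CC m z τ := by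
  obtain ⟨h1, h2, h3, h4, h5, h6⟩ := lf_vals z
  obtain ⟨k1, k2, k3, k4, k5, k6⟩ := lf_vals τ
  rw [AA, dl_prodL]
  · simp only [Lam, List.map_append, List.map_replicate, List.sum_append, List.sum_replicate, h1,
      h2, h3, h4, h5, h6, k1, k2, k3, k4, k5, k6, CC, nsmul_eq_mul]
    push_cast
    ring
  · intro c hc
    obtain ⟨r1, r2, r3, r4, r5, r6⟩ := hz
    simp only [Lam, List.mem_append, List.mem_replicate] at hc
    rcases hc with hc | hc | hc | hc | hc | hc <;> rw [hc.2]
    · rwa [h1]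
    · rwa [h2]
    · rwa [h3]
    · rwa [h4]
    · rwa [h5]
    · rwa [h6]

lemma U_scaled {z : ℂ × ℂ} (hz : Reg z) : ∀ᶠ ε in 𝓝[≠] (0 : ℂ), U (z.1 / ε, z.2 / ε) := by
  have key : ∀ (X : ℂ) (hX : X ≠ 0) (g : ℂ → ℂ) (hg : ∀ ε, g ε = X / ε) (j : ℂ),
      ∀ᶠ ε in 𝓝[≠] (0 : ℂ), g ε ≠ j := by
    intro X hX g hg j
    have hc : ContinuousAt (fun ε : ℂ => X - j * ε) 0 := by fun_prop
    have := (hc.eventually_ne (show X - j * 0 ≠ 0 by simpa using hX)).filter_mono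
      (nhdsWithin_le_nhds (s := {0}ᶜ))
    filter_upwards [this, self_mem_nhdsWithin] with ε h1 h2 h3
    apply h1
    have h2' : ε ≠ 0 := h2
    rw [← h3, hg]
    field_simp
    ring
  obtain ⟨r1, r2, r3, r4, r5, r6⟩ := hz
  unfold U
  rw [Filter.eventually_all_finset]
  intro j _
  refine (key _ r1 _ (fun ε => by ring) _).and ((key _ r2 _ (fun ε => by simp only [b2]; ring) _).and
    ((key _ r3 _ (fun ε => by simp only [b3]; ring) _).and ((key _ r4 _ (fun ε => by ring) _).and
    ((key _ r5 _ (fun ε => by simp only [a2]; ring) _).and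
    (key _ r6 _ (fun ε => by simp only [a3]; ring) _)))))

lemma CC_neg (m : ℂ) (z : ℂ × ℂ) (c d : ℂ) : CC m z (-c, -d) = - CC m z (c, d) := by
  simp only [CC, a2, a3, b2, b3]; ring

lemma step_top {m : ℕ} (hm : 1 ≤ m) (y : ℂ × ℂ) {d : ℕ} (P R : Pol) (hQ : QI m (psi y P))
    (hd : P.totalDegree ≤ d + 1) (hR : hc (d + 1) P = AA m * R) :
    ∃ P' : Pol, QI m (psi y P') ∧ P'.totalDegree ≤ d ∧ hc d P' = AA m * dl (vv y) R := by
  obtain ⟨P', h1, h2⟩ := poly_step hm y (mu y) P hQ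
  refine ⟨P', h2, converse fun z hz => ?_⟩
  have T := HH_lim m y hd z hz
  have T' : Tendsto (fun ε => ε ^ d * ev P' (z.1 / ε, z.2 / ε)) (𝓝[≠] 0) (𝓝 _) :=
    T.congr' ((U_scaled hz).mono fun ε he => by beta_reduce; rw [h1 _ he])
  refine (congrArg (fun l => Tendsto (fun ε => ε ^ d * ev P' (z.1 / ε, z.2 / ε)) (𝓝[≠] 0) (𝓝 l))
    ?_).mp T'
  have hL : ∀ κ c d' : ℂ, κ * (CC m z (c, d') * (EE y (c, d') - 1) * ev (hc (d + 1) P) z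
        + EE y (c, d') * ev (dl (c, d') (hc (d + 1) P)) z) =
      ev (AA m) z * (κ * EE y (c, d') * (c * ev (dl (1, 0) R) z + d' * ev (dl (0, 1) R) z)
        - κ * CC m z (c, d') * ev R z) := by
    intro κ c d'
    rw [hR, Derivation.leibniz, smul_eq_mul, smul_eq_mul, ev_add, ev_mul, ev_mul, ev_mul,
      dl_AA m _ z hz, dl_lin (c, d') R]
    ring
  simp only [hL]
  rw [ev_mul, dl_lin (vv y) R]
  have n1 := CC_neg m z 3 1
  have n2 := CC_neg m z 3 (-1)
  have n3 := CC_neg m z 1 1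
  have n4 := CC_neg m z 1 (-1)
  have n5 := CC_neg m z 2 0
  have n6 := CC_neg m z 0 2
  simp only [neg_neg, neg_zero] at n1 n2 n3 n4 n5 n6
  rw [n1, n2, n3, n4, n5, n6]
  simp only [vv]
  ring

lemma iter_top {m : ℕ} (hm : 1 ≤ m) (y : ℂ × ℂ) (e n : ℕ) (P R : Pol) (hQ : QI m (psi y P))
    (hd : P.totalDegree ≤ e + n) (hR : hc (e + n) P = AA m * R) :
    ∃ P' : Pol, QI m (psi y P') ∧ P'.totalDegree ≤ e ∧ hc e P' = AA m * (dl (vv y))^[n] R := by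
  induction n generalizing P R with
  | zero => exact ⟨P, hQ, hd, hR⟩
  | succ n ih =>
    obtain ⟨P', h1, h2, h3⟩ := step_top hm y P R hQ hd hR
    exact ih P' _ h1 h2 h3

/-! ### the starting polynomial -/

def SB (m : ℕ) : Finset ℕ := insert (3 * m + 2) (Finset.Icc 1 (3 * m))
def SA (m : ℕ) : Finset ℕ := Finset.Icc 1 m

def sqf (c : ℂ × ℂ) (s : ℕ) : Pol := lf c * lf c - MvPolynomial.C ((s : ℂ) ^ 2)

def Q0 (m : ℕ) : Pol :=
  (∏ s ∈ SB m, sqf (1, 0) s * sqf (1/2, 3/2) s * sqf (-1/2, 3/2) s) *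
  ∏ s ∈ SA m, sqf (0, 1) s * sqf (-1/2, 1/2) s * sqf (1/2, 1/2) s

lemma ev_prod {ι : Type*} (s : Finset ι) (f : ι → Pol) (z) :
    ev (∏ i ∈ s, f i) z = ∏ i ∈ s, ev (f i) z := by
  simp [ev, map_prod]

lemma ev_Q0 (m : ℕ) (z : ℂ × ℂ) : ev (Q0 m) z =
    (∏ s ∈ SB m, (z.1 ^ 2 - (s : ℂ) ^ 2) * (b2 z ^ 2 - (s : ℂ) ^ 2) * (b3 z ^ 2 - (s : ℂ) ^ 2)) *
    ∏ s ∈ SA m, (z.2 ^ 2 - (s : ℂ) ^ 2) * (a2 z ^ 2 - (s : ℂ) ^ 2) * (a3 z ^ 2 - (s : ℂ) ^ 2) := by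
  obtain ⟨h1, h2, h3, h4, h5, h6⟩ := lf_vals z
  simp only [Q0, ev_mul, ev_prod, sqf, ev_sub, ev_C, h1, h2, h3, h4, h5, h6, sq]

lemma Q0_RR (m : ℕ) (z : ℂ × ℂ) : ev (Q0 m) (RR z) = ev (Q0 m) z := by
  rw [ev_Q0, ev_Q0]
  congr 1 <;> refine Finset.prod_congr rfl fun s _ => ?_ <;> simp only [RR, a2, a3, b2, b3] <;> ring

lemma Q0_RR_iter (m k : ℕ) (z : ℂ × ℂ) : ev (Q0 m) (RR^[k] z) = ev (Q0 m) z := by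
  induction k with
  | zero => rfl
  | succ k ih => rw [Function.iterate_succ_apply', Q0_RR, ih]

lemma Q0_B {m s : ℕ} (hs : s ∈ SB m) (p q : ℂ) (hp : p ^ 2 = (s : ℂ) ^ 2) :
    ev (Q0 m) (p, q) = 0 := by
  rw [ev_Q0, Finset.prod_eq_zero hs, zero_mul]
  simp [hp]

lemma Q0_A {m s : ℕ} (hs : s ∈ SA m) (p q : ℂ) (hp : q ^ 2 = (s : ℂ) ^ 2) :
    ev (Q0 m) (p, q) = 0 := by
  rw [ev_Q0, Finset.prod_eq_zero hs, mul_zero]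
  simp [hp]

lemma Q0_QI (m : ℕ) (y : ℂ × ℂ) : QI m (psi y (Q0 m)) := by
  intro k
  have z0 : ∀ z : ℂ × ℂ, ev (Q0 m) z = 0 → psi y (Q0 m) (RR^[k] z).1 (RR^[k] z).2 = 0 := by
    intro z hz
    have : ev (Q0 m) ((RR^[k] z).1, (RR^[k] z).2) = 0 := by
      rw [← hz, ← Q0_RR_iter m k z]
    rw [psi, this, zero_mul]
  constructor
  · intro s hs q
    rcases Nat.eq_zero_or_pos s with rfl | h0
    · simp
    · have : s ∈ SB m := by
        simp only [inB, Nat.abs_cast] at hs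
        simp only [SB, Finset.mem_insert, Finset.mem_Icc]
        omega
      rw [rot_iter, rot_iter, z0 _ (Q0_B this _ _ (by simp)), z0 _ (Q0_B this _ _ (by simp))]
  · intro s hs p
    rcases Nat.eq_zero_or_pos s with rfl | h0
    · simp
    · have : s ∈ SA m := by
        simp only [inA, Nat.abs_cast] at hs
        simp only [SA, Finset.mem_Icc]
        omega
      rw [rot_iter, rot_iter, z0 _ (Q0_A this _ _ (by simp)), z0 _ (Q0_A this _ _ (by simp))]

lemma SB_card (m : ℕ) : (SB m).card = 3 * m + 1 := by
  rw [SB, Finset.card_insert_of_notMem (by simp), Nat.card_Icc]; omega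
lemma SA_card (m : ℕ) : (SA m).card = m := by simp [SA]

lemma Q0_top (m : ℕ) : (Q0 m).totalDegree ≤ (12 * m + 3) + (12 * m + 3) ∧
    hc ((12 * m + 3) + (12 * m + 3)) (Q0 m) = AA m * AA m := by
  refine converse fun z _ => ?_
  set G : ℂ → ℂ := fun ε =>
    (∏ s ∈ SB m, (z.1 ^ 2 - ε ^ 2 * (s : ℂ) ^ 2) * (b2 z ^ 2 - ε ^ 2 * (s : ℂ) ^ 2)
      * (b3 z ^ 2 - ε ^ 2 * (s : ℂ) ^ 2)) *
    ∏ s ∈ SA m, (z.2 ^ 2 - ε ^ 2 * (s : ℂ) ^ 2) * (a2 z ^ 2 - ε ^ 2 * (s : ℂ) ^ 2)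
      * (a3 z ^ 2 - ε ^ 2 * (s : ℂ) ^ 2) with hG
  have hc : Continuous G := by
    rw [hG]
    refine Continuous.mul (continuous_finset_prod _ fun s _ => ?_)
      (continuous_finset_prod _ fun s _ => ?_) <;> fun_prop
  have h0 : G 0 = ev (AA m * AA m) z := by
    rw [ev_mul, AA, ev_prodL, Lam_prod, hG]
    simp only [ne_eq, OfNat.ofNat_ne_zero, not_false_eq_true, zero_pow, zero_mul, sub_zero,
      Finset.prod_const, SB_card, SA_card]
    ring
  have := (hc.tendsto 0).mono_left (nhdsWithin_le_nhds (s := {0}ᶜ))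
  rw [h0] at this
  refine this.congr' ?_
  filter_upwards [self_mem_nhdsWithin] with ε he
  have he' : ε ≠ 0 := he
  have e : ε ^ ((12 * m + 3) + (12 * m + 3)) = (∏ s ∈ SB m, ε ^ 6) * ∏ s ∈ SA m, ε ^ 6 := by
    rw [Finset.prod_const, Finset.prod_const, SB_card, SA_card]
    ring
  have sc : b2 (z.1 / ε, z.2 / ε) = b2 z / ε ∧ b3 (z.1 / ε, z.2 / ε) = b3 z / ε ∧
      a2 (z.1 / ε, z.2 / ε) = a2 z / ε ∧ a3 (z.1 / ε, z.2 / ε) = a3 z / ε := by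
    simp only [b2, b3, a2, a3]
    refine ⟨?_, ?_, ?_, ?_⟩ <;> ring
  have f : ∀ X s : ℂ, X ^ 2 - ε ^ 2 * s ^ 2 = ε ^ 2 * ((X / ε) ^ 2 - s ^ 2) := by
    intro X s; field_simp
  rw [ev_Q0, sc.1, sc.2.1, sc.2.2.1, sc.2.2.2, e, hG]
  simp only [f]
  rw [mul_mul_mul_comm, ← Finset.prod_mul_distrib, ← Finset.prod_mul_distrib]
  congr 1 <;> refine Finset.prod_congr rfl fun s _ => ?_ <;> ring

lemma QI_smul {m : ℕ} {y : ℂ × ℂ} {P : Pol} (a : ℂ) (h : QI m (psi y P)) :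
    QI m (psi y (MvPolynomial.C a * P)) := by
  have e : ∀ p q, psi y (MvPolynomial.C a * P) p q = a * psi y P p q := by
    intro p q; simp only [psi, ev_mul, ev_C]; ring
  intro k
  obtain ⟨h1, h2⟩ := h k
  constructor
  · intro s hs q
    have := h1 s hs q
    rw [rot_iter, rot_iter] at *
    rw [e, e, this]
  · intro s hs q
    have := h2 s hs q
    rw [rot_iter, rot_iter] at *
    rw [e, e, this]

theorem exists_pq {m : ℕ} (hm : 1 ≤ m) (y : ℂ × ℂ) (hv : Reg (vv y)) (K : ℂ) :
    ∃ P : Pol, QI m (psi y P) ∧ P.totalDegree ≤ 12 * m + 3 ∧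
      hc (12 * m + 3) P = AA m * MvPolynomial.C K := by
  obtain ⟨P, h1, h2, h3⟩ := iter_top hm y (12 * m + 3) (12 * m + 3) (Q0 m) (AA m) (Q0_QI m y)
    (Q0_top m).1 (Q0_top m).2
  have h4 := dl_prodL_iter (vv y) (Lam m)
  rw [Lam_length] at h4
  rw [AA, h4, ← AA, Lam_prod] at h3
  set c : ℂ := ((12 * m + 3).factorial : ℂ) * ((vv y).2 ^ m * (a2 (vv y) ^ m * (a3 (vv y) ^ m *
    ((vv y).1 ^ (3 * m + 1) * (b2 (vv y) ^ (3 * m + 1) * b3 (vv y) ^ (3 * m + 1)))))) with hc'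
  have hc0 : c ≠ 0 := by
    obtain ⟨r1, r2, r3, r4, r5, r6⟩ := hv
    rw [hc']
    have := Nat.cast_ne_zero (R := ℂ).mpr (Nat.factorial_ne_zero (12 * m + 3))
    simp only [mul_ne_zero_iff]
    exact ⟨this, pow_ne_zero _ r4, pow_ne_zero _ r5, pow_ne_zero _ r6, pow_ne_zero _ r1,
      pow_ne_zero _ r2, pow_ne_zero _ r3⟩
  refine ⟨MvPolynomial.C (K / c) * P, QI_smul _ h1, ?_, ?_⟩
  · refine (MvPolynomial.totalDegree_mul _ _).trans ?_
    simpa using h2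
  · have : hc (12 * m + 3) (MvPolynomial.C (K / c) * P) =
        MvPolynomial.C (K / c) * hc (12 * m + 3) P :=
      MvPolynomial.homogeneousComponent_C_mul _ _ _
    rw [this, h3, mul_left_comm, ← map_mul, div_mul_cancel₀ _ hc0]

/-! ### translation to the original coordinates -/

lemma rt3_sq : rt3 * rt3 = 3 := by
  rw [rt3, ← Complex.ofReal_mul, Real.mul_self_sqrt (by norm_num)]; norm_num

lemma rt3_ne : rt3 ≠ 0 := by
  intro h; have := rt3_sq; rw [h] at this; norm_num at this

lemma short_bil {τ : Fin 2 → ℂ} (h : τ ∈ twoShort) : bil τ τ = 4 := by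
  have h3 := rt3_sq
  simp only [twoShort, shortRoots, List.map_cons, List.map_nil, List.mem_cons, List.not_mem_nil,
    or_false] at h
  rcases h with rfl | rfl | rfl | rfl | rfl | rfl <;>
    simp [bil, vβ₁, vβ₂, vβ₃] <;> first | ring1 | linear_combination h3

lemma kap_short {τ : Fin 2 → ℂ} (h : τ ∈ twoShort) : kap τ = 3 := if_pos h
lemma kap_long {τ : Fin 2 → ℂ} (h : bil τ τ = 12) : kap τ = 1 :=
  if_neg fun h' => by rw [short_bil h'] at h; norm_num at h

lemma cSum_eq (x γ : Fin 2 → ℂ) : cSum x γ =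
    bil ![(vv (x 0, rt3 * x 1)).1, rt3 * (vv (x 0, rt3 * x 1)).2] γ := by
  have h3 := rt3_sq
  have s1 : kap ((2 : ℂ) • vβ₁) = 3 := kap_short (by simp [twoShort, shortRoots])
  have s2 : kap ((2 : ℂ) • vβ₂) = 3 := kap_short (by simp [twoShort, shortRoots])
  have s3 : kap ((2 : ℂ) • vβ₃) = 3 := kap_short (by simp [twoShort, shortRoots])
  have s4 : kap ((2 : ℂ) • -vβ₁) = 3 := kap_short (by simp [twoShort, shortRoots])
  have s5 : kap ((2 : ℂ) • -vβ₂) = 3 := kap_short (by simp [twoShort, shortRoots])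
  have s6 : kap ((2 : ℂ) • -vβ₃) = 3 := kap_short (by simp [twoShort, shortRoots])
  have l1 : kap ((2 : ℂ) • vα₁) = 1 := kap_long (by simp [bil, vα₁]; linear_combination 4 * h3)
  have l2 : kap ((2 : ℂ) • vα₂) = 1 := kap_long (by simp [bil, vα₂]; linear_combination h3)
  have l3 : kap ((2 : ℂ) • vα₃) = 1 := kap_long (by simp [bil, vα₃]; linear_combination h3)
  have l4 : kap ((2 : ℂ) • -vα₁) = 1 := kap_long (by simp [bil, vα₁]; linear_combination 4 * h3)
  have l5 : kap ((2 : ℂ) • -vα₂) = 1 := kap_long (by simp [bil, vα₂]; linear_combination h3)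
  have l6 : kap ((2 : ℂ) • -vα₃) = 1 := kap_long (by simp [bil, vα₃]; linear_combination h3)
  have E : ∀ (τ : Fin 2 → ℂ) (c d : ℂ), τ 0 = c → τ 1 = rt3 * d →
      Complex.exp (bil x τ) = EE (x 0, rt3 * x 1) (c, d) := by
    intro τ c d h1 h2
    rw [EE, bil, h1, h2]; congr 1; ring
  simp only [cSum, twoG2, G2all, longRoots, shortRoots, List.cons_append, List.nil_append,
    List.map_cons, List.map_nil, List.sum_cons, List.sum_nil, s1, s2, s3, s4, s5, s6,
    l1, l2, l3, l4, l5, l6]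
  rw [E ((2 : ℂ) • vα₁) 0 2 (by simp [vα₁] <;> ring) (by simp [vα₁] <;> ring),
    E ((2 : ℂ) • vα₂) (-3) 1 (by simp [vα₂] <;> ring) (by simp [vα₂] <;> ring),
    E ((2 : ℂ) • vα₃) 3 1 (by simp [vα₃] <;> ring) (by simp [vα₃] <;> ring),
    E ((2 : ℂ) • -vα₁) 0 (-2) (by simp [vα₁] <;> ring) (by simp [vα₁] <;> ring),
    E ((2 : ℂ) • -vα₂) 3 (-1) (by simp [vα₂] <;> ring) (by simp [vα₂] <;> ring),
    E ((2 : ℂ) • -vα₃) (-3) (-1) (by simp [vα₃] <;> ring) (by simp [vα₃] <;> ring),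
    E ((2 : ℂ) • vβ₁) 2 0 (by simp [vβ₁] <;> ring) (by simp [vβ₁] <;> ring),
    E ((2 : ℂ) • vβ₂) 1 1 (by simp [vβ₂] <;> ring) (by simp [vβ₂] <;> ring),
    E ((2 : ℂ) • vβ₃) (-1) 1 (by simp [vβ₃] <;> ring) (by simp [vβ₃] <;> ring),
    E ((2 : ℂ) • -vβ₁) (-2) 0 (by simp [vβ₁] <;> ring) (by simp [vβ₁] <;> ring),
    E ((2 : ℂ) • -vβ₂) (-1) (-1) (by simp [vβ₂] <;> ring) (by simp [vβ₂] <;> ring),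
    E ((2 : ℂ) • -vβ₃) 1 (-1) (by simp [vβ₃] <;> ring) (by simp [vβ₃] <;> ring)]
  simp only [bil, vα₁, vα₂, vα₃, vβ₁, vβ₂, vβ₃, Pi.smul_apply, Pi.neg_apply, smul_eq_mul,
    Matrix.cons_val_zero, Matrix.cons_val_one, vv]
  ring

lemma reg_of_cSum {x : Fin 2 → ℂ} (hx : ∀ γ ∈ G2plus, cSum x γ ≠ 0) :
    Reg (vv (x 0, rt3 * x 1)) := by
  have h3 := rt3_sq
  set v := vv (x 0, rt3 * x 1) with hv
  have h : ∀ γ ∈ G2plus, bil ![v.1, rt3 * v.2] γ ≠ 0 := fun γ hγ => by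
    rw [hv, ← cSum_eq]; exact hx γ hγ
  simp only [G2plus, List.mem_cons, List.not_mem_nil, or_false, forall_eq_or_imp, forall_eq] at h
  obtain ⟨k1, k2, k3, k4, k5, k6⟩ := h
  simp only [bil, vα₁, vα₂, vα₃, vβ₁, vβ₂, vβ₃, Matrix.cons_val_zero, Matrix.cons_val_one] at *
  refine ⟨fun e => k4 ?_, fun e => k5 ?_, fun e => k6 ?_, fun e => k1 ?_, fun e => k2 ?_,
    fun e => k3 ?_⟩
  · linear_combination e
  · rw [b2] at e; linear_combination e + v.2 / 2 * h3
  · rw [b3] at e; linear_combination e + v.2 / 2 * h3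
  · linear_combination (rt3 * rt3) * e
  · rw [a2] at e; linear_combination 3 * e + v.2 / 2 * h3
  · rw [a3] at e; linear_combination 3 * e + v.2 / 2 * h3

lemma ev_eval (P : Pol) (z : Fin 2 → ℂ) : MvPolynomial.eval z P = ev P (z 0, z 1) := by
  have e : ![z 0, z 1] = z := by ext i; fin_cases i <;> rfl
  simp [ev, e]

lemma ev_pow (P : Pol) (n : ℕ) (z) : ev (P ^ n) z = ev P z ^ n := by simp [ev]

lemma ev_top (m : ℕ) (z : ℂ × ℂ) : ev (topTerm m) z =
    ev (AA m) (z.1, rt3⁻¹ * z.2) * (27 ^ m * 8) := by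
  have h3 := rt3_sq
  have hn := rt3_ne
  have hq : z.2 = rt3 * (rt3⁻¹ * z.2) := by field_simp
  set q := rt3⁻¹ * z.2 with hq'
  have e : ∀ γ : Fin 2 → ℂ, ev (linForm γ) z = γ 0 * z.1 + γ 1 * z.2 := by
    intro γ; simp [linForm]
  have f1 : ev (linForm vα₁) z = 3 * q := by
    rw [e, hq]; simp [vα₁]; linear_combination q * h3
  have f2 : ev (linForm vα₂) z = 3 * a2 (z.1, q) := by
    rw [e, hq]; simp [vα₂, a2]; linear_combination q / 2 * h3
  have f3 : ev (linForm vα₃) z = 3 * a3 (z.1, q) := by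
    rw [e, hq]; simp [vα₃, a3]; linear_combination q / 2 * h3
  have f4 : ev (linForm vβ₁) z = z.1 := by
    rw [e, hq]; simp [vβ₁]
  have f5 : ev (linForm vβ₂) z = b2 (z.1, q) := by
    rw [e, hq]; simp [vβ₂, b2]; linear_combination q / 2 * h3
  have f6 : ev (linForm vβ₃) z = b3 (z.1, q) := by
    rw [e, hq]; simp [vβ₃, b3]; linear_combination q / 2 * h3
  have g : ∀ γ, ev (linForm ((2 : ℂ) • γ)) z = 2 * ev (linForm γ) z := by
    intro γ; rw [e, e]; simp; ring
  simp only [topTerm, ev_mul, ev_pow, g, f1, f2, f3, f4, f5, f6, AA, ev_prodL, Lam_prod]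
  rw [show (27 : ℂ) = 3 * 3 * 3 by norm_num]
  simp only [mul_pow, pow_succ]
  ring

theorem main {m : ℕ} (hm : 1 ≤ m) (x : Fin 2 → ℂ) (hx : ∀ γ ∈ G2plus, cSum x γ ≠ 0) :
    ∃ ψ : (Fin 2 → ℂ) → ℂ, IsBAFunction m x ψ := by
  have h3 := rt3_sq
  have hn := rt3_ne
  obtain ⟨P, hQ, hd, hP⟩ := exists_pq hm (x 0, rt3 * x 1) (reg_of_cSum hx) (27 ^ m * 8)
  set y : ℂ × ℂ := (x 0, rt3 * x 1) with hy
  set P' : Pol := MvPolynomial.bind₁ ![MvPolynomial.X 0, MvPolynomial.C rt3⁻¹ * MvPolynomial.X 1] P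
    with hP'
  have evP' : ∀ z : ℂ × ℂ, ev P' z = ev P (z.1, rt3⁻¹ * z.2) := by
    intro z; rw [hP', ev_bind]; simp
  have top : P'.totalDegree ≤ 12 * m + 3 ∧ hc (12 * m + 3) P' = topTerm m := by
    refine converse fun z _ => ?_
    have := top_tendsto hd (z.1, rt3⁻¹ * z.2)
    rw [hP, ev_mul, ev_C, ← ev_top] at this
    refine this.congr fun ε => ?_
    rw [evP', mul_div_assoc]
  have hψ : ∀ z : Fin 2 → ℂ, MvPolynomial.eval z P' * Complex.exp (bil z x) =
      psi y P (z 0) (rt3⁻¹ * z 1) := by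
    intro z
    rw [ev_eval, evP', psi, EE, bil, hy]
    congr 2
    field_simp
  have top0 : topTerm m ≠ 0 := by
    intro h
    have := ev_top m (1, rt3 * 2)
    rw [h, ev_zero, AA, ev_prodL, Lam_prod] at this
    simp [a2, a3, b2, b3, hn] at this
    norm_num at this
  refine ⟨fun z => MvPolynomial.eval z P' * Complex.exp (bil z x), P', le_antisymm top.1 ?_, top.2,
    fun z => rfl, ?_⟩
  · by_contra hlt
    push Not at hlt
    exact top0 (top.2.symm.trans (MvPolynomial.homogeneousComponent_eq_zero _ _ hlt))
  · have q3 : ∀ z : ℂ, rt3 * (rt3⁻¹ * z) = z := fun z => by field_simp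
    have i3 : rt3⁻¹ * rt3 = 1 := by field_simp
    have B0 := (hQ 0).1
    have B1 := (hQ 1).1
    have B2 := (hQ 2).1
    have A0 := (hQ 0).2
    have A1 := (hQ 1).2
    have A2 := (hQ 2).2
    simp only [QB, QA, Function.iterate_succ, Function.iterate_zero, Function.comp, id, rot]
      at B0 B1 B2 A0 A1 A2
    constructor
    · intro α hα s hs1 hs2 z hz
      have hs : inA m (s : ℤ) := by simp only [inA, Nat.abs_cast]; omega
      simp only [hψ]
      set q := rt3⁻¹ * z 1 with hq
      have hz1 : z 1 = rt3 * q := by rw [hq, q3]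
      simp only [List.mem_cons, List.not_mem_nil, or_false] at hα
      rcases hα with rfl | rfl | rfl
      · have hz' : q = 0 := by
          simp only [bil, vα₁, Matrix.cons_val_zero, Matrix.cons_val_one, hz1] at hz
          linear_combination hz / 3 - q / 3 * h3
        convert A0 s hs (z 0) using 2 <;> simp [vα₁]
        · linear_combination hz' + s * i3
        · linear_combination hz' - s * i3
      · have hz' : q = z 0 := by
          simp only [bil, vα₂, Matrix.cons_val_zero, Matrix.cons_val_one, hz1] at hz
          linear_combination 2 * hz / 3 - q / 3 * h3
        convert A1 s hs (2 * z 0) using 2 <;> simp [vα₂]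
        · ring
        · linear_combination hz' + s / 2 * i3
        · ring
        · linear_combination hz' - s / 2 * i3
      · have hz' : q = - z 0 := by
          simp only [bil, vα₃, Matrix.cons_val_zero, Matrix.cons_val_one, hz1] at hz
          linear_combination 2 * hz / 3 - q / 3 * h3
        convert (A2 s hs (-2 * z 0)).symm using 2 <;> simp [vα₃]
        · ring
        · linear_combination hz' + s / 2 * i3
        · ring
        · linear_combination hz' - s / 2 * i3
    · intro β hβ s hs' z hz
      have hs : inB m (s : ℤ) := by simp only [inB, Nat.abs_cast]; omega
      simp only [hψ]
      set q := rt3⁻¹ * z 1 with hq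
      have hz1 : z 1 = rt3 * q := by rw [hq, q3]
      simp only [List.mem_cons, List.not_mem_nil, or_false] at hβ
      rcases hβ with rfl | rfl | rfl
      · have hz' : z 0 = 0 := by
          simp only [bil, vβ₁, Matrix.cons_val_zero, Matrix.cons_val_one, hz1] at hz
          linear_combination hz
        convert B0 s hs q using 2 <;> simp [vβ₁, hz', hq]
      · have hz' : z 0 = - 3 * q := by
          simp only [bil, vβ₂, Matrix.cons_val_zero, Matrix.cons_val_one, hz1] at hz
          linear_combination 2 * hz - q * h3
        convert B1 s hs (2 * q) using 2 <;> simp [vβ₂]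
        · linear_combination hz'
        · linear_combination s / 2 * i3
        · linear_combination hz'
        · linear_combination - s / 2 * i3
      · have hz' : z 0 = 3 * q := by
          simp only [bil, vβ₃, Matrix.cons_val_zero, Matrix.cons_val_one, hz1] at hz
          linear_combination -2 * hz + q * h3
        convert B2 s hs (-2 * q) using 2 <;> simp [vβ₃]
        · linear_combination hz'
        · linear_combination s / 2 * i3
        · linear_combination hz'
        · linear_combination - s / 2 * i3

end AG2

/-- Existence of the Baker–Akhiezer function for `AG₂`. -/
theorem stmt_7 (m : ℕ) (hm : 1 ≤ m) (x : Fin 2 → ℂ)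
    (hx : ∀ γ ∈ G2plus, cSum x γ ≠ 0) :
    ∃ ψ : (Fin 2 → ℂ) → ℂ, IsBAFunction m x ψ := by
  exact AG2.main hm x hx

end
end

section
/- Assume the AG₂ setup and the definition of the rational functions a_τ (for τ/2 ∈ G₂) below. Let s_γ(z) = z − (2⟨γ,z⟩/γ²)γ for γ ∈ ℂ² with γ² ≠ 0, and let W be the subgroup of linear automorphisms of ℂ² generated by {s_γ : γ ∈ G₂} (the Weyl group of type G₂). Then for every w ∈ W, every τ with τ/2 ∈ G₂, and every z ∈ ℂ² such that both z and w⁻¹z are D₁-regular, one has a_{wτ}(z) = a_τ(w⁻¹z). -/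
noncomputable section

open Complex

/-- `z` is `D₁`-regular: `⟨γ,z⟩ ∉ {0, ±γ², ±2γ²}` for every `γ ∈ G₂₊`. -/
def D1Reg (z : Fin 2 → ℂ) : Prop :=
  ∀ γ ∈ G2plus, bil γ z ≠ 0 ∧ bil γ z ≠ bil γ γ ∧ bil γ z ≠ -bil γ γ ∧
    bil γ z ≠ 2 * bil γ γ ∧ bil γ z ≠ -(2 * bil γ γ)

open scoped Classical in
/-- The coefficient functions `a_τ` (for `τ/2 ∈ G₂`) of the dual
Macdonald–Ruijsenaars operator `D₁` for `AG₂`. -/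
noncomputable def aD1 (m : ℕ) (τ z : Fin 2 → ℂ) : ℂ :=
  let h : Fin 2 → ℂ := (2⁻¹ : ℂ) • τ
  if τ ∈ twoShort then
    3 *
      ((shortRoots.filter (fun γ => bil τ γ = bil γ γ)).map (fun γ =>
        (1 - (3 * (m : ℂ) + 2) * bil γ γ / bil γ z) *
        (1 + 3 * (m : ℂ) * bil γ γ / (bil γ z + 2 * bil γ γ)) *
        (1 - (3 * (m : ℂ) - 1) * bil γ γ / (bil γ z - bil γ γ)))).prod *
      ((longRoots.filter (fun γ => bil τ γ = bil γ γ)).map (fun γ =>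
        1 - (m : ℂ) * bil γ γ / bil γ z)).prod *
      ((1 - (3 * (m : ℂ) + 2) * bil h h / bil h z) *
        (1 - 3 * (m : ℂ) * bil h h / (bil h z + bil h h)))
  else
    ((shortRoots.filter (fun γ => bil τ γ = 3 * bil γ γ)).map (fun γ =>
        (1 - (3 * (m : ℂ) + 2) * bil γ γ / bil γ z) *
        (1 - (3 * (m : ℂ) + 1) * bil γ γ / (bil γ z + bil γ γ)) *
        (1 - 3 * (m : ℂ) * bil γ γ / (bil γ z + 2 * bil γ γ)))).prod *
      ((longRoots.filter (fun γ => bil τ γ = bil γ γ)).map (fun γ =>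
        1 - (m : ℂ) * bil γ γ / bil γ z)).prod *
      ((1 - (m : ℂ) * bil h h / bil h z) *
        (1 - (m : ℂ) * bil h h / (bil h z + bil h h)))

/-- The value `D₁p(z) = ∑_{τ : τ/2 ∈ G₂} a_τ(z)(p(z+τ) − p(z))`. -/
noncomputable def applyD1 (m : ℕ) (p : (Fin 2 → ℂ) → ℂ) (z : Fin 2 → ℂ) : ℂ :=
  (twoG2.map (fun τ => aD1 m τ z * (p (z + τ) - p z))).sum

/-- The ring `R^a_{AG₂}` of analytic quasi-invariants for `AG₂`. -/
def RaAG2 (m : ℕ) (p : (Fin 2 → ℂ) → ℂ) : Prop :=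
  (∀ z, AnalyticAt ℂ p z) ∧ QuasiInvAG2 m p

/-- The linear map `z ↦ ⟨γ,z⟩`. -/
noncomputable def bilinMap (γ : Fin 2 → ℂ) : (Fin 2 → ℂ) →ₗ[ℂ] ℂ where
  toFun z := bil γ z
  map_add' u v := by simp [bil]; ring
  map_smul' c u := by simp [bil]; ring

/-- The orthogonal reflection `s_γ(z) = z − (2⟨γ,z⟩/γ²)γ` as a linear
automorphism of `ℂ²`. -/
noncomputable def reflAt (γ : Fin 2 → ℂ) (h : bil γ γ ≠ 0) :
    (Fin 2 → ℂ) ≃ₗ[ℂ] (Fin 2 → ℂ) :=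
  Module.reflection (f := (2 / bil γ γ) • bilinMap γ) (x := γ)
    (by simp [bilinMap]; field_simp)

/-- The Weyl group of type `G₂`: the subgroup of linear automorphisms of `ℂ²`
generated by the reflections `s_γ`, `γ ∈ G₂`. -/
noncomputable def WeylG2 : Subgroup ((Fin 2 → ℂ) ≃ₗ[ℂ] (Fin 2 → ℂ)) :=
  Subgroup.closure {w | ∃ γ ∈ G2all, ∃ h : bil γ γ ≠ 0, w = reflAt γ h}

theorem aux_rt3_sq : rt3 * rt3 = 3 := by
  unfold rt3
  rw [← Complex.ofReal_mul, Real.mul_self_sqrt (by norm_num)]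
  norm_num

theorem aux_rt3_ne : rt3 ≠ 0 := by
  intro h
  have := aux_rt3_sq
  rw [h] at this
  norm_num at this

theorem aux_refl_apply (γ : Fin 2 → ℂ) (h : bil γ γ ≠ 0) (z : Fin 2 → ℂ) :
    reflAt γ h z = z - (2 / bil γ γ * bil γ z) • γ := by
  simp [reflAt, Module.reflection_apply, bilinMap]

theorem aux_refl_bil (γ : Fin 2 → ℂ) (h : bil γ γ ≠ 0) (x y : Fin 2 → ℂ) :
    bil (reflAt γ h x) (reflAt γ h y) = bil x y := by
  rw [aux_refl_apply, aux_refl_apply]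
  have e : ∀ a b : ℂ, bil (x - a • γ) (y - b • γ) =
      bil x y - a * bil γ y - b * bil γ x + a * b * bil γ γ := by
    intro a b; simp [bil]; ring
  rw [e]
  field_simp
  ring

theorem aux_short_nodup : shortRoots.Nodup := by
  have h := aux_rt3_ne
  have h2 : -rt3 ≠ rt3 := by
    intro h'; apply h; linear_combination (-1/2) * h'
  simp [shortRoots, vβ₁, vβ₂, vβ₃, h, h.symm, h2, h2.symm, neg_div]
  norm_num [neg_eq_iff_eq_neg, eq_neg_iff_add_eq_zero]
  try simp [h, ← two_mul]

theorem aux_long_nodup : longRoots.Nodup := by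
  have h := aux_rt3_ne
  have h2 : -rt3 ≠ rt3 := by
    intro h'; apply h; linear_combination (-1/2) * h'
  simp [longRoots, vα₁, vα₂, vα₃, h, h.symm, h2, h2.symm, neg_div]
  norm_num [neg_eq_iff_eq_neg, eq_neg_iff_add_eq_zero]
  try simp [h, ← two_mul]

theorem aux_neg_short (x : Fin 2 → ℂ) (h : x ∈ shortRoots) : -x ∈ shortRoots := by
  simp only [shortRoots, List.mem_cons, List.not_mem_nil, or_false] at h ⊢
  rcases h with h | h | h | h | h | h <;> subst h <;> simp

theorem aux_neg_long (x : Fin 2 → ℂ) (h : x ∈ longRoots) : -x ∈ longRoots := by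
  simp only [longRoots, List.mem_cons, List.not_mem_nil, or_false] at h ⊢
  rcases h with h | h | h | h | h | h <;> subst h <;> simp

/-- Reflection formula without a nondegeneracy proof. -/
def auxR (γ z : Fin 2 → ℂ) : Fin 2 → ℂ := z - (2 / bil γ γ * bil γ z) • γ

theorem auxR_neg_left (γ z : Fin 2 → ℂ) : auxR (-γ) z = auxR γ z := by
  ext i; simp [auxR, bil]; ring

theorem auxR_neg_right (γ z : Fin 2 → ℂ) : auxR γ (-z) = -auxR γ z := by
  ext i; simp [auxR, bil]; ring

theorem aux_bil_short (γ : Fin 2 → ℂ) (h : γ ∈ [vβ₁, vβ₂, vβ₃]) : bil γ γ = 1 := by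
  have := aux_rt3_sq
  simp only [List.mem_cons, List.not_mem_nil, or_false] at h
  rcases h with h | h | h <;> subst h <;> simp [bil, vβ₁, vβ₂, vβ₃] <;>
    linear_combination (1/4) * this

theorem aux_bil_long (γ : Fin 2 → ℂ) (h : γ ∈ [vα₁, vα₂, vα₃]) : bil γ γ = 3 := by
  have := aux_rt3_sq
  simp only [List.mem_cons, List.not_mem_nil, or_false] at h
  rcases h with h | h | h <;> subst h <;> simp [bil, vα₁, vα₂, vα₃] <;>
    first | linear_combination this | linear_combination (1/4) * this

theorem aux_G2plus_bil (γ : Fin 2 → ℂ) (h : γ ∈ G2plus) :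
    (γ ∈ [vβ₁, vβ₂, vβ₃] ∧ bil γ γ = 1) ∨ (γ ∈ [vα₁, vα₂, vα₃] ∧ bil γ γ = 3) := by
  have : γ ∈ [vβ₁, vβ₂, vβ₃] ∨ γ ∈ [vα₁, vα₂, vα₃] := by
    simp only [G2plus, List.mem_cons, List.not_mem_nil, or_false] at h ⊢
    tauto
  rcases this with h | h
  · exact Or.inl ⟨h, aux_bil_short γ h⟩
  · exact Or.inr ⟨h, aux_bil_long γ h⟩

theorem auxR_short_pos (γ δ : Fin 2 → ℂ) (h : γ ∈ G2plus) (hd : δ ∈ [vβ₁, vβ₂, vβ₃]) :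
    auxR γ δ ∈ shortRoots := by
  have r := aux_rt3_sq
  unfold auxR
  rcases aux_G2plus_bil γ h with ⟨h, e⟩ | ⟨h, e⟩ <;> rw [e] <;>
  simp only [shortRoots, List.mem_cons, List.not_mem_nil, or_false] at h hd ⊢ <;>
  rcases h with h | h | h <;> rcases hd with hd | hd | hd <;> subst h <;> subst hd <;>
  simp only [funext_iff, Fin.forall_fin_two, bil, vα₁, vα₂, vα₃, vβ₁, vβ₂, vβ₃, Pi.sub_apply,
    Pi.smul_apply, Pi.neg_apply, smul_eq_mul, Matrix.cons_val_zero, Matrix.cons_val_one] <;>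
  first
  | (refine Or.inl ⟨?_, ?_⟩ <;> first | (ring1) | (linear_combination (1/2) * r) | (linear_combination (-1/2) * r) | (grind))
  | (refine Or.inr (Or.inl ⟨?_, ?_⟩) <;> first | (ring1) | (linear_combination (1/2) * r) | (linear_combination (-1/2) * r) | (grind))
  | (refine Or.inr (Or.inr (Or.inl ⟨?_, ?_⟩)) <;> first | (ring1) | (linear_combination (1/2) * r) | (linear_combination (-1/2) * r) | (grind))
  | (refine Or.inr (Or.inr (Or.inr (Or.inl ⟨?_, ?_⟩))) <;> first | (ring1) | (linear_combination (1/2) * r) | (linear_combination (-1/2) * r) | (grind))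
  | (refine Or.inr (Or.inr (Or.inr (Or.inr (Or.inl ⟨?_, ?_⟩)))) <;> first | (ring1) | (linear_combination (1/2) * r) | (linear_combination (-1/2) * r) | (grind))
  | (refine Or.inr (Or.inr (Or.inr (Or.inr (Or.inr (⟨?_, ?_⟩))))) <;> first | (ring1) | (linear_combination (1/2) * r) | (linear_combination (-1/2) * r) | (grind))

theorem auxR_long_pos (γ δ : Fin 2 → ℂ) (h : γ ∈ G2plus) (hd : δ ∈ [vα₁, vα₂, vα₃]) :
    auxR γ δ ∈ longRoots := by
  have r := aux_rt3_sq
  unfold auxR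
  rcases aux_G2plus_bil γ h with ⟨h, e⟩ | ⟨h, e⟩ <;> rw [e] <;>
  simp only [longRoots, List.mem_cons, List.not_mem_nil, or_false] at h hd ⊢ <;>
  rcases h with h | h | h <;> rcases hd with hd | hd | hd <;> subst h <;> subst hd <;>
  simp only [funext_iff, Fin.forall_fin_two, bil, vα₁, vα₂, vα₃, vβ₁, vβ₂, vβ₃, Pi.sub_apply,
    Pi.smul_apply, Pi.neg_apply, smul_eq_mul, Matrix.cons_val_zero, Matrix.cons_val_one] <;>
  first
  | (refine Or.inl ⟨?_, ?_⟩ <;> first | (ring1) | (linear_combination (1/2) * r) | (linear_combination (-1/2) * r) | (grind))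
  | (refine Or.inr (Or.inl ⟨?_, ?_⟩) <;> first | (ring1) | (linear_combination (1/2) * r) | (linear_combination (-1/2) * r) | (grind))
  | (refine Or.inr (Or.inr (Or.inl ⟨?_, ?_⟩)) <;> first | (ring1) | (linear_combination (1/2) * r) | (linear_combination (-1/2) * r) | (grind))
  | (refine Or.inr (Or.inr (Or.inr (Or.inl ⟨?_, ?_⟩))) <;> first | (ring1) | (linear_combination (1/2) * r) | (linear_combination (-1/2) * r) | (grind))
  | (refine Or.inr (Or.inr (Or.inr (Or.inr (Or.inl ⟨?_, ?_⟩)))) <;> first | (ring1) | (linear_combination (1/2) * r) | (linear_combination (-1/2) * r) | (grind))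
  | (refine Or.inr (Or.inr (Or.inr (Or.inr (Or.inr (⟨?_, ?_⟩))))) <;> first | (ring1) | (linear_combination (1/2) * r) | (linear_combination (-1/2) * r) | (grind))

theorem aux_pos_or_neg (γ : Fin 2 → ℂ) (h : γ ∈ G2all) : γ ∈ G2plus ∨ -γ ∈ G2plus := by
  simp only [G2all, shortRoots, longRoots, G2plus, List.mem_append, List.mem_cons,
    List.not_mem_nil, or_false] at h ⊢
  rcases h with (h | h | h | h | h | h) | (h | h | h | h | h | h) <;> subst h <;> simp

theorem auxR_short (γ δ : Fin 2 → ℂ) (h : γ ∈ G2all) (hd : δ ∈ shortRoots) :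
    auxR γ δ ∈ shortRoots := by
  wlog hp : γ ∈ G2plus generalizing γ with H
  · have h' := (aux_pos_or_neg γ h).resolve_left hp
    rw [← auxR_neg_left]
    refine H _ ?_ h'
    simp only [G2all, List.mem_append] at h ⊢
    exact h.imp (aux_neg_long _) (aux_neg_short _)
  simp only [shortRoots, List.mem_cons, List.not_mem_nil, or_false] at hd
  rcases hd with hd | hd | hd | hd | hd | hd <;> subst hd
  · exact auxR_short_pos _ _ hp (by simp)
  · exact auxR_short_pos _ _ hp (by simp)
  · exact auxR_short_pos _ _ hp (by simp)
  all_goals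
    rw [auxR_neg_right]
    exact aux_neg_short _ (auxR_short_pos _ _ hp (by simp))

theorem auxR_long (γ δ : Fin 2 → ℂ) (h : γ ∈ G2all) (hd : δ ∈ longRoots) :
    auxR γ δ ∈ longRoots := by
  wlog hp : γ ∈ G2plus generalizing γ with H
  · have h' := (aux_pos_or_neg γ h).resolve_left hp
    rw [← auxR_neg_left]
    refine H _ ?_ h'
    simp only [G2all, List.mem_append] at h ⊢
    exact h.imp (aux_neg_long _) (aux_neg_short _)
  simp only [longRoots, List.mem_cons, List.not_mem_nil, or_false] at hd
  rcases hd with hd | hd | hd | hd | hd | hd <;> subst hd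
  · exact auxR_long_pos _ _ hp (by simp)
  · exact auxR_long_pos _ _ hp (by simp)
  · exact auxR_long_pos _ _ hp (by simp)
  all_goals
    rw [auxR_neg_right]
    exact aux_neg_long _ (auxR_long_pos _ _ hp (by simp))

theorem aux_perm (L : List (Fin 2 → ℂ)) (hL : L.Nodup) (w : (Fin 2 → ℂ) ≃ₗ[ℂ] (Fin 2 → ℂ))
    (h : ∀ x ∈ L, w x ∈ L) : (L.map w).Perm L := by
  apply List.Subperm.perm_of_length_le
  · apply List.subperm_of_subset
    · exact hL.map w.injective
    · intro y hy
      obtain ⟨x, hx, rfl⟩ := List.mem_map.1 hy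
      exact h x hx
  · simp

/-- The symmetry properties of Weyl group elements that are used. -/
def AuxSym (w : (Fin 2 → ℂ) ≃ₗ[ℂ] (Fin 2 → ℂ)) : Prop :=
  (∀ x y, bil (w x) (w y) = bil x y) ∧ (shortRoots.map w).Perm shortRoots ∧
    (longRoots.map w).Perm longRoots

theorem aux_perm_inv (L : List (Fin 2 → ℂ)) (w : (Fin 2 → ℂ) ≃ₗ[ℂ] (Fin 2 → ℂ))
    (h : (L.map w).Perm L) : (L.map ⇑(w⁻¹)).Perm L := by
  have h1 := (h.map ⇑(w⁻¹)).symm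
  have e : (L.map w).map ⇑(w⁻¹) = L := by
    rw [List.map_map]
    have : (⇑(w⁻¹) ∘ ⇑w) = id := by
      funext x; exact w.symm_apply_apply x
    rw [this, List.map_id]
  rwa [e] at h1

theorem aux_sym_of_mem (w : (Fin 2 → ℂ) ≃ₗ[ℂ] (Fin 2 → ℂ)) (hw : w ∈ WeylG2) : AuxSym w := by
  unfold WeylG2 at hw
  induction hw using Subgroup.closure_induction with
  | mem w hw =>
    obtain ⟨γ, hγ, h, rfl⟩ := hw
    refine ⟨aux_refl_bil γ h, aux_perm _ aux_short_nodup _ ?_, aux_perm _ aux_long_nodup _ ?_⟩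
    · intro x hx
      rw [aux_refl_apply]
      exact auxR_short γ x hγ hx
    · intro x hx
      rw [aux_refl_apply]
      exact auxR_long γ x hγ hx
  | one =>
    refine ⟨fun _ _ => rfl, ?_, ?_⟩
    · exact List.Perm.of_eq (List.map_id _)
    · exact List.Perm.of_eq (List.map_id _)
  | mul u v _ _ hu hv =>
    refine ⟨fun x y => (hu.1 _ _).trans (hv.1 x y), ?_, ?_⟩
    · have := (hv.2.1.map u).trans hu.2.1
      rwa [List.map_map] at this
    · have := (hv.2.2.map u).trans hu.2.2
      rwa [List.map_map] at this
  | inv u _ hu =>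
    refine ⟨fun x y => ?_, aux_perm_inv _ _ hu.2.1, aux_perm_inv _ _ hu.2.2⟩
    rw [← hu.1]
    exact congrArg₂ bil (u.apply_symm_apply x) (u.apply_symm_apply y)

theorem aux_prod (L : List (Fin 2 → ℂ)) (w : (Fin 2 → ℂ) ≃ₗ[ℂ] (Fin 2 → ℂ))
    (h : (L.map w).Perm L) (p q : (Fin 2 → ℂ) → Bool) (F G : (Fin 2 → ℂ) → ℂ)
    (hp : ∀ x, p (w x) = q x) (hF : ∀ x, F (w x) = G x) :
    ((L.filter p).map F).prod = ((L.filter q).map G).prod := by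
  rw [← ((h.filter p).map F).prod_eq, List.filter_map, List.map_map]
  have e1 : p ∘ w = q := funext hp
  have e2 : F ∘ w = G := funext hF
  rw [e1, e2]

theorem aux_mem_iff (w : (Fin 2 → ℂ) ≃ₗ[ℂ] (Fin 2 → ℂ)) (h : (shortRoots.map w).Perm shortRoots)
    (τ : Fin 2 → ℂ) : w τ ∈ twoShort ↔ τ ∈ twoShort := by
  have e : (twoShort.map w).Perm twoShort := by
    have := h.map (fun γ => (2 : ℂ) • γ)
    unfold twoShort
    rw [List.map_map] at this ⊢
    convert this using 2
    funext x
    simp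
  rw [← e.mem_iff, List.mem_map]
  constructor
  · rintro ⟨x, hx, hxe⟩
    rwa [← w.injective hxe]
  · intro hx
    exact ⟨τ, hx, rfl⟩

theorem aux_main (m : ℕ) (w : (Fin 2 → ℂ) ≃ₗ[ℂ] (Fin 2 → ℂ)) (hw : AuxSym w)
    (τ z : Fin 2 → ℂ) : aD1 m (w τ) z = aD1 m τ (w⁻¹ z) := by
  obtain ⟨hb, hs, hl⟩ := hw
  have hz : ∀ x, bil (w x) z = bil x (w⁻¹ z) := by
    intro x
    rw [← hb x]
    exact congrArg (bil (w x)) (w.apply_symm_apply z).symm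
  unfold aD1
  simp only [aux_mem_iff w hs, ← map_smul w, hz, hb]
  congr 1
  · congr 2
    · congr 1
      apply aux_prod _ w hs
      · intro x; simp only [hb]
      · intro x; simp only [hb, hz]
    · apply aux_prod _ w hl
      · intro x; simp only [hb]
      · intro x; simp only [hb, hz]
  · congr 2
    · apply aux_prod _ w hs
      · intro x; simp only [hb]
      · intro x; simp only [hb, hz]
    · apply aux_prod _ w hl
      · intro x; simp only [hb]
      · intro x; simp only [hb, hz]

/-- `G₂`-symmetry of the coefficients of the operator `D₁`:
`a_{wτ}(z) = a_τ(w⁻¹z)` for all `w` in the Weyl group of `G₂`. -/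
theorem stmt_8 (m : ℕ) (hm : 1 ≤ m) :
    ∀ w ∈ WeylG2, ∀ τ ∈ twoG2, ∀ z : Fin 2 → ℂ,
      D1Reg z → D1Reg (w⁻¹ z) →
        aD1 m (w τ) z = aD1 m τ (w⁻¹ z) := by
  intro w hw τ _ z _ _
  exact aux_main m w (aux_sym_of_mem w hw) τ z

end
end
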